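/- (Basic Identity) Let (M,0) and (M',0) be germs of generic real-analytic submanifolds of ℂ^N of the same dimension, with M of minimum orbit codimension at 0 and M' l-nondegenerate at 0 (l ≥ 0), and choose coordinates as in the Setup. Then for every integer r > 0 there exists a germ of a holomorphic map Ψ^r : (ℂ × E^{r+l} × ℂ^{2N}, ℂ × E^{r+l}_0 × {0}) → (E^r, E^r_0) (and for r = 0 a germ Ψ^0 mapping into (E^0, 0)) whose components lie in the ring R^{r+l}_{2N}, such that for every k-equivalence H = (F,G) between (M,0) and (M',0) with k > r + l, one has for (Z,ζ) near the origin in ℂ^{2N}: 𝒥^r H(Z) = Ψ^r(1/det(F̄_χ(ζ)), 𝒥^{r+l}H̄(ζ), ζ, Z) + R_H^r(Z,ζ), where R_H^r is a germ at 0 of a holomorphic map from ℂ^{2N} into E^r whose restriction to the complexification 𝓜 vanishes of order k − r − l at 0. -/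

import Mathlib

open scoped BigOperators
open Complex

noncomputable section

abbrev Cn (N : ℕ) : Type := Fin N → ℂ
abbrev Rn (m : ℕ) : Type := Fin m → ℝ

/-- A local defining function for `M` near `p`. -/
def IsDefiningFun (N d : ℕ) (M : Set (Cn N)) (p : Cn N)
    (U : Set (Cn N)) (ρ : Cn N → Rn d) : Prop :=
  IsOpen U ∧ p ∈ U ∧ AnalyticOnNhd ℝ ρ U ∧
  (∀ z ∈ U, (z ∈ M ↔ ρ z = 0)) ∧
  ∀ z ∈ U, Function.Surjective (fderiv ℝ ρ z)

/-- `M` is a real-analytic submanifold of `ℂ^N` of (real) codimension `d`. -/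
def IsRASubmanifold (N d : ℕ) (M : Set (Cn N)) : Prop :=
  ∀ p ∈ M, ∃ U ρ, IsDefiningFun N d M p U ρ

/-- A real-analytic local parametrization of `M` (of codimension `d`) at `p`. -/
def IsLocalParam (N d : ℕ) (M : Set (Cn N)) (p : Cn N)
    (Ω : Set (Rn (2*N - d))) (Z : Rn (2*N - d) → Cn N) : Prop :=
  IsOpen Ω ∧ (0 : Rn (2*N-d)) ∈ Ω ∧ Z 0 = p ∧ AnalyticOnNhd ℝ Z Ω ∧
  Set.InjOn Z Ω ∧ (∀ x ∈ Ω, Function.Injective (fderiv ℝ Z x)) ∧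
  ∃ U : Set (Cn N), IsOpen U ∧ p ∈ U ∧ Z '' Ω = M ∩ U

/-- `H` is a `k`-equivalence between `(M,p)` and `(M',p')`. -/
def IsKEquivalence (N d : ℕ) (M M' : Set (Cn N)) (p p' : Cn N) (k : ℕ)
    (H : Cn N → Cn N) : Prop :=
  AnalyticAt ℂ H p ∧ H p = p' ∧ Function.Bijective (fderiv ℂ H p) ∧
  ∃ Ω Z, IsLocalParam N d M p Ω Z ∧
    ∀ U' ρ', IsDefiningFun N d M' p' U' ρ' →
      ∃ C ε : ℝ, 0 < ε ∧ ∀ x : Rn (2*N - d), ‖x‖ < ε →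
        ‖ρ' (H (Z x))‖ ≤ C * ‖x‖ ^ k

/-- `H` is a biholomorphic equivalence between `(M,p)` and `(M',p')`. -/
def IsBiholEquivalence (N : ℕ) (M M' : Set (Cn N)) (p p' : Cn N)
    (H : Cn N → Cn N) : Prop :=
  ∃ (U U' : Set (Cn N)) (Hinv : Cn N → Cn N),
    IsOpen U ∧ IsOpen U' ∧ p ∈ U ∧ p' ∈ U' ∧ H p = p' ∧
    AnalyticOnNhd ℂ H U ∧ AnalyticOnNhd ℂ Hinv U' ∧
    Set.BijOn H U U' ∧ (∀ z ∈ U, Hinv (H z) = z) ∧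
    H '' (M ∩ U) = M' ∩ U'

/-- `V` is a real-analytic subvariety of `M`: closed in `M` and locally the common zero
set of finitely many real-valued real-analytic functions. -/
def IsRASubvarietyOf (N : ℕ) (M V : Set (Cn N)) : Prop :=
  V ⊆ M ∧ (∃ C : Set (Cn N), IsClosed C ∧ V = M ∩ C) ∧
  ∀ p ∈ M, ∃ (U : Set (Cn N)) (m : ℕ) (f : Fin m → (Cn N → ℝ)),
    IsOpen U ∧ p ∈ U ∧ (∀ i, AnalyticOnNhd ℝ (f i) U) ∧
    V ∩ U = {z ∈ M ∩ U | ∀ i, f i z = 0}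

/-- Componentwise complex conjugation on `ℂ^N`. -/
def conjV (N : ℕ) (z : Cn N) : Cn N := fun i => (starRingEnd ℂ) (z i)

/-- The germ `H̄` whose power series coefficients are the complex conjugates of those
of `H`: `H̄(ζ) = conj (H (conj ζ))`. -/
def conjMap (N : ℕ) (H : Cn N → Cn N) : Cn N → Cn N :=
  fun ζ => conjV N (H (conjV N ζ))

/-! Coordinates `Z = (z,w,u) ∈ ℂ^n × ℂ^{d₁} × ℂ^{d₂}` on `ℂ^N`, `N = n + (d₁ + d₂)`,
and `(z',w') ∈ ℂ^n × ℂ^d`, `d = d₁ + d₂`, on the target. -/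

def zIdx (n d₁ d₂ : ℕ) (i : Fin n) : Fin (n + (d₁ + d₂)) := Fin.castAdd (d₁ + d₂) i
def wIdx (n d₁ d₂ : ℕ) (j : Fin d₁) : Fin (n + (d₁ + d₂)) := Fin.natAdd n (Fin.castAdd d₂ j)
def uIdx (n d₁ d₂ : ℕ) (j : Fin d₂) : Fin (n + (d₁ + d₂)) := Fin.natAdd n (Fin.natAdd d₁ j)
def wfIdx (n d₁ d₂ : ℕ) (j : Fin (d₁ + d₂)) : Fin (n + (d₁ + d₂)) := Fin.natAdd n j

def zPart (n d₁ d₂ : ℕ) (Z : Cn (n + (d₁ + d₂))) : Cn n := fun i => Z (zIdx n d₁ d₂ i)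
def wPart (n d₁ d₂ : ℕ) (Z : Cn (n + (d₁ + d₂))) : Cn d₁ := fun j => Z (wIdx n d₁ d₂ j)
def uPart (n d₁ d₂ : ℕ) (Z : Cn (n + (d₁ + d₂))) : Cn d₂ := fun j => Z (uIdx n d₁ d₂ j)
def wfPart (n d₁ d₂ : ℕ) (Z : Cn (n + (d₁ + d₂))) : Cn (d₁ + d₂) := fun j => Z (wfIdx n d₁ d₂ j)

/-- The point `(z,w,u) ∈ ℂ^N`. -/
def mk3 (n d₁ d₂ : ℕ) (z : Cn n) (w : Cn d₁) (u : Cn d₂) : Cn (n + (d₁ + d₂)) :=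
  Fin.append z (Fin.append w u)

/-- `M` is given near `0` by `u ∈ ℝ^{d₂}`, `w = Q(z, z̄, w̄, u)`, where `Q` is holomorphic
near `0` and satisfies the normality conditions `Q(z,0,τ,u) ≡ Q(0,χ,τ,u) ≡ τ`. -/
def QDescribes (n d₁ d₂ : ℕ) (Q : Cn n → Cn n → Cn d₁ → Cn d₂ → Cn d₁)
    (M : Set (Cn (n + (d₁ + d₂)))) : Prop :=
  AnalyticAt ℂ (fun p : (Cn n × Cn n) × (Cn d₁ × Cn d₂) => Q p.1.1 p.1.2 p.2.1 p.2.2) 0 ∧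
  (∃ ε : ℝ, 0 < ε ∧ ∀ (z χ : Cn n) (τ : Cn d₁) (u : Cn d₂),
    ‖z‖ < ε → ‖χ‖ < ε → ‖τ‖ < ε → ‖u‖ < ε → (Q z 0 τ u = τ ∧ Q 0 χ τ u = τ)) ∧
  ∃ ε : ℝ, 0 < ε ∧ ∀ Z : Cn (n + (d₁ + d₂)), ‖Z‖ < ε →
    (Z ∈ M ↔ ((∀ j, (Z (uIdx n d₁ d₂ j)).im = 0) ∧
      ∀ j, Z (wIdx n d₁ d₂ j) =
        Q (zPart n d₁ d₂ Z) (fun i => (starRingEnd ℂ) (zPart n d₁ d₂ Z i))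
          (fun i => (starRingEnd ℂ) (wPart n d₁ d₂ Z i)) (uPart n d₁ d₂ Z) j))

/-- `M'` is given near `0` in normal coordinates by `w' = Q'(z', z̄', w̄')`. -/
def QpDescribes (n d₁ d₂ : ℕ) (Q' : Cn n → Cn n → Cn (d₁ + d₂) → Cn (d₁ + d₂))
    (M' : Set (Cn (n + (d₁ + d₂)))) : Prop :=
  AnalyticAt ℂ (fun p : (Cn n × Cn n) × Cn (d₁ + d₂) => Q' p.1.1 p.1.2 p.2) 0 ∧
  (∃ ε : ℝ, 0 < ε ∧ ∀ (z χ : Cn n) (τ : Cn (d₁ + d₂)),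
    ‖z‖ < ε → ‖χ‖ < ε → ‖τ‖ < ε → (Q' z 0 τ = τ ∧ Q' 0 χ τ = τ)) ∧
  ∃ ε : ℝ, 0 < ε ∧ ∀ Z : Cn (n + (d₁ + d₂)), ‖Z‖ < ε →
    (Z ∈ M' ↔ ∀ j, Z (wfIdx n d₁ d₂ j) =
      Q' (zPart n d₁ d₂ Z) (fun i => (starRingEnd ℂ) (zPart n d₁ d₂ Z i))
        (fun i => (starRingEnd ℂ) (wfPart n d₁ d₂ Z i)) j)

/-- Iterated directional derivative along a list of directions. -/
def iterDeriv {E F : Type*} [NormedAddCommGroup E] [NormedSpace ℂ E]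
    [NormedAddCommGroup F] [NormedSpace ℂ F] : List E → (E → F) → E → F
  | [], f => f
  | v :: vs, f => iterDeriv vs fun x => fderiv ℂ f x v

/-- `M'`, given in normal coordinates by `Q'`, is `l`-nondegenerate at `0`:
`span_ℂ{Q'^j_{z'^β χ'}(0,0,0) : 1 ≤ j ≤ d, 1 ≤ |β| ≤ l} = ℂ^n`. -/
def QpLNondeg (n dd l : ℕ) (Q' : Cn n → Cn n → Cn dd → Cn dd) : Prop :=
  Submodule.span ℂ {v : Cn n | ∃ (j : Fin dd) (β : Fin n → ℕ),
    1 ≤ (∑ i, β i) ∧ (∑ i, β i) ≤ l ∧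
    v = fun i => iterDeriv
      ((((0 : Cn n), Pi.single i (1:ℂ), (0 : Cn dd)) : Cn n × Cn n × Cn dd) ::
        ((List.finRange n).flatMap fun i' => List.replicate (β i')
          (((Pi.single i' (1:ℂ) : Cn n), (0 : Cn n), (0 : Cn dd)) : Cn n × Cn n × Cn dd)))
      (fun P => Q' P.1 P.2.1 P.2.2 j) 0} = ⊤

/-- Multi-indices of total degree at most `r` in `m` variables. -/
abbrev MIdx (m r : ℕ) : Type := {dd : Fin m → Fin (r+1) // (∑ i, (dd i : ℕ)) ≤ r}

/-- The jet space `J^r_{m,l}` of `r`-jets at `0` of holomorphic maps `ℂ^m → ℂ^l`. -/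
abbrev JetSp (r m lt : ℕ) : Type := MIdx m r → (Fin lt → ℂ)

/-- The partial derivative `∂^β f` where the variables are selected by `idx`. -/
def mderivIdx {N : ℕ} {F : Type*} [NormedAddCommGroup F] [NormedSpace ℂ F]
    (m : ℕ) (idx : Fin m → Fin N) (β : Fin m → ℕ) (f : Cn N → F) : Cn N → F :=
  iterDeriv ((List.finRange m).flatMap fun i =>
    List.replicate (β i) ((Pi.single (idx i) (1:ℂ) : Cn N))) f

/-- The full `r`-jet `j^r H(Z) = (∂^α H(Z))_{|α| ≤ r}`. -/
def jetFull (N r : ℕ) (H : Cn N → Cn N) (Z : Cn N) : JetSp r N N :=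
  fun dd => mderivIdx N id (fun i => ((dd.1 i : ℕ))) H Z

/-- The component `F` of `H = (F,G)`. -/
def Fpart (n d₁ d₂ : ℕ) (H : Cn (n + (d₁ + d₂)) → Cn (n + (d₁ + d₂)))
    (Z : Cn (n + (d₁ + d₂))) : Cn n := fun i => H Z (zIdx n d₁ d₂ i)

/-- The component `G` of `H = (F,G)`. -/
def Gpart (n d₁ d₂ : ℕ) (H : Cn (n + (d₁ + d₂)) → Cn (n + (d₁ + d₂)))
    (Z : Cn (n + (d₁ + d₂))) : Cn (d₁ + d₂) := fun j => H Z (wfIdx n d₁ d₂ j)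

/-- The jet `(∂^ν_z G(Z))_{|ν| ≤ r}` of derivatives of `G` with respect to `z` only. -/
def jetZG (n d₁ d₂ r : ℕ) (H : Cn (n + (d₁ + d₂)) → Cn (n + (d₁ + d₂)))
    (Z : Cn (n + (d₁ + d₂))) : JetSp r n (d₁ + d₂) :=
  fun ν => mderivIdx n (zIdx n d₁ d₂) (fun i => ((ν.1 i : ℕ)))
    (fun W => Gpart n d₁ d₂ H W) Z

/-- The space `E^r = J^r_{N,N} × J^r_{n,d} × ℂ^n`, grouped as `E^r_0 × E^r_1`. -/
abbrev ESp (n d₁ d₂ r : ℕ) : Type :=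
  JetSp r (n + (d₁ + d₂)) (n + (d₁ + d₂)) × (JetSp r n (d₁ + d₂) × Cn n)

/-- `𝒥^r H(Z) = (j^r H(Z), (∂^ν_z G(Z))_ν, F(Z)) ∈ E^r`. -/
def calJ (n d₁ d₂ r : ℕ) (H : Cn (n + (d₁ + d₂)) → Cn (n + (d₁ + d₂)))
    (Z : Cn (n + (d₁ + d₂))) : ESp n d₁ d₂ r :=
  (jetFull (n + (d₁ + d₂)) r H Z, (jetZG n d₁ d₂ r H Z, Fpart n d₁ d₂ H Z))

/-- `det F_z(Z)`, the determinant of the Jacobian of `F` with respect to `z`. -/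
def detFz (n d₁ d₂ : ℕ) (H : Cn (n + (d₁ + d₂)) → Cn (n + (d₁ + d₂)))
    (Z : Cn (n + (d₁ + d₂))) : ℂ :=
  (Matrix.of fun i i' : Fin n =>
    fderiv ℂ (fun W => H W (zIdx n d₁ d₂ i)) Z (Pi.single (zIdx n d₁ d₂ i') 1)).det

/-- The complexification relation: `(Z,ζ) ∈ 𝓜` iff `v = u` and `w = Q(z,χ,τ,u)`. -/
def cxRel (n d₁ d₂ : ℕ) (Q : Cn n → Cn n → Cn d₁ → Cn d₂ → Cn d₁)
    (Z ζ : Cn (n + (d₁ + d₂))) : Prop :=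
  (∀ j, ζ (uIdx n d₁ d₂ j) = Z (uIdx n d₁ d₂ j)) ∧
  ∀ j, Z (wIdx n d₁ d₂ j) =
    Q (zPart n d₁ d₂ Z) (zPart n d₁ d₂ ζ) (wPart n d₁ d₂ ζ) (uPart n d₁ d₂ Z) j

/-- Polynomial functions on a complex vector space. -/
inductive IsPolyFun {V : Type*} [AddCommGroup V] [Module ℂ V] : (V → ℂ) → Prop
  | const (c : ℂ) : IsPolyFun fun _ => c
  | linear (φ : V →ₗ[ℂ] ℂ) : IsPolyFun fun x => φ x
  | add {f g : V → ℂ} : IsPolyFun f → IsPolyFun g → IsPolyFun fun x => f x + g x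
  | mul {f g : V → ℂ} : IsPolyFun f → IsPolyFun g → IsPolyFun fun x => f x * g x

/-- The ring `R(V₀ × V₁, V₀)` of germs along `V₀ × {0}` of holomorphic functions all of
whose partial derivatives restrict to polynomial functions on `V₀ × {0}`. -/
def MemRing (V0 V1 : Type*) [NormedAddCommGroup V0] [NormedSpace ℂ V0]
    [NormedAddCommGroup V1] [NormedSpace ℂ V1] (f : V0 × V1 → ℂ) : Prop :=
  (∃ Ω : Set (V0 × V1), IsOpen Ω ∧ (∀ x0 : V0, ((x0, 0) : V0 × V1) ∈ Ω) ∧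
    AnalyticOnNhd ℂ f Ω) ∧
  ∀ vs : List (V0 × V1), IsPolyFun fun x0 : V0 => iterDeriv vs f ((x0, 0) : V0 × V1)

/-- A map has components in the ring `R(V₀ × V₁, V₀)`. -/
def MemRingMap (V0 V1 F : Type*) [NormedAddCommGroup V0] [NormedSpace ℂ V0]
    [NormedAddCommGroup V1] [NormedSpace ℂ V1] [NormedAddCommGroup F] [NormedSpace ℂ F]
    (Ψ : V0 × V1 → F) : Prop :=
  ∀ φ : F →ₗ[ℂ] ℂ, MemRing V0 V1 fun x => φ (Ψ x)

section

open Filter Topology Asymptotics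
open scoped ContDiff

/-! ### Iterated directional derivatives -/

section IterDeriv

variable {E E' F F' : Type*} [NormedAddCommGroup E] [NormedSpace ℂ E]
  [NormedAddCommGroup E'] [NormedSpace ℂ E']
  [NormedAddCommGroup F] [NormedSpace ℂ F] [NormedAddCommGroup F'] [NormedSpace ℂ F']

lemma AnalyticAt.dirDeriv [CompleteSpace F] {f : E → F} {x : E} (hf : AnalyticAt ℂ f x) (v : E) :
    AnalyticAt ℂ (fun y => fderiv ℂ f y v) x :=
  ((ContinuousLinearMap.apply ℂ F v).analyticAt _).comp hf.fderiv

lemma AnalyticAt.iterDeriv [CompleteSpace F] {x : E} (vs : List E) {f : E → F}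
    (hf : AnalyticAt ℂ f x) : AnalyticAt ℂ (iterDeriv vs f) x := by
  induction vs generalizing f with
  | nil => exact hf
  | cons v vs ih => exact ih (hf.dirDeriv v)

lemma Filter.EventuallyEq.dirDeriv {f g : E → F} {x : E} (h : f =ᶠ[𝓝 x] g) (v : E) :
    (fun y => fderiv ℂ f y v) =ᶠ[𝓝 x] fun y => fderiv ℂ g y v := by
  filter_upwards [h.fderiv (𝕜 := ℂ)] with y hy
  rw [hy]

lemma Filter.EventuallyEq.iterDeriv {x : E} (vs : List E) {f g : E → F} (h : f =ᶠ[𝓝 x] g) :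
    iterDeriv vs f =ᶠ[𝓝 x] iterDeriv vs g := by
  induction vs generalizing f g with
  | nil => exact h
  | cons v vs ih => exact ih (h.dirDeriv v)

lemma iterDeriv_append (vs ws : List E) (f : E → F) :
    iterDeriv (vs ++ ws) f = iterDeriv ws (iterDeriv vs f) := by
  induction vs generalizing f with
  | nil => rfl
  | cons v vs ih => exact ih _

lemma iterDeriv_concat (vs : List E) (v : E) (f : E → F) :
    iterDeriv (vs ++ [v]) f = fun x => fderiv ℂ (iterDeriv vs f) x v := by
  rw [iterDeriv_append]; rfl

lemma dirDeriv_comm [CompleteSpace F] {f : E → F} {x : E} (hf : AnalyticAt ℂ f x) (v w : E) :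
    fderiv ℂ (fun y => fderiv ℂ f y v) x w = fderiv ℂ (fun y => fderiv ℂ f y w) x v := by
  have h1 : ∀ u : E, HasFDerivAt (fun y => fderiv ℂ f y u)
      ((ContinuousLinearMap.apply ℂ F u).comp (fderiv ℂ (fderiv ℂ f) x)) x := fun u =>
    (ContinuousLinearMap.apply ℂ F u).hasFDerivAt.comp x
      hf.fderiv.differentiableAt.hasFDerivAt
  rw [(h1 v).fderiv, (h1 w).fderiv]
  have := (hf.contDiffAt (n := ⊤)).isSymmSndFDerivAt_of_omega
  exact this w v

lemma iterDeriv_perm [CompleteSpace F] {vs ws : List E} (h : vs.Perm ws) {f : E → F} {x : E}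
    (hf : AnalyticAt ℂ f x) : iterDeriv vs f x = iterDeriv ws f x := by
  induction h generalizing f with
  | nil => rfl
  | cons v _ ih => exact ih (hf.dirDeriv v)
  | swap v w l =>
    refine Filter.EventuallyEq.eq_of_nhds (Filter.EventuallyEq.iterDeriv l ?_)
    filter_upwards [hf.eventually_analyticAt] with y hy
    exact dirDeriv_comm hy w v
  | trans _ _ ih1 ih2 => exact (ih1 hf).trans (ih2 hf)

lemma iterDeriv_clm_comp [CompleteSpace F] [CompleteSpace F'] (L : F →L[ℂ] F') (vs : List E)
    {f : E → F} {x : E} (hf : AnalyticAt ℂ f x) :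
    iterDeriv vs (fun y => L (f y)) x = L (iterDeriv vs f x) := by
  induction vs generalizing f with
  | nil => rfl
  | cons v vs ih =>
    rw [iterDeriv, iterDeriv, ← ih (hf.dirDeriv v)]
    refine Filter.EventuallyEq.eq_of_nhds (Filter.EventuallyEq.iterDeriv vs ?_)
    filter_upwards [hf.eventually_analyticAt] with y hy
    have := (L.hasFDerivAt.comp y hy.differentiableAt.hasFDerivAt).fderiv
    simp only [Function.comp_def] at this
    rw [this]; rfl

lemma iterDeriv_comp_clm [CompleteSpace F] (L : E' →L[ℂ] E) (vs : List E')
    {f : E → F} {x : E'} (hf : AnalyticAt ℂ f (L x)) :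
    iterDeriv vs (fun y => f (L y)) x = iterDeriv (vs.map L) f (L x) := by
  induction vs generalizing f with
  | nil => rfl
  | cons v vs ih =>
    rw [iterDeriv, List.map_cons, iterDeriv, ← ih (hf.dirDeriv (L v))]
    refine Filter.EventuallyEq.eq_of_nhds (Filter.EventuallyEq.iterDeriv vs ?_)
    filter_upwards [L.continuous.continuousAt.eventually hf.eventually_analyticAt] with y hy
    have := (hy.differentiableAt.hasFDerivAt.comp y L.hasFDerivAt).fderiv
    simp only [Function.comp_def] at this
    rw [this]; rfl

end IterDeriv

/-! ### Complex conjugation of holomorphic germs -/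

section Star

variable {E F : Type*} [NormedAddCommGroup E] [NormedSpace ℂ E]
  [StarAddMonoid E] [NormedStarGroup E] [StarModule ℂ E]
  [NormedAddCommGroup F] [NormedSpace ℂ F]
  [StarAddMonoid F] [NormedStarGroup F] [StarModule ℂ F]

/-- The conjugate of a continuous multilinear map. -/
def ContinuousMultilinearMap.starConj {m : ℕ} (p : ContinuousMultilinearMap ℂ (fun _ : Fin m => E) F) :
    ContinuousMultilinearMap ℂ (fun _ : Fin m => E) F where
  toFun v := star (p fun i => star (v i))
  map_update_add' v i x y := by
    have h : ∀ z : E, (fun j => star (Function.update v i z j))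
        = Function.update (fun j => star (v j)) i (star z) := fun z => by
      ext j; by_cases hj : j = i <;> simp [hj]
    simp only [h, star_add, p.map_update_add]
  map_update_smul' v i c x := by
    have h : ∀ z : E, (fun j => star (Function.update v i z j))
        = Function.update (fun j => star (v j)) i (star z) := fun z => by
      ext j; by_cases hj : j = i <;> simp [hj]
    simp only [h, star_smul, p.map_update_smul, RCLike.star_def, RingHomCompTriple.comp_apply,
      RingHom.id_apply]
  cont := by
    refine continuous_star.comp (p.cont.comp ?_)
    exact continuous_pi fun i => continuous_star.comp (continuous_apply i)

lemma AnalyticAt.starConj {f : E → F} {x : E} (hf : AnalyticAt ℂ f (star x)) :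
    AnalyticAt ℂ (fun y => star (f (star y))) x := by
  obtain ⟨p, r, hp⟩ := hf
  refine ⟨fun m => (p m).starConj, r, ?_, hp.r_pos, ?_⟩
  · refine hp.r_le.trans (ENNReal.le_of_forall_nnreal_lt fun s hs => ?_)
    refine FormalMultilinearSeries.le_radius_of_bound _ ((p.norm_mul_pow_le_of_lt_radius hs).choose)
      fun m => ?_
    refine le_trans ?_ ((p.norm_mul_pow_le_of_lt_radius hs).choose_spec.2 m)
    gcongr
    refine ContinuousMultilinearMap.opNorm_le_bound (norm_nonneg _) fun v => ?_
    change ‖star (p m fun i => star (v i))‖ ≤ _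
    rw [norm_star]
    refine ((p m).le_opNorm _).trans ?_
    simp [norm_star]
  · intro y hy
    have h := hp.hasSum (y := star y) (by simpa [Metric.mem_eball, edist_zero_right, enorm_eq_nnnorm, nnnorm_star] using hy)
    have h2 := h.map (starAddEquiv : F ≃+ F) continuous_star
    simp only [Function.comp_def, starAddEquiv_apply] at h2
    rw [← star_add] at h2
    exact h2

lemma HasFDerivAt.starConj {f : E → F} {x : E} {f' : E →L[ℂ] F} (hf : HasFDerivAt f f' (star x)) :
    HasFDerivAt (fun y => star (f (star y)))
      (((starL ℂ : F ≃L⋆[ℂ] F) : F →L⋆[ℂ] F).comp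
        (f'.comp ((starL ℂ : E ≃L⋆[ℂ] E) : E →L⋆[ℂ] E))) x := by
  rw [hasFDerivAt_iff_isLittleO_nhds_zero] at hf ⊢
  have h1 : Tendsto (star : E → E) (𝓝 0) (𝓝 0) := by
    simpa using (continuous_star (R := E)).tendsto (0 : E)
  have := hf.comp_tendsto h1
  rw [← Asymptotics.isLittleO_norm_norm] at this ⊢
  refine this.congr (fun h => ?_) (fun h => by simp [norm_star])
  rw [Function.comp_apply, ← norm_star]
  simp [star_add, star_sub]

lemma dirDeriv_starConj {f : E → F} {x v : E} (hf : DifferentiableAt ℂ f (star x)) :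
    fderiv ℂ (fun y => star (f (star y))) x v = star (fderiv ℂ f (star x) (star v)) := by
  rw [(hf.hasFDerivAt.starConj).fderiv]; rfl

lemma iterDeriv_starConj [CompleteSpace F] (vs : List E) {f : E → F} {x : E}
    (hf : AnalyticAt ℂ f (star x)) :
    iterDeriv vs (fun y => star (f (star y))) x = star (iterDeriv (vs.map star) f (star x)) := by
  induction vs generalizing f with
  | nil => rfl
  | cons v vs ih =>
    rw [iterDeriv, List.map_cons, iterDeriv, ← ih (hf.dirDeriv (star v))]
    refine Filter.EventuallyEq.eq_of_nhds (Filter.EventuallyEq.iterDeriv vs ?_)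
    filter_upwards [continuous_star.continuousAt.eventually hf.eventually_analyticAt] with y hy
    exact dirDeriv_starConj hy.differentiableAt

end Star

/-! ### The ring `R(V₀ × V₁, V₀)` -/

section IsPolyFun

variable {V W : Type*} [AddCommGroup V] [Module ℂ V] [AddCommGroup W] [Module ℂ W]

lemma IsPolyFun.comp_linear {f : V → ℂ} (hf : IsPolyFun f) (L : W →ₗ[ℂ] V) :
    IsPolyFun fun x => f (L x) := by
  induction hf with
  | const c => exact .const c
  | linear φ => exact .linear (φ.comp L)
  | add _ _ h1 h2 => exact h1.add h2
  | mul _ _ h1 h2 => exact h1.mul h2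

end IsPolyFun

section Ring

variable {V0 V1 : Type*} [NormedAddCommGroup V0] [NormedSpace ℂ V0]
  [NormedAddCommGroup V1] [NormedSpace ℂ V1]

/-- The condition defining `MemRing`, for derivatives of order at most `m` only. -/
def PolyTo (m : ℕ) (f : V0 × V1 → ℂ) : Prop :=
  (∀ x0 : V0, AnalyticAt ℂ f (x0, 0)) ∧
  ∀ vs : List (V0 × V1), vs.length ≤ m →
    IsPolyFun fun x0 : V0 => iterDeriv vs f ((x0, 0) : V0 × V1)

lemma memRing_iff {f : V0 × V1 → ℂ} : MemRing V0 V1 f ↔ ∀ m, PolyTo m f := by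
  constructor
  · rintro ⟨⟨Ω, -, h0, ha⟩, h2⟩ m
    exact ⟨fun x0 => ha _ (h0 x0), fun vs _ => h2 vs⟩
  · intro h
    exact ⟨⟨{x | AnalyticAt ℂ f x}, isOpen_analyticAt ℂ f, (h 0).1, fun x hx => hx⟩,
      fun vs => (h vs.length).2 vs le_rfl⟩

lemma MemRing.analyticAt {f : V0 × V1 → ℂ} (hf : MemRing V0 V1 f) (x0 : V0) :
    AnalyticAt ℂ f (x0, 0) := (memRing_iff.1 hf 0).1 x0

lemma polyTo_zero_iff {f : V0 × V1 → ℂ} : PolyTo 0 f ↔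
    (∀ x0 : V0, AnalyticAt ℂ f (x0, 0)) ∧ IsPolyFun fun x0 : V0 => f (x0, 0) := by
  refine and_congr_right fun _ => ⟨fun h => h [] le_rfl, fun h vs hvs => ?_⟩
  obtain rfl : vs = [] := List.length_eq_zero_iff.1 (Nat.le_zero.1 hvs)
  exact h

lemma polyTo_succ_iff {m : ℕ} {f : V0 × V1 → ℂ} : PolyTo (m + 1) f ↔
    PolyTo 0 f ∧ ∀ v, PolyTo m fun x => fderiv ℂ f x v := by
  constructor
  · intro h
    refine ⟨⟨h.1, fun vs hvs => h.2 vs (by omega)⟩, fun v => ⟨fun x0 => (h.1 x0).dirDeriv v,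
      fun vs hvs => h.2 (v :: vs) (by simpa using hvs)⟩⟩
  · rintro ⟨h0, h⟩
    refine ⟨h0.1, fun vs hvs => ?_⟩
    match vs with
    | [] => exact h0.2 [] le_rfl
    | v :: vs => exact (h v).2 vs (by simpa using hvs)

lemma PolyTo.mono {m k : ℕ} (hmk : m ≤ k) {f : V0 × V1 → ℂ} (h : PolyTo k f) : PolyTo m f :=
  ⟨h.1, fun vs hvs => h.2 vs (hvs.trans hmk)⟩

lemma PolyTo.congr {m : ℕ} {f g : V0 × V1 → ℂ} (hf : PolyTo m f)
    (h : ∀ x0 : V0, f =ᶠ[𝓝 (x0, 0)] g) : PolyTo m g := by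
  refine ⟨fun x0 => (hf.1 x0).congr (h x0), fun vs hvs => ?_⟩
  convert hf.2 vs hvs using 2 with x0
  exact ((h x0).iterDeriv vs).eq_of_nhds.symm

lemma polyTo_const (m : ℕ) (c : ℂ) : PolyTo m fun _ : V0 × V1 => c := by
  induction m generalizing c with
  | zero => exact polyTo_zero_iff.2 ⟨fun _ => analyticAt_const, .const c⟩
  | succ m ih =>
    refine polyTo_succ_iff.2 ⟨polyTo_zero_iff.2 ⟨fun _ => analyticAt_const, .const c⟩, fun v => ?_⟩
    simpa using ih 0

lemma PolyTo.add {m : ℕ} {f g : V0 × V1 → ℂ} (hf : PolyTo m f) (hg : PolyTo m g) :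
    PolyTo m fun x => f x + g x := by
  induction m generalizing f g with
  | zero =>
    rw [polyTo_zero_iff] at *
    exact ⟨fun x0 => (hf.1 x0).add (hg.1 x0), hf.2.add hg.2⟩
  | succ m ih =>
    rw [polyTo_succ_iff] at *
    rw [polyTo_zero_iff] at *
    refine ⟨⟨fun x0 => (hf.1.1 x0).add (hg.1.1 x0), hf.1.2.add hg.1.2⟩, fun v => ?_⟩
    refine (ih (hf.2 v) (hg.2 v)).congr fun x0 => ?_
    filter_upwards [(hf.1.1 x0).eventually_analyticAt, (hg.1.1 x0).eventually_analyticAt]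
      with x h1 h2
    rw [fderiv_fun_add h1.differentiableAt h2.differentiableAt]; rfl

lemma PolyTo.mul {m : ℕ} {f g : V0 × V1 → ℂ} (hf : PolyTo m f) (hg : PolyTo m g) :
    PolyTo m fun x => f x * g x := by
  induction m generalizing f g with
  | zero =>
    rw [polyTo_zero_iff] at *
    exact ⟨fun x0 => (hf.1 x0).mul (hg.1 x0), hf.2.mul hg.2⟩
  | succ m ih =>
    have hf' := hf.mono m.le_succ
    have hg' := hg.mono m.le_succ
    rw [polyTo_succ_iff] at hf hg ⊢
    rw [polyTo_zero_iff] at *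
    refine ⟨⟨fun x0 => (hf.1.1 x0).mul (hg.1.1 x0), hf.1.2.mul hg.1.2⟩, fun v => ?_⟩
    refine ((ih hf' (hg.2 v)).add (ih (hf.2 v) hg')).congr fun x0 => ?_
    filter_upwards [(hf.1.1 x0).eventually_analyticAt, (hg.1.1 x0).eventually_analyticAt]
      with x h1 h2
    rw [fderiv_fun_mul h1.differentiableAt h2.differentiableAt]
    simp [mul_comm]

lemma PolyTo.sum {ι : Type*} {m : ℕ} {f : ι → V0 × V1 → ℂ} (s : Finset ι)
    (hf : ∀ i ∈ s, PolyTo m (f i)) : PolyTo m fun x => ∑ i ∈ s, f i x := by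
  classical
  induction s using Finset.induction_on with
  | empty => simpa using polyTo_const m 0
  | insert i s hi ih =>
    simp only [Finset.sum_insert hi]
    exact (hf i (by simp)).add (ih fun j hj => hf j (by simp [hj]))

lemma polyTo_linear (m : ℕ) (φ : V0 × V1 →L[ℂ] ℂ) : PolyTo m φ := by
  have h0 : PolyTo 0 (φ : V0 × V1 → ℂ) := polyTo_zero_iff.2 ⟨fun _ => φ.analyticAt _,
    .linear ((φ : V0 × V1 →ₗ[ℂ] ℂ).comp (LinearMap.inl ℂ V0 V1))⟩
  cases m with
  | zero => exact h0
  | succ m =>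
    refine polyTo_succ_iff.2 ⟨h0, fun v => ?_⟩
    simpa using polyTo_const m (φ v)

lemma fderiv_comp_pi {E ι : Type*} [NormedAddCommGroup E] [NormedSpace ℂ E] [Fintype ι]
    [DecidableEq ι] {F : E → ι → ℂ} {g : (ι → ℂ) → ℂ} {x : E}
    (hF : ∀ i, DifferentiableAt ℂ (fun y => F y i) x) (hg : DifferentiableAt ℂ g (F x)) (v : E) :
    fderiv ℂ (fun y => g (F y)) x v =
      ∑ i, fderiv ℂ (fun y => F y i) x v * fderiv ℂ g (F x) (Pi.single i 1) := by
  have hF' : HasFDerivAt F (ContinuousLinearMap.pi fun i => fderiv ℂ (fun y => F y i) x) x :=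
    hasFDerivAt_pi.2 fun i => (hF i).hasFDerivAt
  have := (hg.hasFDerivAt.comp x hF').fderiv
  simp only [Function.comp_def] at this
  rw [this, ContinuousLinearMap.comp_apply]
  conv_lhs => rw [← (Pi.basisFun ℂ ι).sum_repr (ContinuousLinearMap.pi _ v), map_sum]
  simp

lemma PolyTo.comp_analyticAt {ι : Type*} [Fintype ι] {m : ℕ} {F : V0 × V1 → ι → ℂ}
    (hF : ∀ i, PolyTo m fun x => F x i) (c : ι → ℂ) (hc : ∀ x0, F (x0, 0) = c) {g : (ι → ℂ) → ℂ}
    (hg : AnalyticAt ℂ g c) : PolyTo m fun x => g (F x) := by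
  classical
  have h0 : ∀ {g : (ι → ℂ) → ℂ}, AnalyticAt ℂ g c → PolyTo 0 fun x => g (F x) := fun {g} hg =>
    polyTo_zero_iff.2 ⟨fun x0 => AnalyticAt.fun_comp (by rwa [hc])
      (AnalyticAt.pi fun i => (hF i).1 x0), by simpa only [hc] using .const (g c)⟩
  induction m generalizing g with
  | zero => exact h0 hg
  | succ m ih =>
    refine polyTo_succ_iff.2 ⟨h0 hg, fun v => ?_⟩
    refine (PolyTo.sum Finset.univ fun i _ =>
      ((polyTo_succ_iff.1 (hF i)).2 v).mul
        (ih (fun i => (hF i).mono m.le_succ) (hg.dirDeriv (Pi.single i 1)))).congr fun x0 => ?_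
    have hcont : Tendsto F (𝓝 (x0, 0)) (𝓝 c) := by
      rw [← hc x0]
      exact (AnalyticAt.pi fun i => (hF i).1 x0).continuousAt
    filter_upwards [eventually_all.2 fun i => ((hF i).1 x0).eventually_analyticAt,
      hcont.eventually hg.eventually_analyticAt] with x h1 h2
    exact (fderiv_comp_pi (fun i => (h1 i).differentiableAt) h2.differentiableAt v).symm

lemma memRing_const (c : ℂ) : MemRing V0 V1 fun _ => c := memRing_iff.2 fun m => polyTo_const m c

lemma memRing_linear (φ : V0 × V1 →L[ℂ] ℂ) : MemRing V0 V1 φ :=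
  memRing_iff.2 fun m => polyTo_linear m φ

lemma MemRing.add {f g : V0 × V1 → ℂ} (hf : MemRing V0 V1 f) (hg : MemRing V0 V1 g) :
    MemRing V0 V1 fun x => f x + g x :=
  memRing_iff.2 fun m => (memRing_iff.1 hf m).add (memRing_iff.1 hg m)

lemma MemRing.mul {f g : V0 × V1 → ℂ} (hf : MemRing V0 V1 f) (hg : MemRing V0 V1 g) :
    MemRing V0 V1 fun x => f x * g x :=
  memRing_iff.2 fun m => (memRing_iff.1 hf m).mul (memRing_iff.1 hg m)

lemma MemRing.neg {f : V0 × V1 → ℂ} (hf : MemRing V0 V1 f) : MemRing V0 V1 fun x => -f x := by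
  simpa using (memRing_const (-1)).mul hf

lemma MemRing.sub {f g : V0 × V1 → ℂ} (hf : MemRing V0 V1 f) (hg : MemRing V0 V1 g) :
    MemRing V0 V1 fun x => f x - g x := by
  simpa [sub_eq_add_neg] using hf.add hg.neg

lemma MemRing.sum {ι : Type*} {f : ι → V0 × V1 → ℂ} (s : Finset ι)
    (hf : ∀ i ∈ s, MemRing V0 V1 (f i)) : MemRing V0 V1 fun x => ∑ i ∈ s, f i x :=
  memRing_iff.2 fun m => PolyTo.sum s fun i hi => memRing_iff.1 (hf i hi) m

lemma MemRing.prod {ι : Type*} {f : ι → V0 × V1 → ℂ} (s : Finset ι)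
    (hf : ∀ i ∈ s, MemRing V0 V1 (f i)) : MemRing V0 V1 fun x => ∏ i ∈ s, f i x := by
  classical
  induction s using Finset.induction_on with
  | empty => simpa using memRing_const 1
  | insert i s hi ih =>
    simp only [Finset.prod_insert hi]
    exact (hf i (by simp)).mul (ih fun j hj => hf j (by simp [hj]))

lemma MemRing.det {ι : Type*} [Fintype ι] [DecidableEq ι] {A : V0 × V1 → Matrix ι ι ℂ}
    (hA : ∀ i j, MemRing V0 V1 fun x => A x i j) : MemRing V0 V1 fun x => (A x).det := by
  simp only [Matrix.det_apply']
  exact MemRing.sum _ fun σ _ => (memRing_const _).mul (MemRing.prod _ fun i _ => hA _ _)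

lemma MemRing.adjugate {ι : Type*} [Fintype ι] [DecidableEq ι] {A : V0 × V1 → Matrix ι ι ℂ}
    (hA : ∀ i j, MemRing V0 V1 fun x => A x i j) (i j : ι) :
    MemRing V0 V1 fun x => (A x).adjugate i j := by
  simp only [Matrix.adjugate_apply]
  refine MemRing.det fun i' j' => ?_
  by_cases h : i' = j
  · subst h; simpa using memRing_const _
  · simpa [h] using hA i' j'

lemma MemRing.comp_analyticAt {ι : Type*} [Fintype ι] {F : V0 × V1 → ι → ℂ}
    (hF : ∀ i, MemRing V0 V1 fun x => F x i) (c : ι → ℂ) (hc : ∀ x0, F (x0, 0) = c)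
    {g : (ι → ℂ) → ℂ} (hg : AnalyticAt ℂ g c) : MemRing V0 V1 fun x => g (F x) :=
  memRing_iff.2 fun m => PolyTo.comp_analyticAt (fun i => memRing_iff.1 (hF i) m) c hc hg

lemma MemRing.dirDeriv {f : V0 × V1 → ℂ} (hf : MemRing V0 V1 f) (v : V0 × V1) :
    MemRing V0 V1 fun x => fderiv ℂ f x v :=
  memRing_iff.2 fun m => (polyTo_succ_iff.1 (memRing_iff.1 hf (m + 1))).2 v

lemma MemRing.congr {f g : V0 × V1 → ℂ} (hf : MemRing V0 V1 f)
    (h : ∀ x0 : V0, f =ᶠ[𝓝 (x0, 0)] g) : MemRing V0 V1 g :=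
  memRing_iff.2 fun m => (memRing_iff.1 hf m).congr h

variable {V0' V1' : Type*} [NormedAddCommGroup V0'] [NormedSpace ℂ V0']
  [NormedAddCommGroup V1'] [NormedSpace ℂ V1']

lemma MemRing.comp_prodMap {f : V0 × V1 → ℂ} (hf : MemRing V0 V1 f) (L0 : V0' →L[ℂ] V0)
    (L1 : V1' →L[ℂ] V1) : MemRing V0' V1' fun x => f (L0.prodMap L1 x) := by
  have h0 : ∀ x0, L0.prodMap L1 (x0, 0) = (L0 x0, 0) := fun x0 => by simp
  refine memRing_iff.2 fun m => ⟨fun x0 => ?_, fun vs _ => ?_⟩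
  · exact AnalyticAt.fun_comp (by rw [h0]; exact hf.analyticAt _)
      ((L0.prodMap L1).analyticAt _)
  · have := ((memRing_iff.1 hf vs.length).2 (vs.map (L0.prodMap L1)) (by simp)).comp_linear
      (L0 : V0' →ₗ[ℂ] V0)
    convert this using 2 with x0
    rw [iterDeriv_comp_clm _ _ (by rw [h0]; exact hf.analyticAt _), h0]; rfl

lemma MemRing.of_snd {g : V1 → ℂ} (hg : AnalyticAt ℂ g 0) [FiniteDimensional ℂ V1] :
    MemRing V0 V1 fun x => g x.2 := by
  let b := Module.finBasis ℂ V1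
  let e := b.equivFun.toContinuousLinearEquiv
  have h : MemRing V0 V1 fun x => (fun c => g (e.symm c)) (e x.2) := by
    refine MemRing.comp_analyticAt (F := fun x : V0 × V1 => e x.2) (fun i => ?_) 0 (fun x0 => by simp)
      (AnalyticAt.fun_comp (by simpa using hg) (e.symm.analyticAt 0))
    exact memRing_linear ((ContinuousLinearMap.proj (R := ℂ) (φ := fun _ => ℂ) i).comp
      ((e : V1 →L[ℂ] (Fin _ → ℂ)).comp (ContinuousLinearMap.snd ℂ V0 V1)))
  simpa using h

section Maps

variable {F G : Type*} [NormedAddCommGroup F] [NormedSpace ℂ F]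
  [NormedAddCommGroup G] [NormedSpace ℂ G]

lemma MemRing.memRingMap {f : V0 × V1 → ℂ} (hf : MemRing V0 V1 f) : MemRingMap V0 V1 ℂ f := by
  intro φ
  have : ∀ x, φ (f x) = φ 1 * f x := fun x => by
    rw [mul_comm, ← smul_eq_mul, ← map_smul, smul_eq_mul, mul_one]
  simp only [this]
  exact (memRing_const _).mul hf

lemma MemRingMap.prodMk {f : V0 × V1 → F} {g : V0 × V1 → G} (hf : MemRingMap V0 V1 F f)
    (hg : MemRingMap V0 V1 G g) : MemRingMap V0 V1 (F × G) fun x => (f x, g x) := by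
  intro φ
  have : ∀ x, φ (f x, g x) = φ.comp (LinearMap.inl ℂ F G) (f x)
      + φ.comp (LinearMap.inr ℂ F G) (g x) := fun x => by
    simp [← map_add]
  simp only [this]
  exact (hf _).add (hg _)

lemma memRingMap_pi {ι : Type*} [Fintype ι] {f : V0 × V1 → ι → F}
    (hf : ∀ i, MemRingMap V0 V1 F fun x => f x i) : MemRingMap V0 V1 (ι → F) f := by
  classical
  intro φ
  have : ∀ x, φ (f x) = ∑ i, φ.comp (LinearMap.single ℂ (fun _ => F) i) (f x i) := fun x => by
    simp only [LinearMap.comp_apply, ← map_sum]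
    congr 1
    ext j
    simp
  simp only [this]
  exact MemRing.sum _ fun i _ => hf i _

lemma MemRingMap.analyticAt [FiniteDimensional ℂ F] {f : V0 × V1 → F} (hf : MemRingMap V0 V1 F f)
    (x0 : V0) : AnalyticAt ℂ f (x0, 0) := by
  let e := (Module.finBasis ℂ F).equivFun.toContinuousLinearEquiv
  have h : AnalyticAt ℂ (fun x => e (f x)) (x0, 0) := AnalyticAt.pi fun i =>
    (hf ((LinearMap.proj (R := ℂ) (φ := fun _ => ℂ) i).comp
      (e.toLinearEquiv : F →ₗ[ℂ] (Fin _ → ℂ)))).analyticAt x0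
  simpa using (e.symm.analyticAt _).fun_comp h

lemma MemRingMap.comp_linear {f : V0 × V1 → F} (hf : MemRingMap V0 V1 F f) (L : F →ₗ[ℂ] G) :
    MemRingMap V0 V1 G fun x => L (f x) := fun φ => hf (φ.comp L)

/-- Differentiating an element of the ring along a vector field with components in the ring. -/
lemma MemRing.fderiv_apply [FiniteDimensional ℂ V0] [FiniteDimensional ℂ V1] {f : V0 × V1 → ℂ}
    (hf : MemRing V0 V1 f) (L0 : V0' →L[ℂ] V0) (L1 : V1' →L[ℂ] V1) {D : V0' × V1' → V0 × V1}
    (hD : MemRingMap V0' V1' (V0 × V1) D) :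
    MemRing V0' V1' fun x => fderiv ℂ f (L0.prodMap L1 x) (D x) := by
  let b := Module.finBasis ℂ (V0 × V1)
  have : ∀ x, fderiv ℂ f (L0.prodMap L1 x) (D x)
      = ∑ i, b.coord i (D x) * fderiv ℂ f (L0.prodMap L1 x) (b i) := fun x => by
    conv_lhs => rw [← b.sum_repr (D x), map_sum]
    simp
  simp only [this]
  exact MemRing.sum _ fun i _ => (hD _).mul ((hf.dirDeriv (b i)).comp_prodMap L0 L1)

end Maps

end Ring

/-! ### Orders of vanishing -/

section Order

variable {E : Type*} [NormedAddCommGroup E] [NormedSpace ℂ E]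

lemma isBigO_pow_of_le {E : Type*} [NormedAddCommGroup E] {j k : ℕ} (h : j ≤ k) :
    (fun y : E => ‖y‖ ^ k) =O[𝓝 0] fun y => ‖y‖ ^ j := by
  refine IsBigO.of_bound 1 ?_
  filter_upwards [Metric.ball_mem_nhds (0 : E) one_pos] with y hy
  rw [norm_pow, norm_pow, norm_norm, one_mul]
  exact pow_le_pow_of_le_one (norm_nonneg _) (mem_ball_zero_iff.1 hy).le h

lemma ContinuousAt.isBigO_pow_zero {E F : Type*} [NormedAddCommGroup E] [NormedAddCommGroup F]
    {f : E → F} (hf : ContinuousAt f 0) : f =O[𝓝 0] fun y => ‖y‖ ^ 0 := by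
  simpa using hf.isBigO_one ℝ

/-- Cauchy estimate: differentiation lowers the order of vanishing by at most one. -/
lemma AnalyticAt.isBigO_dirDeriv {f : E → ℂ} (hf : AnalyticAt ℂ f 0) {k : ℕ}
    (h : f =O[𝓝 0] fun y => ‖y‖ ^ k) (v : E) :
    (fun y => fderiv ℂ f y v) =O[𝓝 0] fun y => ‖y‖ ^ (k - 1) := by
  rcases Nat.lt_or_ge k 2 with hk | hk
  · obtain hk : k - 1 = 0 := by omega
    rw [hk]
    exact (hf.dirDeriv v).continuousAt.isBigO_pow_zero
  obtain ⟨C, hC⟩ := h.bound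
  obtain ⟨ε, hε, hb⟩ := Metric.eventually_nhds_iff_ball.1 (hC.and hf.eventually_analyticAt)
  have hD0 : fderiv ℂ f 0 = 0 :=
    (IsBigO.hasFDerivAt (x₀ := (0 : E)) (n := k) (by simpa using h) (by omega)).fderiv
  refine IsBigO.of_bound (C * 2 ^ k * (‖v‖ + 1)) ?_
  filter_upwards [Metric.ball_mem_nhds (0 : E) (half_pos hε)] with y hy
  rw [mem_ball_zero_iff] at hy
  rcases eq_or_ne y 0 with rfl | hy0
  · rw [hD0]
    obtain ⟨m, hm⟩ : ∃ m, k - 1 = m + 1 := ⟨k - 2, by omega⟩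
    simp [hm]
  have hyp : 0 < ‖y‖ := norm_pos_iff.2 hy0
  have hv : 0 < ‖v‖ + 1 := by positivity
  set R := ‖y‖ / (‖v‖ + 1) with hR
  have hRp : 0 < R := by positivity
  have hle : ∀ t ∈ Metric.closedBall (0 : ℂ) R, ‖y + t • v‖ ≤ 2 * ‖y‖ := by
    intro t ht
    rw [mem_closedBall_zero_iff] at ht
    have h1 : ‖t • v‖ ≤ R * (‖v‖ + 1) := by
      rw [norm_smul]
      gcongr
      linarith
    rw [hR, div_mul_cancel₀ _ hv.ne'] at h1
    linarith [norm_add_le y (t • v)]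
  have hmem : ∀ t ∈ Metric.closedBall (0 : ℂ) R, y + t • v ∈ Metric.ball (0 : E) ε := fun t ht => by
    rw [mem_ball_zero_iff]
    linarith [hle t ht]
  have hder : ∀ t ∈ Metric.closedBall (0 : ℂ) R,
      HasDerivAt (fun t : ℂ => f (y + t • v)) (fderiv ℂ f (y + t • v) v) t := fun t ht => by
    have h1 : HasDerivAt (fun t : ℂ => y + t • v) v t := by
      simpa using ((hasDerivAt_id t).smul_const v).const_add y
    exact ((hb _ (hmem t ht)).2.differentiableAt.hasFDerivAt).comp_hasDerivAt t h1
  have hdc : DiffContOnCl ℂ (fun t : ℂ => f (y + t • v)) (Metric.ball 0 R) := by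
    refine DifferentiableOn.diffContOnCl fun t ht => ?_
    rw [closure_ball _ hRp.ne'] at ht
    exact (hder t ht).differentiableAt.differentiableWithinAt
  have key := norm_deriv_le_of_forall_mem_sphere_norm_le (C := C * (2 * ‖y‖) ^ k) hRp hdc
    fun t ht => by
      have ht' := Metric.sphere_subset_closedBall ht
      have h1 := (hb _ (hmem t ht')).1
      rw [norm_pow, norm_norm] at h1
      have hC0 : 0 ≤ C := by
        have h2 := (hb y (by rw [mem_ball_zero_iff]; linarith)).1
        rw [norm_pow, norm_norm] at h2
        by_contra hneg
        push Not at hneg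
        nlinarith [norm_nonneg (f y), pow_pos hyp k]
      refine h1.trans ?_
      gcongr
      exact hle t ht'
  rw [(hder 0 (by simp [hRp.le])).deriv] at key
  simp only [zero_smul, add_zero] at key
  refine key.trans (le_of_eq ?_)
  obtain ⟨m, rfl⟩ : ∃ m, k = m + 1 := ⟨k - 1, by omega⟩
  rw [hR, norm_pow, norm_norm, Nat.add_sub_cancel]
  field_simp
  ring

lemma AnalyticAt.isBigO_iterDeriv {f : E → ℂ} (hf : AnalyticAt ℂ f 0) {k : ℕ}
    (h : f =O[𝓝 0] fun y => ‖y‖ ^ k) (vs : List E) :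
    _root_.iterDeriv vs f =O[𝓝 0] fun y => ‖y‖ ^ (k - vs.length) := by
  induction vs generalizing f k with
  | nil => exact h
  | cons v vs ih =>
    have := ih (hf.dirDeriv v) (hf.isBigO_dirDeriv h v)
    rwa [Nat.sub_sub, Nat.add_comm] at this

lemma AnalyticAt.iterDeriv_eq_zero {f : E → ℂ} (hf : AnalyticAt ℂ f 0) {k : ℕ}
    (h : f =O[𝓝 0] fun y => ‖y‖ ^ k) {vs : List E} (hvs : vs.length < k) :
    _root_.iterDeriv vs f 0 = 0 := by
  refine IsBigO.eq_zero_of_norm_pow (x₀ := (0 : E)) (n := k - vs.length) ?_ (by omega)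
  simpa using hf.isBigO_iterDeriv h vs

/-- A holomorphic germ which vanishes of order `k` along a generic real submanifold of real
dimension equal to the complex dimension vanishes of order `k`. -/
lemma AnalyticAt.isBigO_of_real {X : Type*} [NormedAddCommGroup X] [NormedSpace ℝ X]
    [NormedSpace ℝ E] [IsScalarTower ℝ ℂ E] {g : E → ℂ} (hg : AnalyticAt ℂ g 0) {γ : X → E}
    {γ' : X →L[ℝ] E} (hγ0 : γ 0 = 0) (hγ : HasFDerivAt γ γ' 0)
    (hspan : ∀ y, ∃ s t, y = γ' s + I • γ' t) {k : ℕ}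
    (hO : (fun x => g (γ x)) =O[𝓝 0] fun x => ‖x‖ ^ k) : g =O[𝓝 0] fun y => ‖y‖ ^ k := by
  have hcs : ∀ (c : ℝ) (v : E), (c : ℂ) • v = c • v := fun c v => by
    rw [← smul_one_smul ℂ c v]
    simp
  obtain ⟨p, hp⟩ := hg
  have taylor : ∀ j, (∀ i < j, ∀ y, (p i fun _ => y) = 0) →
      (fun y => g y - p j fun _ => y) =O[𝓝 0] fun y => ‖y‖ ^ (j + 1) := by
    intro j hj
    refine (hp.isBigO_sub_partialSum_pow (j + 1)).congr_left fun y => ?_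
    simp only [FormalMultilinearSeries.partialSum, zero_add, Finset.sum_range_succ]
    rw [Finset.sum_eq_zero fun i hi => hj i (Finset.mem_range.1 hi) y, zero_add]
  suffices H : ∀ j ≤ k, (∀ i < j, ∀ y, (p i fun _ => y) = 0) by
    cases k with
    | zero => exact hp.continuousAt.isBigO_pow_zero
    | succ j =>
      refine (taylor j fun i hi => H (j + 1) le_rfl i (by omega)).congr_left fun y => ?_
      rw [H (j + 1) le_rfl j (by omega), sub_zero]
  intro j
  induction j with
  | zero => intro _ i hi; omega
  | succ j ih =>
    intro hjk i hi y
    have ih := ih (by omega)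
    rcases Nat.lt_succ_iff_lt_or_eq.1 hi with hi | rfl
    · exact ih i hi y
    set P : E → ℂ := fun y => p i fun _ => y with hP
    have hPc : Continuous P := (p i).cont.comp (continuous_pi fun _ => continuous_id)
    have hreal : ∀ x, P (γ' x) = 0 := by
      intro x
      have hline : HasDerivAt (fun t : ℝ => t • x) x 0 := by
        simpa using (hasDerivAt_id (0 : ℝ)).smul_const x
      have hd : HasDerivAt (fun t : ℝ => γ (t • x)) (γ' x) 0 :=
        HasFDerivAt.comp_hasDerivAt (0 : ℝ) (by simpa using hγ) hline
      have hsl : Tendsto (fun t : ℝ => t⁻¹ • γ (t • x)) (𝓝[≠] 0) (𝓝 (γ' x)) := by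
        simpa [slope_fun_def, hγ0] using hasDerivAt_iff_tendsto_slope.1 hd
      have hcx : Tendsto (fun t : ℝ => t • x) (𝓝 0) (𝓝 0) := by
        simpa using hline.continuousAt.tendsto
      have h1 : (fun t : ℝ => t • x) =O[𝓝 0] fun t : ℝ => t := by
        simpa using hline.isBigO_sub
      have h2 : (fun t : ℝ => γ (t • x)) =O[𝓝 0] fun t : ℝ => t := by
        simpa [hγ0] using hd.isBigO_sub
      have hcg : Tendsto (fun t : ℝ => γ (t • x)) (𝓝 0) (𝓝 0) := by
        simpa [hγ0] using hd.continuousAt.tendsto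
      have e1 : (fun t : ℝ => g (γ (t • x))) =O[𝓝 0] fun t : ℝ => t ^ (i + 1) :=
        ((hO.comp_tendsto hcx).trans ((isBigO_pow_of_le hjk).comp_tendsto hcx)).trans
          (h1.norm_left.pow (i + 1))
      have e2 : (fun t : ℝ => g (γ (t • x)) - P (γ (t • x))) =O[𝓝 0] fun t : ℝ => t ^ (i + 1) :=
        ((taylor i ih).comp_tendsto hcg).trans (h2.norm_left.pow (i + 1))
      have e3 : (fun t : ℝ => P (γ (t • x))) =O[𝓝 0] fun t : ℝ => t ^ (i + 1) :=
        (e1.sub e2).congr_left fun t => by ring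
      have e4 : Tendsto (fun t : ℝ => P (t⁻¹ • γ (t • x))) (𝓝[≠] 0) (𝓝 0) := by
        have e5 : (fun t : ℝ => P (t⁻¹ • γ (t • x))) =O[𝓝[≠] 0] fun t : ℝ => t := by
          obtain ⟨C, hC⟩ := e3.bound
          refine IsBigO.of_bound C ?_
          filter_upwards [nhdsWithin_le_nhds hC, self_mem_nhdsWithin] with t ht ht0
          have ht0 : t ≠ 0 := ht0
          have : P (t⁻¹ • γ (t • x)) = ((t : ℂ)⁻¹) ^ i * P (γ (t • x)) := by
            have hsm : t⁻¹ • γ (t • x) = ((t : ℂ)⁻¹) • γ (t • x) := by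
              rw [← Complex.ofReal_inv, hcs]
            rw [hsm]
            have := (p i).map_smul_univ (fun _ => (t : ℂ)⁻¹) (fun _ => γ (t • x))
            simpa [hP] using this
          rw [this, norm_mul, norm_pow, norm_inv, Complex.norm_real]
          rw [norm_pow] at ht
          have htp : 0 < ‖t‖ := norm_pos_iff.2 ht0
          calc ‖t‖⁻¹ ^ i * ‖P (γ (t • x))‖ ≤ ‖t‖⁻¹ ^ i * (C * ‖t‖ ^ (i + 1)) := by gcongr
            _ = C * ‖t‖ := by
              rw [inv_pow]
              field_simp
              ring
        exact e5.trans_tendsto (tendsto_id.mono_left nhdsWithin_le_nhds)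
      exact tendsto_nhds_unique ((hPc.tendsto _).comp hsl) e4
    obtain ⟨s, t, rfl⟩ := hspan y
    have han : AnalyticOnNhd ℂ (fun c : ℂ => P (γ' s + c • γ' t)) Set.univ := fun c _ => by
      have hl : AnalyticAt ℂ (fun c : ℂ => γ' s + c • γ' t) c := by fun_prop
      have : AnalyticAt ℂ (fun v : Fin i → E => p i v) (fun _ => γ' s + c • γ' t) :=
        (p i).analyticAt
      exact this.fun_comp (f := fun (c : ℂ) (_ : Fin i) => γ' s + c • γ' t) (AnalyticAt.pi fun _ => hl)
    have hz := han.eq_of_frequently_eq (g := fun _ => 0) (z₀ := 0) (fun _ _ => analyticAt_const) ?_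
    · exact congrFun hz I
    · have ht : Tendsto ((↑) : ℝ → ℂ) (𝓝[≠] 0) (𝓝[≠] 0) := by
        refine tendsto_nhdsWithin_iff.2 ⟨?_, ?_⟩
        · simpa using (Complex.continuous_ofReal.tendsto 0).mono_left nhdsWithin_le_nhds
        · filter_upwards [self_mem_nhdsWithin] with c hc
          simpa using hc
      refine ht.frequently (Eventually.frequently (Eventually.of_forall fun c => ?_))
      rw [hcs, ← map_smul, ← map_add, hreal]

lemma AnalyticAt.eventually_eq_zero_of_isBigO {g : E → ℂ} (hg : AnalyticAt ℂ g 0)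
    (h : ∀ k : ℕ, g =O[𝓝 0] fun y => ‖y‖ ^ k) : ∀ᶠ y in 𝓝 0, g y = 0 := by
  obtain ⟨p, hp⟩ := hg
  have H : ∀ j y, (p j fun _ => y) = 0 := by
    intro j
    induction j using Nat.strong_induction_on with
    | _ j ih =>
      refine IsBigO.continuousMultilinearMap_apply_eq_zero ?_
      refine ((h (j + 1)).sub (hp.isBigO_sub_partialSum_pow (j + 1))).congr_left fun y => ?_
      simp only [FormalMultilinearSeries.partialSum, zero_add, Finset.sum_range_succ]
      rw [Finset.sum_eq_zero fun i hi => ih i (Finset.mem_range.1 hi) y]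
      ring
  filter_upwards [hp.eventually_hasSum] with y hy
  simp only [H, zero_add] at hy
  exact hy.unique hasSum_zero

/-- A function vanishing on the zero set of a submersion is controlled by it. -/
lemma isBigO_of_zero_on_zeroSet {E F G : Type*} [NormedAddCommGroup E] [NormedSpace ℝ E]
    [NormedAddCommGroup F] [NormedSpace ℝ F] [NormedAddCommGroup G] [NormedSpace ℝ G]
    [FiniteDimensional ℝ E] [FiniteDimensional ℝ F] {f : E → G} {f' : E →L[ℝ] G} {ρ : E → F}
    {ρ' : E →L[ℝ] F} (hf : HasStrictFDerivAt f f' 0) (hρ : HasStrictFDerivAt ρ ρ' 0)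
    (hsurj : Function.Surjective ρ') (hρ0 : ρ 0 = 0) (h : ∀ᶠ p in 𝓝 0, ρ p = 0 → f p = 0) :
    f =O[𝓝 0] ρ := by
  obtain ⟨R0, hR0⟩ := (ρ' : E →ₗ[ℝ] F).exists_rightInverse_of_surjective
    (LinearMap.range_eq_top.2 hsurj)
  let R : F →L[ℝ] E := R0.toContinuousLinearMap
  have hR : ∀ y, ρ' (R y) = y := fun y => LinearMap.congr_fun hR0 y
  have : CompleteSpace E := FiniteDimensional.complete ℝ E
  let Φ : E → E := fun p => p - R (ρ' p) + R (ρ p)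
  have hΦ : HasStrictFDerivAt Φ ((ContinuousLinearEquiv.refl ℝ E : E ≃L[ℝ] E) : E →L[ℝ] E) 0 := by
    have : HasStrictFDerivAt Φ (ContinuousLinearMap.id ℝ E - R.comp ρ' + R.comp ρ') 0 :=
      ((hasStrictFDerivAt_id (𝕜 := ℝ) (0 : E)).sub
        ((R.comp ρ').hasStrictFDerivAt (x := 0))).add (R.hasStrictFDerivAt.comp 0 hρ)
    rwa [sub_add_cancel] at this
  have hΦ0 : Φ 0 = 0 := by simp [Φ, hρ0]
  set inv := hΦ.localInverse Φ _ 0 with hinv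
  have hl : ∀ᶠ p in 𝓝 0, inv (Φ p) = p := hΦ.eventually_left_inverse
  have hr : ∀ᶠ y in 𝓝 0, Φ (inv y) = y := by
    simpa only [hΦ0] using hΦ.eventually_right_inverse
  have hs : HasStrictFDerivAt inv
      ((ContinuousLinearEquiv.refl ℝ E).symm : E →L[ℝ] E) 0 := by
    simpa only [hΦ0] using hΦ.to_localInverse
  have hi0 : inv 0 = 0 := by
    have := hl.self_of_nhds
    rwa [hΦ0] at this
  have hΦt : Tendsto Φ (𝓝 0) (𝓝 0) := by
    simpa only [hΦ0] using hΦ.hasFDerivAt.continuousAt.tendsto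
  have hyt : Tendsto (fun p => Φ p - R (ρ p)) (𝓝 0) (𝓝 0) := by
    have h1 : Tendsto (fun p => R (ρ p)) (𝓝 0) (𝓝 0) := by
      have := (R.continuous.continuousAt.comp hρ.hasFDerivAt.continuousAt).tendsto
      simpa [Function.comp_def, hρ0] using this
    simpa using hΦt.sub h1
  have hqt : Tendsto (fun p => inv (Φ p - R (ρ p))) (𝓝 0) (𝓝 0) := by
    have := hs.hasFDerivAt.continuousAt.tendsto
    rw [hi0] at this
    exact this.comp hyt
  have hρΦ : ∀ p, ρ' (Φ p) = ρ p := fun p => by simp [Φ, hR]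
  have hq0 : ∀ᶠ p in 𝓝 0, f (inv (Φ p - R (ρ p))) = 0 := by
    filter_upwards [hqt.eventually h, hyt.eventually hr] with p h1 h2
    apply h1
    rw [← hρΦ, h2, map_sub, hρΦ, hR, sub_self]
  have b1 : (fun p => f p - f (inv (Φ p - R (ρ p)))) =O[𝓝 0]
      fun p => p - inv (Φ p - R (ρ p)) := by
    have := hf.isBigO_sub.comp_tendsto (Filter.Tendsto.prodMk_nhds tendsto_id hqt)
    exact this
  have b2 : (fun p => inv (Φ p) - inv (Φ p - R (ρ p))) =O[𝓝 0]
      fun p => Φ p - (Φ p - R (ρ p)) := by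
    have := hs.isBigO_sub.comp_tendsto (Filter.Tendsto.prodMk_nhds hΦt hyt)
    exact this
  have b3 : (fun p => Φ p - (Φ p - R (ρ p))) =O[𝓝 0] ρ := by
    simpa using R.isBigO_comp ρ (𝓝 0)
  refine IsBigO.trans (g := fun p => p - inv (Φ p - R (ρ p))) ?_ ?_
  · refine b1.congr' ?_ EventuallyEq.rfl
    filter_upwards [hq0] with p hp
    rw [hp, sub_zero]
  · refine (b2.trans b3).congr' ?_ EventuallyEq.rfl
    filter_upwards [hl] with p hp
    rw [hp]

lemma AnalyticAt.isBigO_comp_sub {X F G : Type*} [NormedAddCommGroup F] [NormedSpace ℂ F]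
    [NormedAddCommGroup G] [NormedSpace ℂ G] {g : F → G} {c : F} (hg : AnalyticAt ℂ g c)
    {l : Filter X} {u v : X → F} (hu : Tendsto u l (𝓝 c)) (hv : Tendsto v l (𝓝 c)) :
    (fun x => g (u x) - g (v x)) =O[l] fun x => u x - v x :=
  hg.hasStrictFDerivAt.isBigO_sub.comp_tendsto (hu.prodMk_nhds hv)

end Order

/-! ### Coordinates and the complexification -/

/-- Concatenation of coordinates as a continuous linear map. -/
def appendL (a b : ℕ) : (Cn a × Cn b) →L[ℂ] Cn (a + b) :=
  ContinuousLinearMap.pi fun i => Fin.addCases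
    (fun j => (ContinuousLinearMap.proj j).comp (ContinuousLinearMap.fst ℂ (Cn a) (Cn b)))
    (fun j => (ContinuousLinearMap.proj j).comp (ContinuousLinearMap.snd ℂ (Cn a) (Cn b))) i

lemma appendL_apply {a b : ℕ} (p : Cn a × Cn b) : appendL a b p = Fin.append p.1 p.2 := by
  funext i
  refine Fin.addCases (fun j => ?_) (fun j => ?_) i <;> simp [appendL]

section Coord

variable {n d₁ d₂ : ℕ}

/-- The coordinate projections as continuous linear maps. -/
def zL (n d₁ d₂ : ℕ) : Cn (n + (d₁ + d₂)) →L[ℂ] Cn n :=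
  ContinuousLinearMap.pi fun i => ContinuousLinearMap.proj (zIdx n d₁ d₂ i)

def wfL (n d₁ d₂ : ℕ) : Cn (n + (d₁ + d₂)) →L[ℂ] Cn (d₁ + d₂) :=
  ContinuousLinearMap.pi fun i => ContinuousLinearMap.proj (wfIdx n d₁ d₂ i)

def wL (n d₁ d₂ : ℕ) : Cn (n + (d₁ + d₂)) →L[ℂ] Cn d₁ :=
  ContinuousLinearMap.pi fun i => ContinuousLinearMap.proj (wIdx n d₁ d₂ i)

def uL (n d₁ d₂ : ℕ) : Cn (n + (d₁ + d₂)) →L[ℂ] Cn d₂ :=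
  ContinuousLinearMap.pi fun i => ContinuousLinearMap.proj (uIdx n d₁ d₂ i)

lemma zPart_append (z : Cn n) (t : Cn (d₁ + d₂)) : zPart n d₁ d₂ (Fin.append z t) = z := by
  funext i; simp [zPart, zIdx]

lemma wfPart_append (z : Cn n) (t : Cn (d₁ + d₂)) : wfPart n d₁ d₂ (Fin.append z t) = t := by
  funext i; simp [wfPart, wfIdx]

lemma append_zPart_wfPart (Z : Cn (n + (d₁ + d₂))) :
    Fin.append (zPart n d₁ d₂ Z) (wfPart n d₁ d₂ Z) = Z := by
  funext i
  refine Fin.addCases (fun j => ?_) (fun j => ?_) i <;> simp [zPart, wfPart, zIdx, wfIdx]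

lemma mk3_parts (Z : Cn (n + (d₁ + d₂))) :
    mk3 n d₁ d₂ (zPart n d₁ d₂ Z) (wPart n d₁ d₂ Z) (uPart n d₁ d₂ Z) = Z := by
  funext i
  refine Fin.addCases (fun j => ?_) (fun j => ?_) i
  · simp [mk3, zPart, zIdx]
  · refine Fin.addCases (fun j => ?_) (fun j => ?_) j <;> simp [mk3, wPart, uPart, wIdx, uIdx]

lemma append_zero_zero {a b : ℕ} : Fin.append (0 : Cn a) (0 : Cn b) = 0 := by
  funext i
  refine Fin.addCases (fun j => ?_) (fun j => ?_) i <;> simp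

lemma wPart_mk3 (z : Cn n) (w : Cn d₁) (u : Cn d₂) : wPart n d₁ d₂ (mk3 n d₁ d₂ z w u) = w := by
  funext i; simp [wPart, wIdx, mk3]

lemma uPart_mk3 (z : Cn n) (w : Cn d₁) (u : Cn d₂) : uPart n d₁ d₂ (mk3 n d₁ d₂ z w u) = u := by
  funext i; simp [uPart, uIdx, mk3]

lemma zPart_mk3 (z : Cn n) (w : Cn d₁) (u : Cn d₂) : zPart n d₁ d₂ (mk3 n d₁ d₂ z w u) = z := by
  funext i; simp [zPart, zIdx, mk3]

/-- Points of the complexification, with `(Z, χ)` as coordinates, satisfy `ζ = β(Z, χ)`. -/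
def betaMap (n d₁ d₂ : ℕ) (Q : Cn n → Cn n → Cn d₁ → Cn d₂ → Cn d₁)
    (y : Cn (n + (d₁ + d₂)) × Cn n) : Cn (n + (d₁ + d₂)) :=
  mk3 n d₁ d₂ y.2 (star (Q (star y.2) (star (zPart n d₁ d₂ y.1)) (star (wPart n d₁ d₂ y.1))
    (star (uPart n d₁ d₂ y.1)))) (uPart n d₁ d₂ y.1)

/-- The properties of `betaMap` which are used below. -/
structure IsNiceBeta (n d₁ d₂ : ℕ) (β : Cn (n + (d₁ + d₂)) × Cn n → Cn (n + (d₁ + d₂))) : Prop where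
  an : AnalyticAt ℂ β 0
  zPart : ∀ y, zPart n d₁ d₂ (β y) = y.2
  left : ∀ᶠ χ in 𝓝 (0 : Cn n), β (0, χ) = Fin.append χ 0
  right : ∀ᶠ z in 𝓝 (0 : Cn n), β (Fin.append z 0, 0) = 0

variable {Q : Cn n → Cn n → Cn d₁ → Cn d₂ → Cn d₁} {M : Set (Cn (n + (d₁ + d₂)))}

lemma isNiceBeta_betaMap (hQ : QDescribes n d₁ d₂ Q M) :
    IsNiceBeta n d₁ d₂ (betaMap n d₁ d₂ Q) := by
  obtain ⟨han, ⟨ε, hε, hn⟩, -⟩ := hQ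
  have hst : ∀ m : ℕ, ContinuousAt (star : Cn m → Cn m) 0 := fun m => continuous_star.continuousAt
  have hsm : ∀ m : ℕ, ∀ᶠ z in 𝓝 (0 : Cn m), ‖z‖ < ε := fun m => by
    filter_upwards [Metric.ball_mem_nhds (0 : Cn m) hε] with z hz using mem_ball_zero_iff.1 hz
  refine ⟨?_, fun y => zPart_mk3 _ _ _, ?_, ?_⟩
  · have h1 : AnalyticAt ℂ (fun p : (Cn n × Cn n) × (Cn d₁ × Cn d₂) =>
        star (Q (star p.1.1) (star p.1.2) (star p.2.1) (star p.2.2))) 0 :=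
      AnalyticAt.starConj (x := (0 : (Cn n × Cn n) × (Cn d₁ × Cn d₂))) (by simpa using han)
    let Lz : (Cn (n + (d₁ + d₂)) × Cn n) →L[ℂ] ((Cn n × Cn n) × (Cn d₁ × Cn d₂)) :=
      ((ContinuousLinearMap.snd ℂ _ _).prod ((zL n d₁ d₂).comp (ContinuousLinearMap.fst ℂ _ _))).prod
        (((wL n d₁ d₂).comp (ContinuousLinearMap.fst ℂ _ _)).prod
          ((uL n d₁ d₂).comp (ContinuousLinearMap.fst ℂ _ _)))
    have h2 : AnalyticAt ℂ (fun y : Cn (n + (d₁ + d₂)) × Cn n => appendL n (d₁ + d₂) (y.2,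
        appendL d₁ d₂ (star (Q (star (Lz y).1.1) (star (Lz y).1.2) (star (Lz y).2.1)
          (star (Lz y).2.2)), uL n d₁ d₂ y.1))) 0 := by
      refine (appendL n (d₁ + d₂)).analyticAt _ |>.fun_comp ?_
      refine analyticAt_snd.prod ?_
      refine (appendL d₁ d₂).analyticAt _ |>.fun_comp ?_
      refine AnalyticAt.prod ?_ ?_
      · exact AnalyticAt.fun_comp (g := fun p : (Cn n × Cn n) × (Cn d₁ × Cn d₂) =>
          star (Q (star p.1.1) (star p.1.2) (star p.2.1) (star p.2.2))) (by rwa [map_zero])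
          (Lz.analyticAt 0)
      · exact ((uL n d₁ d₂).analyticAt _).fun_comp analyticAt_fst
    refine h2.congr (Eventually.of_forall fun y => ?_)
    simp only [appendL_apply]
    rfl
  · filter_upwards [hsm n] with χ hχ
    have := (hn (star χ) 0 0 0 (by rwa [norm_star]) (by simpa) (by simpa) (by simpa)).1
    have hz : zPart n d₁ d₂ 0 = 0 := rfl
    have hw : wPart n d₁ d₂ 0 = 0 := rfl
    have hu : uPart n d₁ d₂ 0 = 0 := rfl
    simp [betaMap, mk3, hz, hw, hu, this, append_zero_zero]
  · filter_upwards [hsm n] with z hz'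
    have := (hn 0 (star z) 0 0 (by simpa) (by rwa [norm_star]) (by simpa) (by simpa)).2
    have hz : zPart n d₁ d₂ (Fin.append z 0) = z := zPart_append z 0
    have hw : wPart n d₁ d₂ (Fin.append z 0) = 0 := by
      rw [← append_zero_zero]; exact wPart_mk3 z 0 0
    have hu : uPart n d₁ d₂ (Fin.append z 0) = 0 := by
      rw [← append_zero_zero]; exact uPart_mk3 z 0 0
    simp [betaMap, mk3, hz, hw, hu, this, append_zero_zero]

end Coord

/-! ### Real points of the complexification -/

section Real

variable {n d₁ d₂ : ℕ} {Q : Cn n → Cn n → Cn d₁ → Cn d₂ → Cn d₁} {M : Set (Cn (n + (d₁ + d₂)))}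

lemma QDescribes.fderiv_apply (hQ : QDescribes n d₁ d₂ Q M)
    (v : (Cn n × Cn n) × (Cn d₁ × Cn d₂)) :
    fderiv ℂ (fun p : (Cn n × Cn n) × (Cn d₁ × Cn d₂) => Q p.1.1 p.1.2 p.2.1 p.2.2) 0 v
      = v.2.1 := by
  obtain ⟨han, ⟨ε, hε, hn⟩, -⟩ := hQ
  set f := fun p : (Cn n × Cn n) × (Cn d₁ × Cn d₂) => Q p.1.1 p.1.2 p.2.1 p.2.2 with hf
  have hd := han.differentiableAt.hasFDerivAt
  let i₁ : (Cn n × (Cn d₁ × Cn d₂)) →L[ℂ] ((Cn n × Cn n) × (Cn d₁ × Cn d₂)) :=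
    ((ContinuousLinearMap.fst ℂ _ _).prod 0).prod (ContinuousLinearMap.snd ℂ _ _)
  let i₂ : Cn n →L[ℂ] ((Cn n × Cn n) × (Cn d₁ × Cn d₂)) :=
    ContinuousLinearMap.prod ((0 : Cn n →L[ℂ] Cn n).prod (ContinuousLinearMap.id ℂ _)) 0
  have hsm : ∀ {E : Type} [NormedAddCommGroup E], ∀ᶠ z in 𝓝 (0 : E), ‖z‖ < ε := fun {E} _ => by
    filter_upwards [Metric.ball_mem_nhds (0 : E) hε] with z hz using mem_ball_zero_iff.1 hz
  have h1 : ∀ p, fderiv ℂ f 0 (i₁ p) = p.2.1 := by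
    intro p
    have hc : HasFDerivAt (fun q => f (i₁ q)) ((fderiv ℂ f 0).comp i₁) 0 :=
      HasFDerivAt.comp (g := f) (f := i₁) (0 : Cn n × (Cn d₁ × Cn d₂)) (by rwa [map_zero]) i₁.hasFDerivAt
    have he : (fun q => f (i₁ q)) =ᶠ[𝓝 0] ((ContinuousLinearMap.fst ℂ (Cn d₁) (Cn d₂)).comp
        (ContinuousLinearMap.snd ℂ (Cn n) (Cn d₁ × Cn d₂))) := by
      filter_upwards [hsm] with q hq
      have hq1 := (norm_fst_le q).trans_lt hq
      have hq2 := (norm_snd_le q).trans_lt hq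
      exact (hn q.1 0 q.2.1 q.2.2 hq1 (by simpa) ((norm_fst_le q.2).trans_lt hq2)
        ((norm_snd_le q.2).trans_lt hq2)).1
    have := hc.unique ((ContinuousLinearMap.hasFDerivAt _).congr_of_eventuallyEq he)
    exact congrArg (fun L => L p) this
  have h2 : ∀ χ, fderiv ℂ f 0 (i₂ χ) = 0 := by
    intro χ
    have hc : HasFDerivAt (fun q => f (i₂ q)) ((fderiv ℂ f 0).comp i₂) 0 :=
      HasFDerivAt.comp (g := f) (f := i₂) (0 : Cn n) (by rwa [map_zero]) i₂.hasFDerivAt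
    have he : (fun q => f (i₂ q)) =ᶠ[𝓝 0] fun _ => 0 := by
      filter_upwards [hsm] with q hq
      exact (hn 0 q 0 0 (by simpa) hq (by simpa) (by simpa)).2
    have := hc.unique ((hasFDerivAt_const _ _).congr_of_eventuallyEq he)
    exact congrArg (fun L => L χ) this
  have hv : v = i₁ (v.1.1, v.2) + i₂ v.1.2 := by
    simp [i₁, i₂]
  conv_lhs => rw [hv]
  rw [map_add, h1, h2, add_zero]

variable {Ω : Set (Rn (2 * (n + (d₁ + d₂)) - (d₁ + d₂)))}
  {Zp : Rn (2 * (n + (d₁ + d₂)) - (d₁ + d₂)) → Cn (n + (d₁ + d₂))}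

lemma IsLocalParam.eventually_mem (hQ : QDescribes n d₁ d₂ Q M)
    (hZ : IsLocalParam (n + (d₁ + d₂)) (d₁ + d₂) M 0 Ω Zp) :
    ∀ᶠ x in 𝓝 0, star (uPart n d₁ d₂ (Zp x)) = uPart n d₁ d₂ (Zp x) ∧
      wPart n d₁ d₂ (Zp x) = Q (zPart n d₁ d₂ (Zp x)) (star (zPart n d₁ d₂ (Zp x)))
        (star (wPart n d₁ d₂ (Zp x))) (uPart n d₁ d₂ (Zp x)) := by
  obtain ⟨-, -, ε, hε, hM⟩ := hQ
  obtain ⟨hΩ, h0, hZ0, han, -, -, U, -, -, himg⟩ := hZ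
  have hc : Tendsto Zp (𝓝 0) (𝓝 0) := by
    simpa only [hZ0] using (han 0 h0).continuousAt.tendsto
  filter_upwards [hΩ.mem_nhds h0, hc (Metric.ball_mem_nhds _ hε)] with x hx hxε
  have hmem : Zp x ∈ M := by
    have : Zp x ∈ M ∩ U := himg ▸ Set.mem_image_of_mem _ hx
    exact this.1
  obtain ⟨h1, h2⟩ := (hM _ (mem_ball_zero_iff.1 hxε)).1 hmem
  refine ⟨?_, ?_⟩
  · funext j
    exact Complex.conj_eq_iff_im.2 (h1 j)
  · funext j
    exact h2 j

lemma IsLocalParam.exists_deriv (hQ : QDescribes n d₁ d₂ Q M)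
    (hZ : IsLocalParam (n + (d₁ + d₂)) (d₁ + d₂) M 0 Ω Zp) :
    ∃ L : Rn (2 * (n + (d₁ + d₂)) - (d₁ + d₂)) →L[ℝ] Cn (n + (d₁ + d₂)), HasFDerivAt Zp L 0 ∧
      (∀ x, star (wfPart n d₁ d₂ (L x)) = wfPart n d₁ d₂ (L x)) ∧
      ∀ (z : Cn n) (t : Cn (d₁ + d₂)), star t = t → ∃ x, L x = Fin.append z t := by
  have hev := hZ.eventually_mem hQ
  obtain ⟨hΩ, h0, hZ0, han, -, hinj, -⟩ := hZ
  have hL : HasFDerivAt Zp (fderiv ℝ Zp 0) 0 := (han 0 h0).differentiableAt.hasFDerivAt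
  set L := fderiv ℝ Zp 0 with hLdef
  let zR := (zL n d₁ d₂).restrictScalars ℝ
  let wR := (wL n d₁ d₂).restrictScalars ℝ
  let uR := (uL n d₁ d₂).restrictScalars ℝ
  let cj : ∀ m : ℕ, Cn m →L[ℝ] Cn m := fun m => ((starL' ℝ : Cn m ≃L[ℝ] Cn m) : Cn m →L[ℝ] Cn m)
  have hu : ∀ x, star (uPart n d₁ d₂ (L x)) = uPart n d₁ d₂ (L x) := by
    intro x
    have h1 : HasFDerivAt (fun x => ((cj d₂).comp uR) (Zp x)) (((cj d₂).comp uR).comp L) 0 :=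
      ((cj d₂).comp uR).hasFDerivAt.comp 0 hL
    have h2 : HasFDerivAt (fun x => uR (Zp x)) (uR.comp L) 0 := uR.hasFDerivAt.comp 0 hL
    have := h1.unique (h2.congr_of_eventuallyEq (hev.mono fun x hx => hx.1))
    exact congrArg (fun T => T x) this
  have hw : ∀ x, star (wPart n d₁ d₂ (L x)) = wPart n d₁ d₂ (L x) := by
    intro x
    have h1 : HasFDerivAt (fun x => wR (Zp x)) (wR.comp L) 0 := wR.hasFDerivAt.comp 0 hL
    let J : Cn (n + (d₁ + d₂)) →L[ℝ] ((Cn n × Cn n) × (Cn d₁ × Cn d₂)) :=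
      (zR.prod ((cj n).comp zR)).prod (((cj d₁).comp wR).prod uR)
    have hJ : HasFDerivAt (fun x => J (Zp x)) (J.comp L) 0 := J.hasFDerivAt.comp 0 hL
    have h2 : HasFDerivAt (fun x => (fun p : (Cn n × Cn n) × (Cn d₁ × Cn d₂) =>
        Q p.1.1 p.1.2 p.2.1 p.2.2) (J (Zp x)))
        (((fderiv ℂ (fun p : (Cn n × Cn n) × (Cn d₁ × Cn d₂) =>
          Q p.1.1 p.1.2 p.2.1 p.2.2) 0).restrictScalars ℝ).comp (J.comp L)) 0 := by
      have h3 : HasFDerivAt (fun p : (Cn n × Cn n) × (Cn d₁ × Cn d₂) =>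
          Q p.1.1 p.1.2 p.2.1 p.2.2) ((fderiv ℂ (fun p : (Cn n × Cn n) × (Cn d₁ × Cn d₂) =>
          Q p.1.1 p.1.2 p.2.1 p.2.2) 0).restrictScalars ℝ) (J (Zp 0)) := by
        rw [hZ0, map_zero]
        exact hQ.1.differentiableAt.hasFDerivAt.restrictScalars ℝ
      exact h3.comp 0 hJ
    have h3 := h1.unique (h2.congr_of_eventuallyEq (hev.mono fun x hx => hx.2))
    have h4 := congrArg (fun T => T x) h3
    refine (h4.trans ?_).symm
    exact hQ.fderiv_apply (J (L x))
  have hwf : ∀ x, star (wfPart n d₁ d₂ (L x)) = wfPart n d₁ d₂ (L x) := by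
    intro x
    funext j
    refine Fin.addCases (fun i => ?_) (fun i => ?_) j
    · exact congrFun (hw x) i
    · exact congrFun (hu x) i
  refine ⟨L, hL, hwf, fun z t ht => ?_⟩
  let re : Cn (d₁ + d₂) →L[ℝ] Rn (d₁ + d₂) :=
    ContinuousLinearMap.pi fun j => Complex.reCLM.comp (ContinuousLinearMap.proj j)
  let P : Rn (2 * (n + (d₁ + d₂)) - (d₁ + d₂)) →L[ℝ] Cn n × Rn (d₁ + d₂) :=
    (zR.comp L).prod ((re.comp ((wfL n d₁ d₂).restrictScalars ℝ)).comp L)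
  have hP : ∀ (x) (t' : Cn (d₁ + d₂)), star t' = t' → (P x).2 = re t' →
      wfPart n d₁ d₂ (L x) = t' := by
    intro x t' ht' h
    funext j
    refine Complex.ext (congrFun h j) ?_
    rw [Complex.conj_eq_iff_im.1 (congrFun (hwf x) j), Complex.conj_eq_iff_im.1 (congrFun ht' j)]
  have hPinj : Function.Injective (P : Rn (2 * (n + (d₁ + d₂)) - (d₁ + d₂)) →ₗ[ℝ] Cn n × Rn (d₁ + d₂)) := by
    rw [← LinearMap.ker_eq_bot, LinearMap.ker_eq_bot']
    intro x hx
    have hx' : P x = 0 := hx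
    apply hinj 0 h0
    rw [map_zero]
    change L x = 0
    rw [← append_zPart_wfPart (L x), hP x 0 (star_zero _) (by rw [hx']; simp),
      show zPart n d₁ d₂ (L x) = 0 from congrArg Prod.fst hx', append_zero_zero]
  have hdim : Module.finrank ℝ (Rn (2 * (n + (d₁ + d₂)) - (d₁ + d₂)))
      = Module.finrank ℝ (Cn n × Rn (d₁ + d₂)) := by
    simp [Module.finrank_prod, Module.finrank_pi_fintype, Complex.finrank_real_complex]
    omega
  obtain ⟨x, hx⟩ := (LinearMap.injective_iff_surjective_of_finrank_eq_finrank hdim).1 hPinj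
    (z, re t)
  refine ⟨x, ?_⟩
  have hx' : P x = (z, re t) := hx
  rw [← append_zPart_wfPart (L x), hP x t ht (by rw [hx']),
    show zPart n d₁ d₂ (L x) = z from congrArg Prod.fst hx']

/-- The real points `(Z, z̄)`, `Z` in the tangent space, span. -/
lemma span_real_points {X : Type*} (L : X → Cn (n + (d₁ + d₂)))
    (hL : ∀ (z : Cn n) (t : Cn (d₁ + d₂)), star t = t → ∃ x, L x = Fin.append z t)
    (y : Cn (n + (d₁ + d₂)) × Cn n) : ∃ s t, y = (L s, star (zPart n d₁ d₂ (L s)))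
      + I • (L t, star (zPart n d₁ d₂ (L t))) := by
  obtain ⟨Z, χ⟩ := y
  obtain ⟨s, hs⟩ := hL (fun i => (zPart n d₁ d₂ Z i + star (χ i)) / 2)
    (fun j => ((wfPart n d₁ d₂ Z j).re : ℂ)) (funext fun j => Complex.conj_ofReal _)
  obtain ⟨t, ht⟩ := hL (fun i => (zPart n d₁ d₂ Z i - star (χ i)) / (2 * I))
    (fun j => ((wfPart n d₁ d₂ Z j).im : ℂ)) (funext fun j => Complex.conj_ofReal _)
  refine ⟨s, t, ?_⟩
  rw [hs, ht, zPart_append, zPart_append]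
  refine Prod.ext ?_ ?_
  · conv_lhs => rw [← append_zPart_wfPart Z]
    funext i
    refine Fin.addCases (fun j => ?_) (fun j => ?_) i
    · simp
      field_simp
      ring
    · simp only [Fin.append_right, Prod.mk_add_mk, Prod.smul_mk, Pi.add_apply, Pi.smul_apply,
        smul_eq_mul]
      rw [mul_comm, Complex.re_add_im]
  · funext i
    simp
    field_simp
    ring

end Real

section Real

variable {n d₁ d₂ : ℕ} {Q : Cn n → Cn n → Cn d₁ → Cn d₂ → Cn d₁} {M : Set (Cn (n + (d₁ + d₂)))}
  {Ω : Set (Rn (2 * (n + (d₁ + d₂)) - (d₁ + d₂)))}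
  {Zp : Rn (2 * (n + (d₁ + d₂)) - (d₁ + d₂)) → Cn (n + (d₁ + d₂))}

/-- Complex conjugation as a real-linear map. -/
def conjR (m : ℕ) : Cn m →L[ℝ] Cn m := ((starL' ℝ : Cn m ≃L[ℝ] Cn m) : Cn m →L[ℝ] Cn m)

lemma zPart_continuous : Continuous (zPart n d₁ d₂) := (zL n d₁ d₂).continuous

lemma mk3_eq_appendL (z : Cn n) (w : Cn d₁) (u : Cn d₂) :
    mk3 n d₁ d₂ z w u = appendL n (d₁ + d₂) (z, appendL d₁ d₂ (w, u)) := by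
  rw [appendL_apply, appendL_apply]; rfl

lemma IsLocalParam.isBigO_of_real (hQ : QDescribes n d₁ d₂ Q M)
    (hZ : IsLocalParam (n + (d₁ + d₂)) (d₁ + d₂) M 0 Ω Zp) {g : Cn (n + (d₁ + d₂)) × Cn n → ℂ}
    (hg : AnalyticAt ℂ g 0) {k : ℕ}
    (hO : (fun x => g (Zp x, star (zPart n d₁ d₂ (Zp x)))) =O[𝓝 0] fun x => ‖x‖ ^ k) :
    g =O[𝓝 0] fun y => ‖y‖ ^ k := by
  obtain ⟨L, hL, -, hs⟩ := hZ.exists_deriv hQ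
  let T : Cn (n + (d₁ + d₂)) →L[ℝ] Cn (n + (d₁ + d₂)) × Cn n :=
    (ContinuousLinearMap.id ℝ _).prod ((conjR n).comp ((zL n d₁ d₂).restrictScalars ℝ))
  refine hg.isBigO_of_real (γ := fun x => T (Zp x)) (γ' := T.comp L) ?_ (T.hasFDerivAt.comp 0 hL)
    (span_real_points L hs) hO
  rw [hZ.2.2.1, map_zero]

lemma IsLocalParam.isBigO_of_real' (hQ : QDescribes n d₁ d₂ Q M)
    (hZ : IsLocalParam (n + (d₁ + d₂)) (d₁ + d₂) M 0 Ω Zp) {g : Cn (n + (d₁ + d₂)) × Cn n → ℂ}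
    (hg : AnalyticAt ℂ g 0) {k : ℕ}
    (hO : (fun x => g (mk3 n d₁ d₂ (zPart n d₁ d₂ (Zp x)) (star (wPart n d₁ d₂ (Zp x)))
      (uPart n d₁ d₂ (Zp x)), star (zPart n d₁ d₂ (Zp x)))) =O[𝓝 0] fun x => ‖x‖ ^ k) :
    g =O[𝓝 0] fun y => ‖y‖ ^ k := by
  obtain ⟨L, hL, hr, hs⟩ := hZ.exists_deriv hQ
  let zR := (zL n d₁ d₂).restrictScalars ℝ
  let wR := (wL n d₁ d₂).restrictScalars ℝ
  let uR := (uL n d₁ d₂).restrictScalars ℝ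
  let S : Cn (n + (d₁ + d₂)) →L[ℝ] Cn (n + (d₁ + d₂)) :=
    ((appendL n (d₁ + d₂)).restrictScalars ℝ).comp (zR.prod
      (((appendL d₁ d₂).restrictScalars ℝ).comp (((conjR d₁).comp wR).prod uR)))
  have hS : ∀ Z, S Z = mk3 n d₁ d₂ (zPart n d₁ d₂ Z) (star (wPart n d₁ d₂ Z))
      (uPart n d₁ d₂ Z) := fun Z => (mk3_eq_appendL _ _ _).symm
  let T : Cn (n + (d₁ + d₂)) →L[ℝ] Cn (n + (d₁ + d₂)) × Cn n := S.prod ((conjR n).comp zR)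
  have hT : ∀ x, T (L x) = (L x, star (zPart n d₁ d₂ (L x))) := by
    intro x
    refine Prod.ext ?_ rfl
    refine (hS _).trans ?_
    rw [show star (wPart n d₁ d₂ (L x)) = wPart n d₁ d₂ (L x) from
      funext fun j => congrFun (hr x) (Fin.castAdd d₂ j), mk3_parts]
  refine hg.isBigO_of_real (γ := fun x => T (Zp x)) (γ' := T.comp L) ?_ (T.hasFDerivAt.comp 0 hL)
    ?_ (hO.congr_left fun x => ?_)
  · rw [hZ.2.2.1, map_zero]
  · intro y
    obtain ⟨s, t, h⟩ := span_real_points L hs y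
    exact ⟨s, t, by simpa only [ContinuousLinearMap.comp_apply, hT] using h⟩
  · rw [← hS]; rfl

lemma cxRel_iff_betaMap (hQ : QDescribes n d₁ d₂ Q M)
    (hZ : IsLocalParam (n + (d₁ + d₂)) (d₁ + d₂) M 0 Ω Zp) :
    ∀ᶠ p in 𝓝 (0 : Cn (n + (d₁ + d₂)) × Cn (n + (d₁ + d₂))), cxRel n d₁ d₂ Q p.1 p.2 →
      p.2 = betaMap n d₁ d₂ Q (p.1, zPart n d₁ d₂ p.2) := by
  have hβ := isNiceBeta_betaMap hQ
  have hβ0 : betaMap n d₁ d₂ Q 0 = 0 := by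
    have := hβ.left.self_of_nhds
    rwa [append_zero_zero] at this
  let Sw : Cn (n + (d₁ + d₂)) × Cn n → Cn (n + (d₁ + d₂)) × Cn n := fun y =>
    (mk3 n d₁ d₂ (zPart n d₁ d₂ y.1) (Q (zPart n d₁ d₂ y.1) y.2 (wPart n d₁ d₂ y.1)
      (uPart n d₁ d₂ y.1)) (uPart n d₁ d₂ y.1), y.2)
  have hQan : AnalyticAt ℂ (fun y : Cn (n + (d₁ + d₂)) × Cn n => Q (zPart n d₁ d₂ y.1) y.2
      (wPart n d₁ d₂ y.1) (uPart n d₁ d₂ y.1)) 0 := by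
    let Lz : (Cn (n + (d₁ + d₂)) × Cn n) →L[ℂ] ((Cn n × Cn n) × (Cn d₁ × Cn d₂)) :=
      (((zL n d₁ d₂).comp (ContinuousLinearMap.fst ℂ _ _)).prod (ContinuousLinearMap.snd ℂ _ _)).prod
        (((wL n d₁ d₂).comp (ContinuousLinearMap.fst ℂ _ _)).prod
          ((uL n d₁ d₂).comp (ContinuousLinearMap.fst ℂ _ _)))
    exact AnalyticAt.fun_comp (g := fun p : (Cn n × Cn n) × (Cn d₁ × Cn d₂) =>
      Q p.1.1 p.1.2 p.2.1 p.2.2) (by rw [map_zero]; exact hQ.1) (Lz.analyticAt 0)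
  have hSw : AnalyticAt ℂ Sw 0 := by
    refine AnalyticAt.prod ?_ analyticAt_snd
    simp only [mk3_eq_appendL]
    refine ((appendL n (d₁ + d₂)).analyticAt _).fun_comp ?_
    refine (((zL n d₁ d₂).analyticAt _).fun_comp analyticAt_fst).prod ?_
    refine ((appendL d₁ d₂).analyticAt _).fun_comp ?_
    exact hQan.prod (((uL n d₁ d₂).analyticAt _).fun_comp analyticAt_fst)
  have hSw0 : Sw 0 = 0 := by
    obtain ⟨ε, hε, hn⟩ := hQ.2.1
    have := (hn 0 0 0 0 (by simpa) (by simpa) (by simpa) (by simpa)).1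
    refine Prod.ext ?_ rfl
    change mk3 n d₁ d₂ 0 (Q 0 0 0 0) 0 = 0
    rw [this]
    exact (congrArg _ append_zero_zero).trans append_zero_zero
  have hg : ∀ j, ∀ᶠ y in 𝓝 (0 : Cn (n + (d₁ + d₂)) × Cn n),
      wPart n d₁ d₂ (betaMap n d₁ d₂ Q (Sw y)) j - wPart n d₁ d₂ y.1 j = 0 := by
    intro j
    have hga : AnalyticAt ℂ (fun y => wPart n d₁ d₂ (betaMap n d₁ d₂ Q (Sw y)) j
        - wPart n d₁ d₂ y.1 j) 0 := by
      have hc : AnalyticAt ℂ (fun y => betaMap n d₁ d₂ Q (Sw y)) 0 :=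
        AnalyticAt.fun_comp (by rw [hSw0]; exact hβ.an) hSw
      have hpr : ∀ x, AnalyticAt ℂ (fun Z => wPart n d₁ d₂ Z j) x := fun x =>
        ((ContinuousLinearMap.proj (R := ℂ) (φ := fun _ => ℂ) j).comp (wL n d₁ d₂)).analyticAt x
      exact ((hpr _).fun_comp hc).sub ((hpr _).fun_comp analyticAt_fst)
    refine hga.eventually_eq_zero_of_isBigO fun k => hZ.isBigO_of_real' hQ hga ?_
    refine (isBigO_zero _ _).congr' ?_ EventuallyEq.rfl
    filter_upwards [hZ.eventually_mem hQ] with x hx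
    simp only [Sw, zPart_mk3, wPart_mk3, uPart_mk3, betaMap, star_star]
    rw [hx.1, ← hx.2, ← hx.2]
    simp
  let P : Cn (n + (d₁ + d₂)) × Cn (n + (d₁ + d₂)) →L[ℂ] Cn (n + (d₁ + d₂)) × Cn n :=
    ((appendL n (d₁ + d₂)).comp (((zL n d₁ d₂).comp (ContinuousLinearMap.fst ℂ _ _)).prod
      ((appendL d₁ d₂).comp (((wL n d₁ d₂).comp (ContinuousLinearMap.snd ℂ _ _)).prod
        ((uL n d₁ d₂).comp (ContinuousLinearMap.fst ℂ _ _)))))).prod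
      ((zL n d₁ d₂).comp (ContinuousLinearMap.snd ℂ _ _))
  have hP : ∀ p, P p = (mk3 n d₁ d₂ (zPart n d₁ d₂ p.1) (wPart n d₁ d₂ p.2) (uPart n d₁ d₂ p.1),
      zPart n d₁ d₂ p.2) := fun p => Prod.ext (mk3_eq_appendL _ _ _).symm rfl
  have hPt : Tendsto P (𝓝 0) (𝓝 0) := by simpa using P.continuous.tendsto 0
  filter_upwards [hPt.eventually (eventually_all.2 hg)] with p hp hrel
  obtain ⟨h1, h2⟩ := hrel
  have hu : uPart n d₁ d₂ p.2 = uPart n d₁ d₂ p.1 := funext h1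
  have hw : wPart n d₁ d₂ p.1 = Q (zPart n d₁ d₂ p.1) (zPart n d₁ d₂ p.2) (wPart n d₁ d₂ p.2)
    (uPart n d₁ d₂ p.1) := funext h2
  have hSwP : Sw (P p) = (p.1, zPart n d₁ d₂ p.2) := by
    simp only [hP, Sw, zPart_mk3, wPart_mk3, uPart_mk3]
    rw [← hw, mk3_parts]
  have hwβ : wPart n d₁ d₂ (betaMap n d₁ d₂ Q (p.1, zPart n d₁ d₂ p.2)) = wPart n d₁ d₂ p.2 := by
    funext j
    have := hp j
    rw [hSwP, hP] at this
    simpa [wPart_mk3, sub_eq_zero] using this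
  rw [← mk3_parts p.2, hu, ← hwβ]
  simp only [betaMap, zPart_mk3, wPart_mk3]

end Real

/-! ### Approximate equivalences on the complexification -/

section Adm

variable {n d₁ d₂ : ℕ}

/-- Normality of a defining map `Q'`. -/
structure IsNormalMap (n m : ℕ) (B : Cn n → Cn n → Cn m → Cn m) : Prop where
  an : AnalyticAt ℂ (fun p : (Cn n × Cn n) × Cn m => B p.1.1 p.1.2 p.2) 0
  nrm : ∀ᶠ p in 𝓝 (0 : (Cn n × Cn n) × Cn m), B p.1.1 0 p.2 = p.2 ∧ B 0 p.1.2 p.2 = p.2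

/-- The conjugated defining map. -/
def conjQ (n m : ℕ) (B : Cn n → Cn n → Cn m → Cn m) : Cn n → Cn n → Cn m → Cn m :=
  fun f p q => star (B (star f) (star p) (star q))

lemma QpDescribes.isNormalMap {Q' : Cn n → Cn n → Cn (d₁ + d₂) → Cn (d₁ + d₂)}
    {M' : Set (Cn (n + (d₁ + d₂)))} (h : QpDescribes n d₁ d₂ Q' M') :
    IsNormalMap n (d₁ + d₂) Q' := by
  obtain ⟨han, ⟨ε, hε, hn⟩, -⟩ := h
  refine ⟨han, ?_⟩
  filter_upwards [Metric.ball_mem_nhds (0 : (Cn n × Cn n) × Cn (d₁ + d₂)) hε] with p hp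
  have hp := mem_ball_zero_iff.1 hp
  have h1 := (norm_fst_le p).trans_lt hp
  exact ⟨(hn p.1.1 0 p.2 ((norm_fst_le _).trans_lt h1) (by simpa)
    ((norm_snd_le p).trans_lt hp)).1, (hn 0 p.1.2 p.2 (by simpa)
    ((norm_snd_le _).trans_lt h1) ((norm_snd_le p).trans_lt hp)).2⟩

lemma IsNormalMap.conj {m : ℕ} {B : Cn n → Cn n → Cn m → Cn m} (h : IsNormalMap n m B) :
    IsNormalMap n m (conjQ n m B) := by
  refine ⟨AnalyticAt.starConj (x := (0 : (Cn n × Cn n) × Cn m)) (by simpa using h.an), ?_⟩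
  have hc : Tendsto (star : (Cn n × Cn n) × Cn m → (Cn n × Cn n) × Cn m) (𝓝 0) (𝓝 0) := by
    simpa using (continuous_star (R := (Cn n × Cn n) × Cn m)).tendsto 0
  filter_upwards [hc.eventually h.nrm] with p hp
  constructor
  · have := congrArg star hp.1
    simpa [conjQ] using this
  · have := congrArg star hp.2
    simpa [conjQ] using this

/-- Pairs of germs satisfying, up to order `k`, the equations satisfied by `(H, H̄)` on the
complexification when `H` maps `M` into `M'`. -/
structure Adm (n d₁ d₂ : ℕ) (A B : Cn n → Cn n → Cn (d₁ + d₂) → Cn (d₁ + d₂))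
    (β : Cn (n + (d₁ + d₂)) × Cn n → Cn (n + (d₁ + d₂))) (k : ℕ)
    (H K : Cn (n + (d₁ + d₂)) → Cn (n + (d₁ + d₂))) : Prop where
  anH : AnalyticAt ℂ H 0
  anK : AnalyticAt ℂ K 0
  H0 : H 0 = 0
  K0 : K 0 = 0
  det : 2 ≤ k ∨ n = 0 → detFz n d₁ d₂ K 0 ≠ 0
  jet : ∀ ν : Fin n → ℕ, ∑ i, ν i < k →
    mderivIdx n (zIdx n d₁ d₂) ν (fun W => Gpart n d₁ d₂ K W) 0 = 0
  id₁ : ∀ j, (fun y => Gpart n d₁ d₂ K (β y) j - A (Fpart n d₁ d₂ K (β y)) (Fpart n d₁ d₂ H y.1)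
    (Gpart n d₁ d₂ H y.1) j) =O[𝓝 0] fun y => ‖y‖ ^ k
  id₂ : ∀ j, (fun y => Gpart n d₁ d₂ H y.1 j - B (Fpart n d₁ d₂ H y.1) (Fpart n d₁ d₂ K (β y))
    (Gpart n d₁ d₂ K (β y)) j) =O[𝓝 0] fun y => ‖y‖ ^ k

lemma AnalyticAt.gpart {H : Cn (n + (d₁ + d₂)) → Cn (n + (d₁ + d₂))} {x : Cn (n + (d₁ + d₂))}
    (h : AnalyticAt ℂ H x) : AnalyticAt ℂ (Gpart n d₁ d₂ H) x :=
  ((wfL n d₁ d₂).analyticAt _).fun_comp h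

lemma AnalyticAt.fpart {H : Cn (n + (d₁ + d₂)) → Cn (n + (d₁ + d₂))} {x : Cn (n + (d₁ + d₂))}
    (h : AnalyticAt ℂ H x) : AnalyticAt ℂ (Fpart n d₁ d₂ H) x :=
  ((zL n d₁ d₂).analyticAt _).fun_comp h

/-- The embedding `z ↦ (z, 0)`. -/
def embL (n m : ℕ) : Cn n →L[ℂ] Cn (n + m) :=
  (appendL n m).comp ((ContinuousLinearMap.id ℂ _).prod 0)

lemma embL_apply {m : ℕ} (z : Cn n) : embL n m z = Fin.append z 0 := appendL_apply _

lemma embL_single (i : Fin n) :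
    embL n (d₁ + d₂) (Pi.single i 1) = Pi.single (zIdx n d₁ d₂ i) 1 := by
  rw [embL_apply]
  funext j
  refine Fin.addCases (fun a => ?_) (fun a => ?_) j
  · simp only [Fin.append_left, zIdx, Pi.single_apply]
    simp [Fin.ext_iff]
  · simp only [Fin.append_right, zIdx, Pi.single_apply, Pi.zero_apply]
    rw [if_neg]
    intro h
    have := congrArg Fin.val h
    simp at this
    omega

lemma mderivIdx_zIdx {f : Cn (n + (d₁ + d₂)) → Cn (d₁ + d₂)} {z : Cn n}
    (hf : AnalyticAt ℂ f (embL n _ z)) (ν : Fin n → ℕ) (j : Fin (d₁ + d₂)) :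
    mderivIdx n (zIdx n d₁ d₂) ν f (embL n _ z) j =
      iterDeriv ((List.finRange n).flatMap fun i => List.replicate (ν i) (Pi.single i (1 : ℂ)))
        (fun χ => f (embL n _ χ) j) z := by
  have h1 := iterDeriv_comp_clm (embL n (d₁ + d₂)) ((List.finRange n).flatMap fun i =>
    List.replicate (ν i) (Pi.single i (1 : ℂ))) (f := f) hf
  have h2 := iterDeriv_clm_comp (ContinuousLinearMap.proj (R := ℂ) (φ := fun _ => ℂ) j)
    ((List.finRange n).flatMap fun i => List.replicate (ν i) (Pi.single i (1 : ℂ)))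
    (hf.fun_comp ((embL n (d₁ + d₂)).analyticAt z))
  refine Eq.trans ?_ h2.symm
  rw [h1]
  simp only [List.map_flatMap, List.map_replicate, embL_single]
  rfl

end Adm

section Adm

variable {n d₁ d₂ : ℕ}

lemma mulVec_detFz_matrix {K : Cn (n + (d₁ + d₂)) → Cn (n + (d₁ + d₂))}
    {x : Cn (n + (d₁ + d₂))} (hK : AnalyticAt ℂ K x) (v : Cn n) :
    (Matrix.of fun i i' : Fin n => fderiv ℂ (fun W => K W (zIdx n d₁ d₂ i)) x
      (Pi.single (zIdx n d₁ d₂ i') 1)).mulVec v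
      = fun i => fderiv ℂ K x (embL n (d₁ + d₂) v) (zIdx n d₁ d₂ i) := by
  funext i
  have h : ∀ u, fderiv ℂ (fun W => K W (zIdx n d₁ d₂ i)) x u = fderiv ℂ K x u (zIdx n d₁ d₂ i) := by
    intro u
    exact congrArg (fun L => L u) (((ContinuousLinearMap.proj (R := ℂ) (φ := fun _ => ℂ)
      (zIdx n d₁ d₂ i)).hasFDerivAt.comp x hK.differentiableAt.hasFDerivAt).fderiv)
  have hv : embL n (d₁ + d₂) v = ∑ i', v i' • (Pi.single (zIdx n d₁ d₂ i') (1 : ℂ)) := by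
    conv_lhs => rw [pi_eq_sum_univ' v, map_sum]
    refine Finset.sum_congr rfl fun i' _ => ?_
    rw [← embL_single, ← map_smul]
  rw [hv]
  simp [Matrix.mulVec, dotProduct, h, mul_comm]

variable {Q : Cn n → Cn n → Cn d₁ → Cn d₂ → Cn d₁}
  {Q' : Cn n → Cn n → Cn (d₁ + d₂) → Cn (d₁ + d₂)} {M M' : Set (Cn (n + (d₁ + d₂)))}

lemma conjMap_apply (N : ℕ) (H : Cn N → Cn N) (ζ : Cn N) : conjMap N H ζ = star (H (star ζ)) := rfl

lemma QpDescribes.isBigO_defining (hQ' : QpDescribes n d₁ d₂ Q' M')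
    {U : Set (Cn (n + (d₁ + d₂)))} {ρ : Cn (n + (d₁ + d₂)) → Rn (d₁ + d₂)}
    (hρ : IsDefiningFun (n + (d₁ + d₂)) (d₁ + d₂) M' 0 U ρ)
    (h0' : (0 : Cn (n + (d₁ + d₂))) ∈ M') :
    (fun Z => wfPart n d₁ d₂ Z - Q' (zPart n d₁ d₂ Z) (star (zPart n d₁ d₂ Z))
      (star (wfPart n d₁ d₂ Z))) =O[𝓝 0] ρ := by
  obtain ⟨hU, h0U, han, hz, hs⟩ := hρ
  let zR := (zL n d₁ d₂).restrictScalars ℝ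
  let wR := (wfL n d₁ d₂).restrictScalars ℝ
  let J : Cn (n + (d₁ + d₂)) →L[ℝ] ((Cn n × Cn n) × Cn (d₁ + d₂)) :=
    (zR.prod ((conjR n).comp zR)).prod ((conjR (d₁ + d₂)).comp wR)
  have hJ : HasStrictFDerivAt (fun Z => (fun p : (Cn n × Cn n) × Cn (d₁ + d₂) =>
      Q' p.1.1 p.1.2 p.2) (J Z)) (((fderiv ℂ (fun p : (Cn n × Cn n) × Cn (d₁ + d₂) =>
      Q' p.1.1 p.1.2 p.2) 0).restrictScalars ℝ).comp J) 0 := by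
    have h3 : HasStrictFDerivAt (fun p : (Cn n × Cn n) × Cn (d₁ + d₂) =>
        Q' p.1.1 p.1.2 p.2) ((fderiv ℂ (fun p : (Cn n × Cn n) × Cn (d₁ + d₂) =>
        Q' p.1.1 p.1.2 p.2) 0).restrictScalars ℝ) (J 0) := by
      rw [map_zero]
      exact hQ'.1.hasStrictFDerivAt.restrictScalars ℝ
    exact h3.comp 0 J.hasStrictFDerivAt
  have hf := (wR.hasStrictFDerivAt (x := 0)).sub hJ
  refine isBigO_of_zero_on_zeroSet hf (han 0 h0U).hasStrictFDerivAt (hs 0 h0U)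
    ((hz 0 h0U).1 h0') ?_
  obtain ⟨-, -, ε, hε, hM⟩ := hQ'
  filter_upwards [hU.mem_nhds h0U, Metric.ball_mem_nhds _ hε] with Z hZU hZε h
  have := (hM Z (mem_ball_zero_iff.1 hZε)).1 ((hz Z hZU).2 h)
  exact sub_eq_zero.2 (funext this)

lemma IsKEquivalence.adm {k : ℕ} {H : Cn (n + (d₁ + d₂)) → Cn (n + (d₁ + d₂))}
    (hM' : IsRASubmanifold (n + (d₁ + d₂)) (d₁ + d₂) M')
    (h0' : (0 : Cn (n + (d₁ + d₂))) ∈ M')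
    (hQ : QDescribes n d₁ d₂ Q M) (hQ' : QpDescribes n d₁ d₂ Q' M')
    (hH : IsKEquivalence (n + (d₁ + d₂)) (d₁ + d₂) M M' 0 0 k H) :
    Adm n d₁ d₂ (conjQ n (d₁ + d₂) Q') Q' (betaMap n d₁ d₂ Q) k H
      (conjMap (n + (d₁ + d₂)) H) := by
  have hβ := isNiceBeta_betaMap hQ
  obtain ⟨hHa, hH0, hbij, Ω, Zp, hZ, hk⟩ := hH
  set K := conjMap (n + (d₁ + d₂)) H with hKdef
  set β := betaMap n d₁ d₂ Q with hβdef
  have hβ0 : β 0 = 0 := by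
    have := hβ.left.self_of_nhds
    rwa [append_zero_zero] at this
  have hKa : AnalyticAt ℂ K 0 :=
    AnalyticAt.starConj (x := (0 : Cn (n + (d₁ + d₂)))) (by simpa using hHa)
  have hK0 : K 0 = 0 := by
    rw [hKdef, conjMap_apply, star_zero, hH0, star_zero]
  have hB := hQ'.isNormalMap
  have hA := hB.conj
  have hZc : Tendsto Zp (𝓝 0) (𝓝 0) := by
    simpa only [hZ.2.2.1] using (hZ.2.2.2.1 0 hZ.2.1).continuousAt.tendsto
  have hHc : Tendsto H (𝓝 0) (𝓝 0) := by simpa only [hH0] using hHa.continuousAt.tendsto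
  have hF0 : Fpart n d₁ d₂ H 0 = 0 := congrArg (zPart n d₁ d₂) hH0
  have hG0 : Gpart n d₁ d₂ H 0 = 0 := congrArg (wfPart n d₁ d₂) hH0
  have hKF0 : Fpart n d₁ d₂ K 0 = 0 := congrArg (zPart n d₁ d₂) hK0
  have hKG0 : Gpart n d₁ d₂ K 0 = 0 := congrArg (wfPart n d₁ d₂) hK0
  have hkey : (fun x => wfPart n d₁ d₂ (H (Zp x)) - Q' (zPart n d₁ d₂ (H (Zp x)))
      (star (zPart n d₁ d₂ (H (Zp x)))) (star (wfPart n d₁ d₂ (H (Zp x)))))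
      =O[𝓝 0] fun x => ‖x‖ ^ k := by
    obtain ⟨U, ρ, hρ⟩ := hM' 0 h0'
    obtain ⟨C, ε, hε, hC⟩ := hk U ρ hρ
    refine ((hQ'.isBigO_defining hρ h0').comp_tendsto (hHc.comp hZc)).trans ?_
    refine IsBigO.of_bound C ?_
    filter_upwards [Metric.ball_mem_nhds _ hε] with x hx
    rw [norm_pow, norm_norm]
    exact hC x (mem_ball_zero_iff.1 hx)
  have hβZ : ∀ᶠ x in 𝓝 0, β (Zp x, star (zPart n d₁ d₂ (Zp x))) = star (Zp x) := by
    filter_upwards [hZ.eventually_mem hQ] with x hx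
    rw [← mk3_parts (star (Zp x))]
    simp only [hβdef, betaMap, star_star, hx.1, ← hx.2]
    have hu : uPart n d₁ d₂ (star (Zp x)) = uPart n d₁ d₂ (Zp x) := hx.1
    rw [hu]
    rfl
  have hKZ : ∀ x, K (star (Zp x)) = star (H (Zp x)) := fun x => by
    rw [hKdef, conjMap_apply, star_star]
  have haF : AnalyticAt ℂ (fun y : Cn (n + (d₁ + d₂)) × Cn n => Fpart n d₁ d₂ H y.1) 0 :=
    (AnalyticAt.fpart (by exact hHa)).fun_comp analyticAt_fst
  have haG : AnalyticAt ℂ (fun y : Cn (n + (d₁ + d₂)) × Cn n => Gpart n d₁ d₂ H y.1) 0 :=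
    (AnalyticAt.gpart (by exact hHa)).fun_comp analyticAt_fst
  have haKF : AnalyticAt ℂ (fun y => Fpart n d₁ d₂ K (β y)) 0 :=
    AnalyticAt.fun_comp (g := Fpart n d₁ d₂ K) (by rw [hβ0]; exact hKa.fpart) hβ.an
  have haKG : AnalyticAt ℂ (fun y => Gpart n d₁ d₂ K (β y)) 0 :=
    AnalyticAt.fun_comp (g := Gpart n d₁ d₂ K) (by rw [hβ0]; exact hKa.gpart) hβ.an
  have hpr : ∀ (j : Fin (d₁ + d₂)) (x : Cn (d₁ + d₂)), AnalyticAt ℂ (fun Z : Cn (d₁ + d₂) => Z j) x :=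
    fun j x => (ContinuousLinearMap.proj (R := ℂ) (φ := fun _ => ℂ) j).analyticAt x
  have haB : AnalyticAt ℂ (fun y : Cn (n + (d₁ + d₂)) × Cn n => Q' (Fpart n d₁ d₂ H y.1)
      (Fpart n d₁ d₂ K (β y)) (Gpart n d₁ d₂ K (β y))) 0 :=
    AnalyticAt.fun_comp (g := fun p : (Cn n × Cn n) × Cn (d₁ + d₂) => Q' p.1.1 p.1.2 p.2)
      (f := fun y => ((Fpart n d₁ d₂ H y.1, Fpart n d₁ d₂ K (β y)), Gpart n d₁ d₂ K (β y)))
      (by rw [Prod.fst_zero, hβ0, hF0, hKF0, hKG0]; exact hB.an) ((haF.prod haKF).prod haKG)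
  have haA : AnalyticAt ℂ (fun y : Cn (n + (d₁ + d₂)) × Cn n => conjQ n (d₁ + d₂) Q'
      (Fpart n d₁ d₂ K (β y)) (Fpart n d₁ d₂ H y.1) (Gpart n d₁ d₂ H y.1)) 0 :=
    AnalyticAt.fun_comp (g := fun p : (Cn n × Cn n) × Cn (d₁ + d₂) =>
        conjQ n (d₁ + d₂) Q' p.1.1 p.1.2 p.2)
      (f := fun y => ((Fpart n d₁ d₂ K (β y), Fpart n d₁ d₂ H y.1), Gpart n d₁ d₂ H y.1))
      (by rw [Prod.fst_zero, hβ0, hF0, hG0, hKF0]; exact hA.an) ((haKF.prod haF).prod haG)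
  have hcomp : ∀ j : Fin (d₁ + d₂), (fun x => (wfPart n d₁ d₂ (H (Zp x)) - Q' (zPart n d₁ d₂ (H (Zp x)))
      (star (zPart n d₁ d₂ (H (Zp x)))) (star (wfPart n d₁ d₂ (H (Zp x))))) j)
      =O[𝓝 0] fun x => ‖x‖ ^ k := fun j => isBigO_pi.1 hkey j
  have id₂ : ∀ j, (fun y : Cn (n + (d₁ + d₂)) × Cn n => Gpart n d₁ d₂ H y.1 j
      - Q' (Fpart n d₁ d₂ H y.1) (Fpart n d₁ d₂ K (β y))
      (Gpart n d₁ d₂ K (β y)) j) =O[𝓝 0] fun y => ‖y‖ ^ k := by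
    intro j
    refine hZ.isBigO_of_real hQ (((hpr j _).fun_comp haG).sub ((hpr j _).fun_comp haB)) ?_
    refine (hcomp j).congr' ?_ EventuallyEq.rfl
    filter_upwards [hβZ] with x hx
    simp only [Pi.sub_apply]
    rw [hx]
    have h1 : Fpart n d₁ d₂ K (star (Zp x)) = star (zPart n d₁ d₂ (H (Zp x))) :=
      congrArg (zPart n d₁ d₂) (hKZ x)
    have h2 : Gpart n d₁ d₂ K (star (Zp x)) = star (wfPart n d₁ d₂ (H (Zp x))) :=
      congrArg (wfPart n d₁ d₂) (hKZ x)
    rw [h1, h2]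
    rfl
  have id₁ : ∀ j, (fun y : Cn (n + (d₁ + d₂)) × Cn n => Gpart n d₁ d₂ K (β y) j
      - conjQ n (d₁ + d₂) Q' (Fpart n d₁ d₂ K (β y)) (Fpart n d₁ d₂ H y.1)
      (Gpart n d₁ d₂ H y.1) j) =O[𝓝 0] fun y => ‖y‖ ^ k := by
    intro j
    refine hZ.isBigO_of_real hQ (((hpr j _).fun_comp haKG).sub ((hpr j _).fun_comp haA)) ?_
    refine (hcomp j).norm_left.congr' ?_ EventuallyEq.rfl |>.of_norm_left
    filter_upwards [hβZ] with x hx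
    simp only [Pi.sub_apply]
    rw [hx]
    have h1 : Fpart n d₁ d₂ K (star (Zp x)) = star (zPart n d₁ d₂ (H (Zp x))) :=
      congrArg (zPart n d₁ d₂) (hKZ x)
    have h2 : Gpart n d₁ d₂ K (star (Zp x)) = star (wfPart n d₁ d₂ (H (Zp x))) :=
      congrArg (wfPart n d₁ d₂) (hKZ x)
    rw [h1, h2, conjQ, star_star, ← norm_star]
    congr 1
    simp only [Pi.star_apply, star_sub]
    rfl
  have hflat : ∀ j, (fun χ : Cn n => Gpart n d₁ d₂ K (embL n (d₁ + d₂) χ) j)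
      =O[𝓝 0] fun χ => ‖χ‖ ^ k := by
    intro j
    have hc : Tendsto (fun χ : Cn n => ((0, χ) : Cn (n + (d₁ + d₂)) × Cn n)) (𝓝 0) (𝓝 0) := by
      have : Continuous fun χ : Cn n => ((0, χ) : Cn (n + (d₁ + d₂)) × Cn n) := by fun_prop
      exact this.tendsto 0
    refine ((id₁ j).comp_tendsto hc).congr' ?_ (Eventually.of_forall fun χ => ?_)
    · have hcF : Tendsto (fun χ : Cn n => ((Fpart n d₁ d₂ K (β (0, χ)), (0 : Cn n)),
          (0 : Cn (d₁ + d₂)))) (𝓝 0) (𝓝 0) := by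
        have := haKF.continuousAt.tendsto.comp hc
        rw [hβ0, hKF0] at this
        exact (this.prodMk_nhds tendsto_const_nhds).prodMk_nhds tendsto_const_nhds
      filter_upwards [hβ.left, hcF.eventually hA.nrm] with χ h1 h2
      simp only [Function.comp_apply, hF0, hG0]
      rw [h2.1, h1, embL_apply]
      simp
    · simp [Prod.norm_def]
  have hflat_an : ∀ j, AnalyticAt ℂ (fun χ : Cn n => Gpart n d₁ d₂ K (embL n (d₁ + d₂) χ) j) 0 :=
    fun j => (hpr j _).fun_comp (AnalyticAt.fun_comp (by rw [map_zero]; exact hKa.gpart)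
      ((embL n (d₁ + d₂)).analyticAt 0))
  refine ⟨hHa, hKa, hH0, hK0, fun h2 => ?_, fun ν hν => ?_, id₁, id₂⟩
  · rcases h2 with h2 | rfl
    swap
    · simp [detFz]
    intro hdet
    obtain ⟨v, hv0, hv⟩ := Matrix.exists_mulVec_eq_zero_iff.2 hdet
    apply hv0
    rw [mulVec_detFz_matrix hKa] at hv
    have hd : ∀ u, fderiv ℂ K 0 u = star (fderiv ℂ H 0 (star u)) := fun u => by
      have := dirDeriv_starConj (f := H) (x := (0 : Cn (n + (d₁ + d₂)))) (v := u)
        (by rw [star_zero]; exact hHa.differentiableAt)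
      rw [star_zero] at this
      exact this
    have hz : fderiv ℂ K 0 (embL n (d₁ + d₂) v) = 0 := by
      funext i
      refine Fin.addCases (fun a => ?_) (fun j => ?_) i
      · exact congrFun hv a
      · have := (hflat_an j).iterDeriv_eq_zero (hflat j) (vs := [v]) (by simp; omega)
        have hc : HasFDerivAt (fun χ : Cn n => Gpart n d₁ d₂ K (embL n (d₁ + d₂) χ) j)
            ((((ContinuousLinearMap.proj (R := ℂ) (φ := fun _ => ℂ) j).comp (wfL n d₁ d₂)).comp
              (fderiv ℂ K 0)).comp (embL n (d₁ + d₂))) 0 := by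
          have hK' : HasFDerivAt K (fderiv ℂ K 0) (embL n (d₁ + d₂) 0) := by
            rw [map_zero]; exact hKa.differentiableAt.hasFDerivAt
          exact (ContinuousLinearMap.hasFDerivAt ((ContinuousLinearMap.proj (R := ℂ)
            (φ := fun _ => ℂ) j).comp (wfL n d₁ d₂))).comp 0
            (hK'.comp 0 (embL n (d₁ + d₂)).hasFDerivAt)
        have h3 : iterDeriv [v] (fun χ : Cn n => Gpart n d₁ d₂ K (embL n (d₁ + d₂) χ) j) 0
            = fderiv ℂ (fun χ : Cn n => Gpart n d₁ d₂ K (embL n (d₁ + d₂) χ) j) 0 v := rfl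
        rw [h3, hc.fderiv] at this
        exact this
    rw [hd, star_eq_zero] at hz
    have := hbij.1 (hz.trans (map_zero _).symm)
    rw [star_eq_zero, embL_apply] at this
    have := congrArg (zPart n d₁ d₂) this
    rwa [zPart_append] at this
  · funext j
    have h1 := mderivIdx_zIdx (f := fun W => Gpart n d₁ d₂ K W) (z := 0)
      (by rw [map_zero]; exact hKa.gpart) ν j
    rw [map_zero] at h1
    rw [h1]
    refine (hflat_an j).iterDeriv_eq_zero (hflat j) ?_
    simpa [List.length_flatMap, ← List.sum_ofFn, List.ofFn_eq_map] using hν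

end Adm

section Jets

variable {m N lt : ℕ}

/-- The directions occurring in the partial derivative `∂^α`, as a multiset. -/
def dirMultiset (idx : Fin m → Fin N) (α : Fin m → ℕ) : Multiset (Cn N) :=
  ∑ i, α i • ({Pi.single (idx i) 1} : Multiset (Cn N))

lemma coe_dirList (idx : Fin m → Fin N) (α : Fin m → ℕ) :
    (((List.finRange m).flatMap fun i => List.replicate (α i) (Pi.single (idx i) (1 : ℂ)) :
      List (Cn N)) : Multiset (Cn N)) = dirMultiset idx α := by
  rw [← Multiset.coe_bind, dirMultiset, Finset.sum]
  have h : (Finset.univ : Finset (Fin m)).val = (List.finRange m : Multiset (Fin m)) := rfl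
  rw [h, Multiset.bind, Multiset.join]
  congr 1
  refine Multiset.map_congr rfl fun i _ => ?_
  rw [Multiset.nsmul_singleton, Multiset.coe_replicate]

lemma dirMultiset_add_single (idx : Fin m → Fin N) (α : Fin m → ℕ) (j : Fin m) :
    dirMultiset idx (fun i => α i + (Pi.single j 1 : Fin m → ℕ) i)
      = dirMultiset idx α + {Pi.single (idx j) 1} := by
  simp only [dirMultiset, add_smul, Finset.sum_add_distrib]
  congr 1
  rw [Finset.sum_eq_single j (fun i _ hi => by simp [hi]) (by simp)]
  simp

lemma fderiv_apply_pi {E F ι : Type*} [NormedAddCommGroup F] [NormedSpace ℂ F] [NormedAddCommGroup E] [NormedSpace ℂ E] [Fintype ι]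
    {f : E → ι → F} {x : E} (hf : DifferentiableAt ℂ f x) (v : E) (i : ι) :
    fderiv ℂ f x v i = fderiv ℂ (fun y => f y i) x v :=
  (congrArg (fun L => L v) (((ContinuousLinearMap.proj (R := ℂ) (φ := fun _ => F)
      i).hasFDerivAt.comp x hf.hasFDerivAt).fderiv)).symm

variable {F : Type*} [NormedAddCommGroup F] [NormedSpace ℂ F] [CompleteSpace F]

lemma iterDeriv_eq_of_coe {E : Type*} [NormedAddCommGroup E] [NormedSpace ℂ E] {vs ws : List E}
    {f : E → F} {x : E} (hf : AnalyticAt ℂ f x)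
    (h : (vs : Multiset E) = (ws : Multiset E)) : iterDeriv vs f x = iterDeriv ws f x :=
  iterDeriv_perm (Multiset.coe_eq_coe.1 h) hf

lemma fderiv_mderivIdx {m' : ℕ} {idx : Fin m → Fin N} {idx' : Fin m' → Fin N} {α : Fin m → ℕ}
    {α' : Fin m' → ℕ} {j : Fin N}
    (h : dirMultiset idx α + {Pi.single j 1} = dirMultiset idx' α') {f : Cn N → F} {x : Cn N}
    (hf : AnalyticAt ℂ f x) :
    fderiv ℂ (mderivIdx m idx α f) x (Pi.single j 1) = mderivIdx m' idx' α' f x := by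
  have := congrFun (iterDeriv_concat ((List.finRange m).flatMap fun i =>
    List.replicate (α i) (Pi.single (idx i) (1 : ℂ))) (Pi.single j (1 : ℂ)) f) x
  refine Eq.trans this.symm (iterDeriv_eq_of_coe hf ?_)
  rw [← Multiset.coe_add, coe_dirList, coe_dirList, ← h]
  rfl

/-- The coordinate `∂^α` of a jet, or zero when its order is too large. -/
def getJ (r m lt : ℕ) (α : Fin m → ℕ) : JetSp r m lt →L[ℂ] Cn lt :=
  if h : ∑ i, α i ≤ r then
    ContinuousLinearMap.proj (⟨fun i => ⟨α i, Nat.lt_succ_of_le ((Finset.single_le_sum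
      (fun _ _ => Nat.zero_le _) (Finset.mem_univ i)).trans h)⟩, h⟩ : MIdx m r)
  else 0

/-- The jet of `f` in the variables selected by `idx`. -/
def multiJet (idx : Fin m → Fin N) (r : ℕ) (f : Cn N → Cn lt) (Z : Cn N) : JetSp r m lt :=
  fun dd => mderivIdx m idx (fun i => (dd.1 i : ℕ)) f Z

lemma getJ_multiJet {idx : Fin m → Fin N} {r : ℕ} {f : Cn N → Cn lt} {Z : Cn N} {α : Fin m → ℕ}
    (h : ∑ i, α i ≤ r) : getJ r m lt α (multiJet idx r f Z) = mderivIdx m idx α f Z := by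
  rw [getJ, dif_pos h]; rfl

/-- Truncation of jets. -/
def truncJ (r s m lt : ℕ) : JetSp s m lt →L[ℂ] JetSp r m lt :=
  ContinuousLinearMap.pi fun dd => getJ s m lt fun i => (dd.1 i : ℕ)

lemma truncJ_multiJet {idx : Fin m → Fin N} {r s : ℕ} (h : r ≤ s) (f : Cn N → Cn lt) (Z : Cn N) :
    truncJ r s m lt (multiJet idx s f Z) = multiJet idx r f Z :=
  funext fun dd => getJ_multiJet (dd.2.trans h)

/-- The jet of `∂_j f` from the jet of `f`. -/
def shiftJ (r m lt : ℕ) (j : Fin m) : JetSp (r + 1) m lt →L[ℂ] JetSp r m lt :=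
  ContinuousLinearMap.pi fun dd =>
    getJ (r + 1) m lt fun i => (dd.1 i : ℕ) + (Pi.single j 1 : Fin m → ℕ) i

lemma AnalyticAt.multiJet {idx : Fin m → Fin N} {r : ℕ} {f : Cn N → Cn lt} {x : Cn N}
    (hf : AnalyticAt ℂ f x) : AnalyticAt ℂ (multiJet idx r f) x :=
  analyticAt_pi_iff.2 fun _ => hf.iterDeriv _

lemma sum_succ_le {r : ℕ} {α : Fin m → ℕ} (h : ∑ i, α i ≤ r) (j : Fin m) :
    ∑ i, (α i + (Pi.single j 1 : Fin m → ℕ) i) ≤ r + 1 := by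
  rw [Finset.sum_add_distrib]
  simpa using h

lemma fderiv_multiJet_single {idx : Fin m → Fin N} {r : ℕ} {f : Cn N → Cn lt} {x : Cn N}
    (hf : AnalyticAt ℂ f x) (j : Fin m) :
    fderiv ℂ (multiJet idx r f) x (Pi.single (idx j) 1)
      = shiftJ r m lt j (multiJet idx (r + 1) f x) := by
  funext dd
  rw [fderiv_apply_pi hf.multiJet.differentiableAt]
  refine (fderiv_mderivIdx (dirMultiset_add_single idx _ j).symm hf).trans ?_
  exact (getJ_multiJet (sum_succ_le dd.2 j)).symm

lemma map_eq_sum_single {E : Type*} [AddCommGroup E] [Module ℂ E] [TopologicalSpace E]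
    (L : Cn N →L[ℂ] E) (b : Cn N) :
    L b = ∑ j, b j • L (Pi.single j 1) := by
  conv_lhs => rw [pi_eq_sum_univ' b, map_sum]
  refine Finset.sum_congr rfl fun j _ => ?_
  rw [← map_smul]

/-- Extension of a multi-index in the first variables by zero. -/
def embIdx {n e : ℕ} (ν : Fin n → ℕ) : Fin (n + e) → ℕ := Fin.addCases ν fun _ => 0

lemma sum_embIdx {n e : ℕ} (ν : Fin n → ℕ) : ∑ i, (embIdx ν : Fin (n + e) → ℕ) i = ∑ i, ν i := by
  simp [embIdx, Fin.sum_univ_add]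

lemma dirMultiset_embIdx {n d₁ d₂ : ℕ} (ν : Fin n → ℕ) :
    dirMultiset (zIdx n d₁ d₂) ν = dirMultiset id (embIdx ν : Fin (n + (d₁ + d₂)) → ℕ) := by
  simp [dirMultiset, embIdx, Fin.sum_univ_add, zIdx]

/-- The jet in the first variables of the last components of `∂_j f`. -/
def mixJ (n d₁ d₂ r : ℕ) (j : Fin (n + (d₁ + d₂))) :
    JetSp (r + 1) (n + (d₁ + d₂)) (n + (d₁ + d₂)) →L[ℂ] JetSp r n (d₁ + d₂) :=
  ContinuousLinearMap.pi fun ν => (wfL n d₁ d₂).comp (getJ (r + 1) _ _ fun i =>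
    embIdx (fun i => (ν.1 i : ℕ)) i + (Pi.single j 1 : Fin (n + (d₁ + d₂)) → ℕ) i)

lemma fderiv_jetZG {n d₁ d₂ r : ℕ} {K : Cn (n + (d₁ + d₂)) → Cn (n + (d₁ + d₂))}
    {x : Cn (n + (d₁ + d₂))} (hK : AnalyticAt ℂ K x) (b : Cn (n + (d₁ + d₂))) :
    fderiv ℂ (jetZG n d₁ d₂ r K) x b
      = ∑ i, b (zIdx n d₁ d₂ i) • shiftJ r n (d₁ + d₂) i (jetZG n d₁ d₂ (r + 1) K x)
        + ∑ j, b (wfIdx n d₁ d₂ j) • mixJ n d₁ d₂ r (wfIdx n d₁ d₂ j)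
          (jetFull (n + (d₁ + d₂)) (r + 1) K x) := by
  have hG : AnalyticAt ℂ (fun W => Gpart n d₁ d₂ K W) x := hK.gpart
  rw [map_eq_sum_single, Fin.sum_univ_add]
  congr 1
  · exact Finset.sum_congr rfl fun i _ => congrArg _ (fderiv_multiJet_single hG i)
  · refine Finset.sum_congr rfl fun j _ => congrArg _ ?_
    funext ν
    have h1 : DifferentiableAt ℂ (jetZG n d₁ d₂ r K) x := hG.multiJet.differentiableAt
    rw [fderiv_apply_pi h1]
    refine (fderiv_mderivIdx (idx' := id) (α' := fun i => embIdx (fun i => (ν.1 i : ℕ)) i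
        + (Pi.single (wfIdx n d₁ d₂ j) 1 : Fin (n + (d₁ + d₂)) → ℕ) i) ?_ hG).trans ?_
    · rw [dirMultiset_add_single, dirMultiset_embIdx]; rfl
    refine (iterDeriv_clm_comp (wfL n d₁ d₂) _ hK).trans (congrArg (wfL n d₁ d₂) ?_)
    refine (getJ_multiJet (idx := id) (sum_succ_le ?_ _)).symm
    rw [sum_embIdx]
    exact ν.2

lemma fderiv_jetFull {r : ℕ} {K : Cn N → Cn N}
    {x : Cn N} (hK : AnalyticAt ℂ K x) (b : Cn N) :
    fderiv ℂ (jetFull N r K) x b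
      = ∑ j, b j • shiftJ r N N j (jetFull N (r + 1) K x) := by
  rw [map_eq_sum_single]
  exact Finset.sum_congr rfl fun j _ => congrArg _ (fderiv_multiJet_single hK j)

lemma getJ_single_jetFull {r : ℕ} (hr : 1 ≤ r) {K : Cn N → Cn N} {x : Cn N} 
    (j : Fin N) : getJ r N N (Pi.single j 1) (jetFull N r K x) = fderiv ℂ K x (Pi.single j 1) := by
  refine (getJ_multiJet (idx := id) (by simpa using hr)).trans ?_
  have : ((List.finRange N).flatMap fun i =>
      List.replicate ((Pi.single j 1 : Fin N → ℕ) i) (Pi.single (id i) (1 : ℂ) : Cn N))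
      = [Pi.single j 1] := by
    refine Multiset.coe_eq_singleton.1 ?_
    rw [coe_dirList]
    simp [dirMultiset]
  rw [mderivIdx, this]
  rfl

end Jets

section TotalDerivative

variable {n d₁ d₂ : ℕ}

abbrev W0 (n d₁ d₂ s : ℕ) : Type := ℂ × JetSp s (n + (d₁ + d₂)) (n + (d₁ + d₂))

abbrev W1 (n d₁ d₂ s : ℕ) : Type :=
  (JetSp s n (d₁ + d₂) × Cn n) × (Cn (n + (d₁ + d₂)) × Cn (n + (d₁ + d₂)))

/-- `det F_z` as a function of the jet. -/
def detJ (n d₁ d₂ s : ℕ) (Λ : JetSp s (n + (d₁ + d₂)) (n + (d₁ + d₂))) : ℂ :=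
  (Matrix.of fun i i' : Fin n =>
    getJ s _ _ (Pi.single (zIdx n d₁ d₂ i') 1) Λ (zIdx n d₁ d₂ i)).det

def detW (n d₁ d₂ s : ℕ) (v : W0 n d₁ d₂ s × W1 n d₁ d₂ s) : ℂ := detJ n d₁ d₂ s v.1.2

def lamL (n d₁ d₂ s : ℕ) : (W0 n d₁ d₂ s × W1 n d₁ d₂ s) →L[ℂ]
    JetSp s (n + (d₁ + d₂)) (n + (d₁ + d₂)) :=
  (ContinuousLinearMap.snd ℂ ℂ (JetSp s (n + (d₁ + d₂)) (n + (d₁ + d₂)))).comp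
    (ContinuousLinearMap.fst ℂ (W0 n d₁ d₂ s) (W1 n d₁ d₂ s))

def gamL (n d₁ d₂ s : ℕ) : (W0 n d₁ d₂ s × W1 n d₁ d₂ s) →L[ℂ] JetSp s n (d₁ + d₂) :=
  (ContinuousLinearMap.fst ℂ (JetSp s n (d₁ + d₂)) (Cn n)).comp
    ((ContinuousLinearMap.fst ℂ (JetSp s n (d₁ + d₂) × Cn n) _).comp
      (ContinuousLinearMap.snd ℂ (W0 n d₁ d₂ s) (W1 n d₁ d₂ s)))

/-- A coordinate of a vector-valued linear map is in the ring. -/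
lemma memRing_clm_apply {V0 V1 : Type*} [NormedAddCommGroup V0] [NormedSpace ℂ V0]
    [NormedAddCommGroup V1] [NormedSpace ℂ V1] {ι : Type*} [Fintype ι]
    (L : (V0 × V1) →L[ℂ] (ι → ℂ)) (i : ι) : MemRing V0 V1 fun x => L x i :=
  memRing_linear ((ContinuousLinearMap.proj (R := ℂ) (φ := fun _ => ℂ) i).comp L)

lemma memRingMap_smul_linear {V0 V1 F : Type*} [NormedAddCommGroup V0] [NormedSpace ℂ V0]
    [NormedAddCommGroup V1] [NormedSpace ℂ V1] [NormedAddCommGroup F] [NormedSpace ℂ F]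
    [FiniteDimensional ℂ F] {c : V0 × V1 → ℂ} (hc : MemRing V0 V1 c) (L : (V0 × V1) →L[ℂ] F) :
    MemRingMap V0 V1 F fun x => c x • L x := by
  intro φ
  simp only [map_smul, smul_eq_mul]
  exact hc.mul (memRing_linear ((LinearMap.toContinuousLinearMap φ).comp L))

lemma MemRingMap.sum {V0 V1 F ι : Type*} [NormedAddCommGroup V0] [NormedSpace ℂ V0]
    [NormedAddCommGroup V1] [NormedSpace ℂ V1] [NormedAddCommGroup F] [NormedSpace ℂ F]
    {f : ι → V0 × V1 → F} (s : Finset ι) (hf : ∀ i ∈ s, MemRingMap V0 V1 F (f i)) :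
    MemRingMap V0 V1 F fun x => ∑ i ∈ s, f i x := by
  intro φ
  simp only [map_sum]
  exact MemRing.sum _ fun i hi => hf i hi φ

lemma MemRingMap.add {V0 V1 F : Type*} [NormedAddCommGroup V0] [NormedSpace ℂ V0]
    [NormedAddCommGroup V1] [NormedSpace ℂ V1] [NormedAddCommGroup F] [NormedSpace ℂ F]
    {f g : V0 × V1 → F} (hf : MemRingMap V0 V1 F f) (hg : MemRingMap V0 V1 F g) :
    MemRingMap V0 V1 F fun x => f x + g x := by
  intro φ
  simp only [map_add]
  exact (hf φ).add (hg φ)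

lemma memRing_detW (s : ℕ) : MemRing _ _ (detW n d₁ d₂ s) := by
  have h : ∀ i i' : Fin n, MemRing (W0 n d₁ d₂ s) (W1 n d₁ d₂ s) fun v =>
      (getJ s _ _ (Pi.single (zIdx n d₁ d₂ i') 1)) (lamL n d₁ d₂ s v) (zIdx n d₁ d₂ i) :=
    fun i i' => memRing_clm_apply
      ((getJ s _ _ (Pi.single (zIdx n d₁ d₂ i') 1)).comp (lamL n d₁ d₂ s)) _
  unfold detW detJ
  exact MemRing.det h

lemma analyticAt_detJ {s : ℕ} (Λ : JetSp s (n + (d₁ + d₂)) (n + (d₁ + d₂))) :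
    AnalyticAt ℂ (detJ n d₁ d₂ s) Λ :=
  ((memRing_detW s).analyticAt (0, Λ)).fun_comp (f := fun Λ => ((0, Λ), 0))
    ((analyticAt_const.prod analyticAt_id).prod analyticAt_const)

lemma analyticAt_detW {s : ℕ} (v : W0 n d₁ d₂ s × W1 n d₁ d₂ s) :
    AnalyticAt ℂ (detW n d₁ d₂ s) v :=
  AnalyticAt.fun_comp (g := detJ n d₁ d₂ s) (analyticAt_detJ (lamL n d₁ d₂ s v)) ((lamL n d₁ d₂ s).analyticAt v)

variable {K : Cn (n + (d₁ + d₂)) → Cn (n + (d₁ + d₂))} {x : Cn (n + (d₁ + d₂))}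

lemma detFz_eq (hK : DifferentiableAt ℂ K x) :
    detFz n d₁ d₂ K x = (Matrix.of fun i i' : Fin n =>
      fderiv ℂ K x (Pi.single (zIdx n d₁ d₂ i') 1) (zIdx n d₁ d₂ i)).det := by
  rw [detFz]
  congr 1
  ext i i'
  exact (fderiv_apply_pi hK _ _).symm

lemma detJ_jetFull {s : ℕ} (hs : 1 ≤ s ∨ n = 0) (hK : DifferentiableAt ℂ K x) :
    detJ n d₁ d₂ s (jetFull _ s K x) = detFz n d₁ d₂ K x := by
  rcases hs with hs | rfl
  swap
  · simp [detJ, detFz]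
  rw [detFz_eq hK, detJ]
  congr 1
  ext i i'
  exact congrFun (getJ_single_jetFull hs _) _

lemma AnalyticAt.detFz (hK : AnalyticAt ℂ K x) : AnalyticAt ℂ (detFz n d₁ d₂ K) x := by
  have h1 : AnalyticAt ℂ (fun x => detJ n d₁ d₂ 1 (jetFull _ 1 K x)) x :=
    (analyticAt_detJ _).fun_comp (AnalyticAt.multiJet (idx := id) hK)
  refine h1.congr ?_
  filter_upwards [hK.eventually_analyticAt] with y hy
  exact detJ_jetFull (Or.inl le_rfl) hy.differentiableAt

/-- The argument of the map in the basic identity. -/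
def sig (n d₁ d₂ s : ℕ) (K : Cn (n + (d₁ + d₂)) → Cn (n + (d₁ + d₂)))
    (Z ζ : Cn (n + (d₁ + d₂))) : W0 n d₁ d₂ s × W1 n d₁ d₂ s :=
  ((1 / detFz n d₁ d₂ K ζ, jetFull (n + (d₁ + d₂)) s K ζ),
    ((jetZG n d₁ d₂ s K ζ, Fpart n d₁ d₂ K ζ), (ζ, Z)))

variable (β : Cn (n + (d₁ + d₂)) × Cn n → Cn (n + (d₁ + d₂)))

def tMap (s : ℕ) (K : Cn (n + (d₁ + d₂)) → Cn (n + (d₁ + d₂)))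
    (y : Cn (n + (d₁ + d₂)) × Cn n) : W0 n d₁ d₂ s × W1 n d₁ d₂ s :=
  sig n d₁ d₂ s K y.1 (β y)

def trunc0 (n d₁ d₂ s t : ℕ) : W0 n d₁ d₂ t →L[ℂ] W0 n d₁ d₂ s :=
  (ContinuousLinearMap.id ℂ ℂ).prodMap (truncJ s t _ _)

def trunc1 (n d₁ d₂ s t : ℕ) : W1 n d₁ d₂ t →L[ℂ] W1 n d₁ d₂ s :=
  ((truncJ s t _ _).prodMap (ContinuousLinearMap.id ℂ (Cn n))).prodMap
    (ContinuousLinearMap.id ℂ (Cn (n + (d₁ + d₂)) × Cn (n + (d₁ + d₂))))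

def truncW (n d₁ d₂ s t : ℕ) :
    (W0 n d₁ d₂ t × W1 n d₁ d₂ t) →L[ℂ] (W0 n d₁ d₂ s × W1 n d₁ d₂ s) :=
  (trunc0 n d₁ d₂ s t).prodMap (trunc1 n d₁ d₂ s t)

lemma truncW_sig {s t : ℕ} (h : s ≤ t) (K) (Z ζ : Cn (n + (d₁ + d₂))) :
    truncW n d₁ d₂ s t (sig n d₁ d₂ t K Z ζ) = sig n d₁ d₂ s K Z ζ :=
  Prod.ext (Prod.ext rfl (truncJ_multiJet h _ _)) (Prod.ext (Prod.ext (truncJ_multiJet h _ _) rfl) rfl)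

def baseDir (e : Cn (n + (d₁ + d₂)) × Cn n) {s : ℕ} (v : W0 n d₁ d₂ s × W1 n d₁ d₂ s) :
    Cn (n + (d₁ + d₂)) := fderiv ℂ β (v.2.2.2, zL n d₁ d₂ v.2.2.1) e

def jetDir (s : ℕ) (b : Cn (n + (d₁ + d₂))) (Λ : JetSp (s + 1) (n + (d₁ + d₂)) (n + (d₁ + d₂))) :
    JetSp s (n + (d₁ + d₂)) (n + (d₁ + d₂)) := ∑ j, b j • shiftJ s _ _ j Λ

/-- The total derivative in the direction `e`, as a vector field on jet space. -/
def dvec (s : ℕ) (e : Cn (n + (d₁ + d₂)) × Cn n) (v : W0 n d₁ d₂ (s + 1) × W1 n d₁ d₂ (s + 1)) :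
    W0 n d₁ d₂ s × W1 n d₁ d₂ s :=
  ((-(v.1.1 * v.1.1) * fderiv ℂ (detW n d₁ d₂ s) (truncW n d₁ d₂ s (s + 1) v)
      ((0, jetDir s (baseDir β e v) v.1.2), 0), jetDir s (baseDir β e v) v.1.2),
    ((∑ i, baseDir β e v (zIdx n d₁ d₂ i) • shiftJ s n (d₁ + d₂) i v.2.1.1
        + ∑ j, baseDir β e v (wfIdx n d₁ d₂ j) • mixJ n d₁ d₂ s (wfIdx n d₁ d₂ j) v.1.2,
      ∑ j, baseDir β e v j • zL n d₁ d₂ (getJ (s + 1) _ _ (Pi.single j 1) v.1.2)),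
      (baseDir β e v, e.1)))

def totalD (s : ℕ) (e : Cn (n + (d₁ + d₂)) × Cn n) (Ψ : W0 n d₁ d₂ s × W1 n d₁ d₂ s → ℂ)
    (v : W0 n d₁ d₂ (s + 1) × W1 n d₁ d₂ (s + 1)) : ℂ :=
  fderiv ℂ Ψ (truncW n d₁ d₂ s (s + 1) v) (dvec β s e v)

variable {β}

lemma IsNiceBeta.memRing_baseDir (hβ : IsNiceBeta n d₁ d₂ β) (s : ℕ)
    (e : Cn (n + (d₁ + d₂)) × Cn n) (j : Fin (n + (d₁ + d₂))) :
    MemRing (W0 n d₁ d₂ s) (W1 n d₁ d₂ s) fun v => baseDir β e v j := by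
  refine MemRing.of_snd (g := fun v : W1 n d₁ d₂ s =>
    fderiv ℂ β (v.2.2, zL n d₁ d₂ v.2.1) e j) ?_
  have h1 : AnalyticAt ℂ (fun y => fderiv ℂ β y e j)
      ((fun v : W1 n d₁ d₂ s => (v.2.2, zL n d₁ d₂ v.2.1)) 0) := by
    have h0 : (fun v : W1 n d₁ d₂ s => (v.2.2, zL n d₁ d₂ v.2.1)) 0 = 0 :=
      Prod.ext rfl (map_zero _)
    rw [h0]
    exact analyticAt_pi_iff.1 (hβ.an.dirDeriv e) j
  exact h1.fun_comp (f := fun v : W1 n d₁ d₂ s => (v.2.2, zL n d₁ d₂ v.2.1))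
    ((analyticAt_snd.fun_comp analyticAt_snd).prod
    (((zL n d₁ d₂).analyticAt _).fun_comp (analyticAt_fst.fun_comp analyticAt_snd)))

lemma IsNiceBeta.memRingMap_jetDir (hβ : IsNiceBeta n d₁ d₂ β) (s : ℕ)
    (e : Cn (n + (d₁ + d₂)) × Cn n) :
    MemRingMap (W0 n d₁ d₂ (s + 1)) (W1 n d₁ d₂ (s + 1)) _
      fun v => jetDir s (baseDir β e v) v.1.2 :=
  MemRingMap.sum _ fun j _ => memRingMap_smul_linear (hβ.memRing_baseDir _ e j)
    ((shiftJ s _ _ j).comp (lamL n d₁ d₂ (s + 1)))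

lemma memRingMap_const {V0 V1 F : Type*} [NormedAddCommGroup V0] [NormedSpace ℂ V0]
    [NormedAddCommGroup V1] [NormedSpace ℂ V1] [NormedAddCommGroup F] [NormedSpace ℂ F] (c : F) :
    MemRingMap V0 V1 F fun _ => c := fun φ => memRing_const (φ c)

lemma IsNiceBeta.memRingMap_dvec (hβ : IsNiceBeta n d₁ d₂ β) (s : ℕ)
    (e : Cn (n + (d₁ + d₂)) × Cn n) :
    MemRingMap (W0 n d₁ d₂ (s + 1)) (W1 n d₁ d₂ (s + 1)) _ (dvec β s e) := by
  have hθ : MemRing (W0 n d₁ d₂ (s + 1)) (W1 n d₁ d₂ (s + 1)) fun v => v.1.1 :=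
    memRing_linear ((ContinuousLinearMap.fst ℂ ℂ _).comp
      (ContinuousLinearMap.fst ℂ (W0 n d₁ d₂ (s + 1)) (W1 n d₁ d₂ (s + 1))))
  have hJ := hβ.memRingMap_jetDir s e
  refine MemRingMap.prodMk (MemRingMap.prodMk (MemRing.memRingMap ((hθ.mul hθ).neg.mul
    ((memRing_detW s).fderiv_apply (trunc0 n d₁ d₂ s (s + 1)) (trunc1 n d₁ d₂ s (s + 1))
      (((memRingMap_const 0).prodMk hJ).prodMk (memRingMap_const 0))))) hJ)
    ((MemRingMap.prodMk ?_ ?_).prodMk ((memRingMap_pi fun j =>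
      (hβ.memRing_baseDir _ e j).memRingMap).prodMk (memRingMap_const _)))
  · refine MemRingMap.add (MemRingMap.sum _ fun i _ => ?_) (MemRingMap.sum _ fun j _ => ?_)
    · exact memRingMap_smul_linear (hβ.memRing_baseDir _ e _) ((shiftJ s n (d₁ + d₂) i).comp
        (gamL n d₁ d₂ (s + 1)))
    · exact memRingMap_smul_linear (hβ.memRing_baseDir _ e _) ((mixJ n d₁ d₂ s _).comp
        (lamL n d₁ d₂ (s + 1)))
  · exact MemRingMap.sum _ fun j _ => memRingMap_smul_linear (hβ.memRing_baseDir _ e _)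
      (((zL n d₁ d₂).comp (getJ (s + 1) _ _ (Pi.single j 1))).comp
        (lamL n d₁ d₂ (s + 1)))

lemma MemRing.totalD (hβ : IsNiceBeta n d₁ d₂ β) {s : ℕ}
    {Ψ : W0 n d₁ d₂ s × W1 n d₁ d₂ s → ℂ} (hΨ : MemRing _ _ Ψ) (e : Cn (n + (d₁ + d₂)) × Cn n) :
    MemRing _ _ (totalD β s e Ψ) :=
  hΨ.fderiv_apply (trunc0 n d₁ d₂ s (s + 1)) (trunc1 n d₁ d₂ s (s + 1)) (hβ.memRingMap_dvec s e)

end TotalDerivative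

section ChainRule

variable {n d₁ d₂ : ℕ} {β : Cn (n + (d₁ + d₂)) × Cn n → Cn (n + (d₁ + d₂))}
  {K : Cn (n + (d₁ + d₂)) → Cn (n + (d₁ + d₂))}

lemma IsNiceBeta.map_zero (hβ : IsNiceBeta n d₁ d₂ β) : β 0 = 0 := by
  have := hβ.left.self_of_nhds
  rwa [append_zero_zero] at this

lemma fderiv_fpart {x : Cn (n + (d₁ + d₂))} (hK : DifferentiableAt ℂ K x)
    (b : Cn (n + (d₁ + d₂))) :
    fderiv ℂ (Fpart n d₁ d₂ K) x b = zL n d₁ d₂ (fderiv ℂ K x b) :=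
  congrArg (fun L => L b) ((zL n d₁ d₂).hasFDerivAt.comp x hK.hasFDerivAt).fderiv

lemma fderiv_detFz {s : ℕ} (hs : 1 ≤ s ∨ n = 0) {x : Cn (n + (d₁ + d₂))} (hK : AnalyticAt ℂ K x)
    (b : Cn (n + (d₁ + d₂))) (θ : ℂ) (v : W1 n d₁ d₂ s) :
    fderiv ℂ (detFz n d₁ d₂ K) x b = fderiv ℂ (detW n d₁ d₂ s) ((θ, jetFull _ s K x), v)
      ((0, jetDir s b (jetFull _ (s + 1) K x)), 0) := by
  have h1 : detFz n d₁ d₂ K =ᶠ[𝓝 x] fun x => detW n d₁ d₂ s ((θ, jetFull _ s K x), v) := by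
    filter_upwards [hK.eventually_analyticAt] with y hy
    exact (detJ_jetFull hs hy.differentiableAt).symm
  have hJ : AnalyticAt ℂ (jetFull _ s K) x := AnalyticAt.multiJet (idx := id) hK
  have h2 := ((hasFDerivAt_const (𝕜 := ℂ) θ x).prodMk hJ.differentiableAt.hasFDerivAt).prodMk
    (hasFDerivAt_const (𝕜 := ℂ) v x)
  have h3 := ((analyticAt_detW ((θ, jetFull _ s K x), v)).differentiableAt.hasFDerivAt.comp x
    h2).fderiv
  rw [h1.fderiv_eq]
  refine (congrArg (fun L => L b) h3).trans ?_
  refine congrArg (fderiv ℂ (detW n d₁ d₂ s) ((θ, jetFull _ s K x), v)) ?_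
  exact Prod.ext (Prod.ext rfl (fderiv_jetFull hK b)) rfl

lemma hasFDerivAt_tMap (hβz : ∀ y, zPart n d₁ d₂ (β y) = y.2) (s : ℕ)
    {y : Cn (n + (d₁ + d₂)) × Cn n} (hβ : AnalyticAt ℂ β y)
    (hK : AnalyticAt ℂ K (β y)) (hdet : detFz n d₁ d₂ K (β y) ≠ 0)
    (e : Cn (n + (d₁ + d₂)) × Cn n) :
    ∃ T' c, HasFDerivAt (𝕜 := ℂ) (tMap β s K) T' y ∧
      T' e = dvec β s e (tMap β (s + 1) K y) + ((c, 0), 0) ∧ (1 ≤ s ∨ n = 0 → c = 0) := by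
  have hβ' := hβ.differentiableAt.hasFDerivAt
  have hJ : AnalyticAt ℂ (jetFull _ s K) (β y) := AnalyticAt.multiJet (idx := id) hK
  have hG : AnalyticAt ℂ (jetZG n d₁ d₂ s K) (β y) := AnalyticAt.multiJet hK.gpart
  have hθ := (((hasDerivAt_inv hdet).comp_hasFDerivAt (β y)
    hK.detFz.differentiableAt.hasFDerivAt).comp y hβ')
  have hT := (hθ.prodMk (hJ.differentiableAt.hasFDerivAt.comp y hβ')).prodMk
    (((hG.differentiableAt.hasFDerivAt.comp y hβ').prodMk
      (hK.fpart.differentiableAt.hasFDerivAt.comp y hβ')).prodMk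
      (hβ'.prodMk (hasFDerivAt_fst (𝕜 := ℂ) (p := y))))
  have hT2 : HasFDerivAt (𝕜 := ℂ) (tMap β s K) _ y :=
    hT.congr_of_eventuallyEq (Eventually.of_forall fun y' => by
      simp [tMap, sig, Function.comp_def])
  have hb : baseDir β e (tMap β (s + 1) K y) = fderiv ℂ β y e :=
    congrArg (fun p => fderiv ℂ β p e) (Prod.ext rfl (hβz y))
  refine ⟨_, _, hT2, Prod.ext (Prod.ext (sub_eq_iff_eq_add'.1 rfl) ?_)
    (Prod.ext (Prod.ext ?_ ?_) (Prod.ext ?_ ?_)), fun hs => ?_⟩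
  · have h1 := fderiv_jetFull (r := s) hK (fderiv ℂ β y e)
    rw [← hb] at h1
    exact (congrArg _ hb.symm).trans (h1.trans (add_zero _).symm)
  · have h1 := fderiv_jetZG (r := s) hK (fderiv ℂ β y e)
    rw [← hb] at h1
    exact (congrArg _ hb.symm).trans (h1.trans (add_zero _).symm)
  · have h1 := fderiv_fpart hK.differentiableAt (fderiv ℂ β y e)
    rw [map_eq_sum_single (fderiv ℂ K (β y)), map_sum, ← hb] at h1
    refine (congrArg _ hb.symm).trans (h1.trans (Eq.trans ?_ (add_zero _).symm))
    refine Finset.sum_congr rfl fun j _ => ?_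
    rw [map_smul]
    congr 2
    exact (getJ_single_jetFull (by omega) _).symm
  · refine Eq.trans ?_ (add_zero _).symm
    exact hb.symm
  · exact (add_zero _).symm
  · rw [sub_eq_zero]
    have h1 := fderiv_detFz hs hK (fderiv ℂ β y e) (1 / detFz n d₁ d₂ K (β y))
      (tMap β s K y).2
    have h2 : truncW n d₁ d₂ s (s + 1) (tMap β (s + 1) K y) = tMap β s K y :=
      truncW_sig (Nat.le_succ s) _ _ _
    have h3 : (dvec β s e (tMap β (s + 1) K y)).1.1
        = -(1 / detFz n d₁ d₂ K (β y) * (1 / detFz n d₁ d₂ K (β y)))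
          * fderiv ℂ (detFz n d₁ d₂ K) (β y) (fderiv ℂ β y e) := by
      have h4 : (dvec β s e (tMap β (s + 1) K y)).1.1 =
          -(1 / detFz n d₁ d₂ K (β y) * (1 / detFz n d₁ d₂ K (β y))) *
            fderiv ℂ (detW n d₁ d₂ s) (truncW n d₁ d₂ s (s + 1) (tMap β (s + 1) K y))
              ((0, jetDir s (baseDir β e (tMap β (s + 1) K y))
                (jetFull (n + (d₁ + d₂)) (s + 1) K (β y))), 0) := rfl
      rw [h4, h2, hb, h1]
      rfl
    rw [h3]
    refine Eq.trans (b := -(detFz n d₁ d₂ K (β y) ^ 2)⁻¹ *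
      fderiv ℂ (detFz n d₁ d₂ K) (β y) (fderiv ℂ β y e)) ?_ (by field_simp)
    simp

lemma AnalyticAt.tMap (hβ : AnalyticAt ℂ β 0) (hβ0 : β 0 = 0) (hK : AnalyticAt ℂ K 0)
    (hdet : _root_.detFz n d₁ d₂ K 0 ≠ 0) (s : ℕ) : AnalyticAt ℂ (_root_.tMap β s K) 0 := by
  rw [← hβ0] at hK hdet
  have hJ : AnalyticAt ℂ (jetFull _ s K) (β 0) := AnalyticAt.multiJet (idx := id) hK
  have hG : AnalyticAt ℂ (jetZG n d₁ d₂ s K) (β 0) := AnalyticAt.multiJet hK.gpart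
  exact ((AnalyticAt.fun_div analyticAt_const (AnalyticAt.fun_comp hK.detFz hβ) hdet).prod
    (hJ.fun_comp hβ)).prod
    (((hG.fun_comp hβ).prod (hK.fpart.fun_comp hβ)).prod (hβ.prod analyticAt_fst))

lemma Adm.sig_zero {A B : Cn n → Cn n → Cn (d₁ + d₂) → Cn (d₁ + d₂)} {k : ℕ}
    {H : Cn (n + (d₁ + d₂)) → Cn (n + (d₁ + d₂))} (h : Adm n d₁ d₂ A B β k H K) {s : ℕ}
    (hs : s < k) : ∃ x0, sig n d₁ d₂ s K 0 0 = (x0, 0) := by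
  refine ⟨_, Prod.ext rfl (Prod.ext (Prod.ext ?_ ?_) rfl)⟩
  · exact funext fun ν => h.jet _ (ν.2.trans_lt hs)
  · exact congrArg (zPart n d₁ d₂) h.K0

lemma Adm.tMap_zero {A B : Cn n → Cn n → Cn (d₁ + d₂) → Cn (d₁ + d₂)} {k : ℕ}
    {H : Cn (n + (d₁ + d₂)) → Cn (n + (d₁ + d₂))} (h : Adm n d₁ d₂ A B β k H K) {s : ℕ}
    (hβ0 : β 0 = 0) (hs : s < k) : ∃ x0, tMap β s K 0 = (x0, 0) := by
  rw [tMap, hβ0]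
  exact h.sig_zero hs

/-- Near the origin, `totalD` computes the derivative along `tMap`. -/
lemma fderiv_comp_tMap (hβ : IsNiceBeta n d₁ d₂ β) (hK : AnalyticAt ℂ K 0)
    (hdet : detFz n d₁ d₂ K 0 ≠ 0) {s : ℕ} {Ψ : W0 n d₁ d₂ s × W1 n d₁ d₂ s → ℂ}
    (hΨ : AnalyticAt ℂ Ψ (tMap β s K 0))
    (hs : (1 ≤ s ∨ n = 0) ∨ ∀ v, fderiv ℂ Ψ v ((1, 0), 0) = 0)
    (e : Cn (n + (d₁ + d₂)) × Cn n) :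
    ∀ᶠ y in 𝓝 0, fderiv ℂ (fun y => Ψ (tMap β s K y)) y e
      = totalD β s e Ψ (tMap β (s + 1) K y) := by
  have hT := AnalyticAt.tMap hβ.an hβ.map_zero hK hdet s
  have hβc : Tendsto β (𝓝 0) (𝓝 0) := by
    simpa only [hβ.map_zero] using hβ.an.continuousAt.tendsto
  filter_upwards [hT.continuousAt.tendsto.eventually hΨ.eventually_analyticAt,
    hβ.an.eventually_analyticAt, hβc.eventually hK.eventually_analyticAt,
    hβc.eventually (hK.detFz.continuousAt.eventually_ne hdet)] with y h1 h2 h3 h4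
  obtain ⟨T', c, h5, h6, h7⟩ := hasFDerivAt_tMap hβ.zPart s h2 h3 h4 e
  have h8 : fderiv ℂ (fun y => Ψ (tMap β s K y)) y e = fderiv ℂ Ψ (tMap β s K y) (T' e) :=
    congrArg (fun L => L e) (h1.differentiableAt.hasFDerivAt.comp y h5).fderiv
  rw [h8, h6, totalD]
  have h9 : truncW n d₁ d₂ s (s + 1) (tMap β (s + 1) K y) = tMap β s K y :=
    truncW_sig (Nat.le_succ s) _ _ _
  rw [h9, map_add]
  have h10 : fderiv ℂ Ψ (tMap β s K y) ((c, 0), 0) = 0 := by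
    rcases hs with hs | hs
    · rw [h7 hs]
      exact map_zero _
    · have : (((c, 0), 0) : W0 n d₁ d₂ s × W1 n d₁ d₂ s) = c • ((1, 0), 0) := by
        ext <;> simp
      rw [this, map_smul, hs, smul_zero]
  rw [h10, add_zero]

end ChainRule

section JetRep

variable {n d₁ d₂ : ℕ} {A B : Cn n → Cn n → Cn (d₁ + d₂) → Cn (d₁ + d₂)}
  {β : Cn (n + (d₁ + d₂)) × Cn n → Cn (n + (d₁ + d₂))}

/-- The expression `φ H K` is given, up to an error of order `k - s`, by the ring element `Ψ`
evaluated at the `s`-jet of `K`. -/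
structure JetRep (A B : Cn n → Cn n → Cn (d₁ + d₂) → Cn (d₁ + d₂))
    (β : Cn (n + (d₁ + d₂)) × Cn n → Cn (n + (d₁ + d₂))) (s : ℕ)
    (φ : (Cn (n + (d₁ + d₂)) → Cn (n + (d₁ + d₂))) → (Cn (n + (d₁ + d₂)) → Cn (n + (d₁ + d₂))) →
      Cn (n + (d₁ + d₂)) × Cn n → ℂ) (Ψ : W0 n d₁ d₂ s × W1 n d₁ d₂ s → ℂ) : Prop where
  mem : MemRing _ _ Ψ
  an : ∀ k H K, s < k → detFz n d₁ d₂ K 0 ≠ 0 → Adm n d₁ d₂ A B β k H K → AnalyticAt ℂ (φ H K) 0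
  bigO : ∀ k H K, s < k → detFz n d₁ d₂ K 0 ≠ 0 → Adm n d₁ d₂ A B β k H K →
    (fun y => φ H K y - Ψ (tMap β s K y)) =O[𝓝 0] fun y => ‖y‖ ^ (k - s)

lemma MemRing.analyticAt_comp_tMap (hβ : IsNiceBeta n d₁ d₂ β) {s k : ℕ}
    {H K : Cn (n + (d₁ + d₂)) → Cn (n + (d₁ + d₂))}
    {Ψ : W0 n d₁ d₂ s × W1 n d₁ d₂ s → ℂ} (hΨ : MemRing _ _ Ψ) (hs : s < k)
    (hdet : detFz n d₁ d₂ K 0 ≠ 0) (h : Adm n d₁ d₂ A B β k H K) :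
    AnalyticAt ℂ Ψ (tMap β s K 0) ∧ AnalyticAt ℂ (fun y => Ψ (tMap β s K y)) 0 := by
  obtain ⟨x0, hx0⟩ := h.tMap_zero hβ.map_zero hs
  have h1 : AnalyticAt ℂ Ψ (tMap β s K 0) := by
    rw [hx0]
    exact hΨ.analyticAt x0
  exact ⟨h1, h1.fun_comp (AnalyticAt.tMap hβ.an hβ.map_zero h.anK hdet s)⟩

variable {s t : ℕ} {φ : (Cn (n + (d₁ + d₂)) → Cn (n + (d₁ + d₂))) →
    (Cn (n + (d₁ + d₂)) → Cn (n + (d₁ + d₂))) → Cn (n + (d₁ + d₂)) × Cn n → ℂ}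
  {Ψ : W0 n d₁ d₂ s × W1 n d₁ d₂ s → ℂ}

lemma JetRep.deriv (hβ : IsNiceBeta n d₁ d₂ β) (h : JetRep A B β s φ Ψ)
    (hs : (1 ≤ s ∨ n = 0) ∨ ∀ v, fderiv ℂ Ψ v ((1, 0), 0) = 0)
    (e : Cn (n + (d₁ + d₂)) × Cn n) :
    JetRep A B β (s + 1) (fun H K y => fderiv ℂ (φ H K) y e) (totalD β s e Ψ) where
  mem := h.mem.totalD hβ e
  an k H K hk hd hA := (h.an k H K (by omega) hd hA).dirDeriv e
  bigO k H K hk hd hA := by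
    have h1 := h.an k H K (by omega) hd hA
    obtain ⟨h2, h3⟩ := h.mem.analyticAt_comp_tMap hβ (by omega) hd hA
    have h4 := (h1.fun_sub h3).isBigO_dirDeriv (h.bigO k H K (by omega) hd hA) e
    refine h4.congr' ?_ EventuallyEq.rfl
    filter_upwards [fderiv_comp_tMap hβ hA.anK hd h2 hs e, h1.eventually_analyticAt,
      h3.eventually_analyticAt] with y hy1 hy2 hy3
    rw [← hy1]
    exact congrArg (fun L => L e) (fderiv_fun_sub hy2.differentiableAt hy3.differentiableAt)

lemma JetRep.lift (h : JetRep A B β s φ Ψ) (hst : s ≤ t) :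
    JetRep A B β t φ fun v => Ψ (truncW n d₁ d₂ s t v) where
  mem := h.mem.comp_prodMap (trunc0 n d₁ d₂ s t) (trunc1 n d₁ d₂ s t)
  an k H K hk hd hA := h.an k H K (by omega) hd hA
  bigO k H K hk hd hA := by
    refine ((h.bigO k H K (by omega) hd hA).trans (isBigO_pow_of_le (j := k - t)
      (by omega))).congr_left fun y => ?_
    exact congrArg (fun v => φ H K y - Ψ v) (truncW_sig hst K y.1 (β y)).symm

lemma JetRep.apply_zero (hβ : IsNiceBeta n d₁ d₂ β) (h : JetRep A B β s φ Ψ) {c : ℂ}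
    (hc : ∀ x0, Ψ (x0, 0) = c) {k : ℕ} {H K : Cn (n + (d₁ + d₂)) → Cn (n + (d₁ + d₂))}
    (hs : s < k) (hd : detFz n d₁ d₂ K 0 ≠ 0) (hA : Adm n d₁ d₂ A B β k H K) :
    Ψ (tMap β s K 0) = c ∧ φ H K 0 = c := by
  obtain ⟨x0, hx0⟩ := hA.tMap_zero hβ.map_zero hs
  have h0 : Ψ (tMap β s K 0) = c := by rw [hx0, hc]
  refine ⟨h0, ?_⟩
  have h1 : φ H K 0 - Ψ (tMap β s K 0) = 0 := by
    refine IsBigO.eq_zero_of_norm_pow (x₀ := (0 : Cn (n + (d₁ + d₂)) × Cn n))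
      (f := fun y => φ H K y - Ψ (tMap β s K y)) (n := k - s) ?_ (by omega)
    simpa only [sub_zero] using h.bigO k H K hs hd hA
  rw [← h0, ← sub_eq_zero, h1]

lemma JetRep.comp {ι : Type*} [Fintype ι] (hβ : IsNiceBeta n d₁ d₂ β)
    {φ : ι → (Cn (n + (d₁ + d₂)) → Cn (n + (d₁ + d₂))) →
      (Cn (n + (d₁ + d₂)) → Cn (n + (d₁ + d₂))) → Cn (n + (d₁ + d₂)) × Cn n → ℂ}
    {Ψ : ι → W0 n d₁ d₂ s × W1 n d₁ d₂ s → ℂ} (h : ∀ i, JetRep A B β s (φ i) (Ψ i)) {c : ι → ℂ}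
    (hc : ∀ i x0, Ψ i (x0, 0) = c i) {g : (ι → ℂ) → ℂ} (hg : AnalyticAt ℂ g c) :
    JetRep A B β s (fun H K y => g fun i => φ i H K y) fun v => g fun i => Ψ i v where
  mem := MemRing.comp_analyticAt (F := fun v i => Ψ i v) (fun i => (h i).mem) c
    (fun x0 => funext fun i => hc i x0) hg
  an k H K hk hd hA := by
    have h0 : (fun i => φ i H K 0) = c :=
      funext fun i => ((h i).apply_zero hβ (hc i) hk hd hA).2
    exact AnalyticAt.fun_comp (g := g) (f := fun y i => φ i H K y) (by rwa [h0])
      (analyticAt_pi_iff.2 fun i => (h i).an k H K hk hd hA)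
  bigO k H K hk hd hA := by
    have h0 : (fun i => φ i H K 0) = c :=
      funext fun i => ((h i).apply_zero hβ (hc i) hk hd hA).2
    have h0' : (fun i => Ψ i (tMap β s K 0)) = c :=
      funext fun i => ((h i).apply_zero hβ (hc i) hk hd hA).1
    have h1 : ContinuousAt (fun y i => φ i H K y) 0 :=
      continuousAt_pi.2 fun i => ((h i).an k H K hk hd hA).continuousAt
    have h2 : ContinuousAt (fun y i => Ψ i (tMap β s K y)) 0 :=
      continuousAt_pi.2 fun i => ((h i).mem.analyticAt_comp_tMap hβ hk hd hA).2.continuousAt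
    have h3 := AnalyticAt.isBigO_comp_sub hg (h0 ▸ h1.tendsto) (h0' ▸ h2.tendsto)
    exact h3.trans (isBigO_pi.2 fun i => (h i).bigO k H K hk hd hA)

/-- Vanishing on a subspace near `V₀ × {0}`. -/
def VanOn {V0 V1 : Type*} [NormedAddCommGroup V0] [NormedSpace ℂ V0]
    [NormedAddCommGroup V1] [NormedSpace ℂ V1] (W : Submodule ℂ (V0 × V1)) (Ψ : V0 × V1 → ℂ) : Prop :=
  ∀ x0 : V0, ∀ᶠ v in 𝓝 ((x0, 0) : V0 × V1), v ∈ W → Ψ v = 0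

lemma tendsto_truncW (s t : ℕ) (x0 : W0 n d₁ d₂ t) :
    Tendsto (truncW n d₁ d₂ s t) (𝓝 (x0, 0)) (𝓝 (trunc0 n d₁ d₂ s t x0, 0)) := by
  have := (truncW n d₁ d₂ s t).continuous.tendsto (x0, 0)
  have h : truncW n d₁ d₂ s t (x0, 0) = (trunc0 n d₁ d₂ s t x0, 0) :=
    Prod.ext rfl (map_zero (trunc1 n d₁ d₂ s t))
  rwa [h] at this

lemma VanOn.lift {W : Submodule ℂ (W0 n d₁ d₂ s × W1 n d₁ d₂ s)}
    {W' : Submodule ℂ (W0 n d₁ d₂ t × W1 n d₁ d₂ t)} (h : VanOn W Ψ)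
    (htr : ∀ v ∈ W', truncW n d₁ d₂ s t v ∈ W) : VanOn W' fun v => Ψ (truncW n d₁ d₂ s t v) := by
  intro x0
  filter_upwards [(tendsto_truncW s t x0).eventually (h (trunc0 n d₁ d₂ s t x0))] with v hv hW
  exact hv (htr v hW)

lemma VanOn.totalD {W : Submodule ℂ (W0 n d₁ d₂ s × W1 n d₁ d₂ s)}
    {W' : Submodule ℂ (W0 n d₁ d₂ (s + 1) × W1 n d₁ d₂ (s + 1))} (h : VanOn W Ψ)
    (hΨ : MemRing _ _ Ψ) {e : Cn (n + (d₁ + d₂)) × Cn n}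
    (htr : ∀ v ∈ W', truncW n d₁ d₂ s (s + 1) v ∈ W)
    (hd : ∀ x0, ∀ᶠ v in 𝓝 (x0, 0), v ∈ W' → dvec β s e v ∈ W) : VanOn W' (totalD β s e Ψ) := by
  intro x0
  have hT := tendsto_truncW s (s + 1) x0
  filter_upwards [hT.eventually (h (trunc0 n d₁ d₂ s (s + 1) x0)).eventually_nhds, hd x0,
    hT.eventually (hΨ.analyticAt _).eventually_analyticAt] with v h1 h2 h3 hW
  have hline : HasDerivAt (fun t : ℂ => truncW n d₁ d₂ s (s + 1) v + t • dvec β s e v)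
      (dvec β s e v) 0 := by
    simpa using ((hasDerivAt_id (0 : ℂ)).smul_const (dvec β s e v)).const_add
      (truncW n d₁ d₂ s (s + 1) v)
  have h0 : truncW n d₁ d₂ s (s + 1) v + (0 : ℂ) • dvec β s e v = truncW n d₁ d₂ s (s + 1) v := by
    rw [zero_smul, add_zero]
  have h4 : HasDerivAt (fun t : ℂ => Ψ (truncW n d₁ d₂ s (s + 1) v + t • dvec β s e v))
      (_root_.totalD β s e Ψ v) 0 :=
    HasFDerivAt.comp_hasDerivAt (0 : ℂ) (h0.symm ▸ h3.differentiableAt.hasFDerivAt) hline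
  have h5 : (fun t : ℂ => Ψ (truncW n d₁ d₂ s (s + 1) v + t • dvec β s e v)) =ᶠ[𝓝 0]
      fun _ => 0 := by
    have := hline.continuousAt.tendsto
    rw [h0] at this
    filter_upwards [this.eventually h1] with t ht
    exact ht (W.add_mem (htr v hW) (W.smul_mem _ (h2 hW)))
  exact (h4.congr_of_eventuallyEq h5.symm).unique (hasDerivAt_const 0 0)

end JetRep

section Subspaces

variable {n d₁ d₂ : ℕ} {β : Cn (n + (d₁ + d₂)) × Cn n → Cn (n + (d₁ + d₂))}

def fL (n d₁ d₂ s : ℕ) : (W0 n d₁ d₂ s × W1 n d₁ d₂ s) →L[ℂ] Cn n :=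
  (ContinuousLinearMap.snd ℂ (JetSp s n (d₁ + d₂)) (Cn n)).comp
    ((ContinuousLinearMap.fst ℂ (JetSp s n (d₁ + d₂) × Cn n) _).comp
      (ContinuousLinearMap.snd ℂ (W0 n d₁ d₂ s) (W1 n d₁ d₂ s)))

def zetaL (n d₁ d₂ s : ℕ) : (W0 n d₁ d₂ s × W1 n d₁ d₂ s) →L[ℂ] Cn (n + (d₁ + d₂)) :=
  (ContinuousLinearMap.fst ℂ (Cn (n + (d₁ + d₂))) (Cn (n + (d₁ + d₂)))).comp
    ((ContinuousLinearMap.snd ℂ (JetSp s n (d₁ + d₂) × Cn n) _).comp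
      (ContinuousLinearMap.snd ℂ (W0 n d₁ d₂ s) (W1 n d₁ d₂ s)))

def bigZL (n d₁ d₂ s : ℕ) : (W0 n d₁ d₂ s × W1 n d₁ d₂ s) →L[ℂ] Cn (n + (d₁ + d₂)) :=
  (ContinuousLinearMap.snd ℂ (Cn (n + (d₁ + d₂))) (Cn (n + (d₁ + d₂)))).comp
    ((ContinuousLinearMap.snd ℂ (JetSp s n (d₁ + d₂) × Cn n) _).comp
      (ContinuousLinearMap.snd ℂ (W0 n d₁ d₂ s) (W1 n d₁ d₂ s)))

/-- The subspace where the jet of `G` and `Z` vanish and `ζ = (χ, 0)`. -/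
def subK (n d₁ d₂ s : ℕ) : Submodule ℂ (W0 n d₁ d₂ s × W1 n d₁ d₂ s) :=
  LinearMap.ker (gamL n d₁ d₂ s).toLinearMap ⊓ LinearMap.ker (bigZL n d₁ d₂ s).toLinearMap ⊓
    LinearMap.ker ((wfL n d₁ d₂).comp (zetaL n d₁ d₂ s)).toLinearMap

/-- The subspace where the jet of `G`, the component `F` and `ζ` vanish and `Z = (z, 0)`. -/
def subI (n d₁ d₂ s : ℕ) : Submodule ℂ (W0 n d₁ d₂ s × W1 n d₁ d₂ s) :=
  LinearMap.ker (gamL n d₁ d₂ s).toLinearMap ⊓ LinearMap.ker (fL n d₁ d₂ s).toLinearMap ⊓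
    LinearMap.ker (zetaL n d₁ d₂ s).toLinearMap ⊓
    LinearMap.ker ((wfL n d₁ d₂).comp (bigZL n d₁ d₂ s)).toLinearMap

lemma mem_subK {s : ℕ} {v : W0 n d₁ d₂ s × W1 n d₁ d₂ s} : v ∈ subK n d₁ d₂ s ↔
    (v.2.1.1 = 0 ∧ v.2.2.2 = 0) ∧ wfL n d₁ d₂ v.2.2.1 = 0 := Iff.rfl

lemma mem_subI {s : ℕ} {v : W0 n d₁ d₂ s × W1 n d₁ d₂ s} : v ∈ subI n d₁ d₂ s ↔
    ((v.2.1.1 = 0 ∧ v.2.1.2 = 0) ∧ v.2.2.1 = 0) ∧ wfL n d₁ d₂ v.2.2.2 = 0 := Iff.rfl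

lemma mem_subK_base (s : ℕ) (x0 : W0 n d₁ d₂ s) : (x0, 0) ∈ subK n d₁ d₂ s :=
  mem_subK.2 ⟨⟨rfl, rfl⟩, map_zero _⟩

lemma mem_subI_base (s : ℕ) (x0 : W0 n d₁ d₂ s) : (x0, 0) ∈ subI n d₁ d₂ s :=
  mem_subI.2 ⟨⟨⟨rfl, rfl⟩, rfl⟩, map_zero _⟩

lemma truncW_mem_subK {s t : ℕ} : ∀ v ∈ subK n d₁ d₂ t, truncW n d₁ d₂ s t v ∈ subK n d₁ d₂ s := by
  intro v hv
  rw [mem_subK] at hv ⊢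
  exact ⟨⟨(congrArg _ hv.1.1).trans (map_zero (truncJ s t _ _)), hv.1.2⟩, hv.2⟩

lemma truncW_mem_subI {s t : ℕ} : ∀ v ∈ subI n d₁ d₂ t, truncW n d₁ d₂ s t v ∈ subI n d₁ d₂ s := by
  intro v hv
  rw [mem_subI] at hv ⊢
  exact ⟨⟨⟨(congrArg _ hv.1.1.1).trans (map_zero (truncJ s t _ _)), hv.1.1.2⟩, hv.1.2⟩, hv.2⟩

lemma wfL_embL (z : Cn n) : wfL n d₁ d₂ (embL n (d₁ + d₂) z) = 0 := by
  rw [embL_apply]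
  exact wfPart_append _ _

lemma embL_zL {Z : Cn (n + (d₁ + d₂))} (h : wfL n d₁ d₂ Z = 0) :
    embL n (d₁ + d₂) (zL n d₁ d₂ Z) = Z := by
  rw [embL_apply]
  conv_rhs => rw [← append_zPart_wfPart Z]
  exact congrArg _ h.symm

lemma IsNiceBeta.fderiv_left (hβ : IsNiceBeta n d₁ d₂ β) (χ' : Cn n) :
    ∀ᶠ χ in 𝓝 (0 : Cn n), fderiv ℂ β (0, χ) (0, χ') = embL n (d₁ + d₂) χ' := by
  have h1 : Tendsto (fun χ : Cn n => ((0 : Cn (n + (d₁ + d₂))), χ)) (𝓝 0) (𝓝 0) :=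
    (Continuous.prodMk_right 0).tendsto 0
  filter_upwards [hβ.left.eventually_nhds, h1.eventually hβ.an.eventually_analyticAt] with χ hχ ha
  have h2 := (ha.differentiableAt.hasFDerivAt.comp χ
    (hasFDerivAt_prodMk_right (𝕜 := ℂ) (0 : Cn (n + (d₁ + d₂))) χ)).fderiv
  have h3 : (β ∘ fun χ => (0, χ)) =ᶠ[𝓝 χ] embL n (d₁ + d₂) := by
    filter_upwards [hχ] with x hx
    rw [embL_apply]
    exact hx
  rw [h3.fderiv_eq, ContinuousLinearMap.fderiv] at h2
  exact (congrArg (fun L => L χ') h2).symm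

lemma IsNiceBeta.fderiv_right (hβ : IsNiceBeta n d₁ d₂ β) (z' : Cn n) :
    ∀ᶠ z in 𝓝 (0 : Cn n), fderiv ℂ β (embL n (d₁ + d₂) z, 0) (embL n (d₁ + d₂) z', 0) = 0 := by
  have h1 : Tendsto (fun z : Cn n => (embL n (d₁ + d₂) z, (0 : Cn n))) (𝓝 0) (𝓝 0) := by
    have : Continuous fun z : Cn n => (embL n (d₁ + d₂) z, (0 : Cn n)) := by fun_prop
    simpa [Prod.zero_eq_mk] using this.tendsto 0
  filter_upwards [hβ.right.eventually_nhds, h1.eventually hβ.an.eventually_analyticAt] with z hz ha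
  have h2 := (ha.differentiableAt.hasFDerivAt.comp z
    ((embL n (d₁ + d₂)).hasFDerivAt.prodMk (hasFDerivAt_const (𝕜 := ℂ) (0 : Cn n) z))).fderiv
  have h3 : (β ∘ fun z => (embL n (d₁ + d₂) z, 0)) =ᶠ[𝓝 z] fun _ => 0 := by
    filter_upwards [hz] with x hx
    simp only [Function.comp_apply, embL_apply]
    exact hx
  rw [h3.fderiv_eq, fderiv_fun_const] at h2
  exact (congrArg (fun L => L z') h2).symm

lemma tendsto_snd_base {V0 V1 F : Type*} [NormedAddCommGroup V0] [NormedSpace ℂ V0]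
    [NormedAddCommGroup V1] [NormedSpace ℂ V1] [NormedAddCommGroup F] [NormedSpace ℂ F]
    (L : V1 →L[ℂ] F) (x0 : V0) :
    Tendsto (fun v : V0 × V1 => L v.2) (𝓝 (x0, 0)) (𝓝 0) := by
  have : Continuous fun v : V0 × V1 => L v.2 := by fun_prop
  simpa using this.tendsto (x0, 0)

lemma IsNiceBeta.dvec_mem_subK (hβ : IsNiceBeta n d₁ d₂ β) (s : ℕ) (χ' : Cn n)
    (x0 : W0 n d₁ d₂ (s + 1)) : ∀ᶠ v in 𝓝 (x0, 0), v ∈ subK n d₁ d₂ (s + 1) →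
      dvec β s (0, χ') v ∈ subK n d₁ d₂ s ∧ baseDir β (0, χ') v = embL n (d₁ + d₂) χ' := by
  have h1 := tendsto_snd_base ((zL n d₁ d₂).comp ((ContinuousLinearMap.fst ℂ _ _).comp
    (ContinuousLinearMap.snd ℂ (JetSp (s + 1) n (d₁ + d₂) × Cn n)
      (Cn (n + (d₁ + d₂)) × Cn (n + (d₁ + d₂)))))) x0
  filter_upwards [h1.eventually (hβ.fderiv_left χ')] with v hv hW
  rw [mem_subK] at hW
  have hb : baseDir β (0, χ') v = embL n (d₁ + d₂) χ' := by
    rw [baseDir, hW.1.2]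
    exact hv
  have hw : ∀ j, baseDir β (0, χ') v (wfIdx n d₁ d₂ j) = 0 := fun j => by
    rw [hb]
    exact congrFun (wfL_embL χ') j
  refine ⟨mem_subK.2 ⟨⟨?_, rfl⟩, (congrArg _ hb).trans (wfL_embL χ')⟩, hb⟩
  simp only [dvec, hW.1.1, hw, zero_smul, Finset.sum_const_zero, add_zero]
  exact Finset.sum_eq_zero fun i _ => by
    rw [ContinuousLinearMap.map_zero, smul_zero]

lemma IsNiceBeta.dvec_mem_subI (hβ : IsNiceBeta n d₁ d₂ β) (s : ℕ) (z' : Cn n)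
    (x0 : W0 n d₁ d₂ (s + 1)) : ∀ᶠ v in 𝓝 (x0, 0), v ∈ subI n d₁ d₂ (s + 1) →
      dvec β s (embL n (d₁ + d₂) z', 0) v ∈ subI n d₁ d₂ s := by
  have h1 := tendsto_snd_base ((zL n d₁ d₂).comp ((ContinuousLinearMap.snd ℂ _ _).comp
    (ContinuousLinearMap.snd ℂ (JetSp (s + 1) n (d₁ + d₂) × Cn n)
      (Cn (n + (d₁ + d₂)) × Cn (n + (d₁ + d₂)))))) x0
  filter_upwards [h1.eventually (hβ.fderiv_right z')] with v hv hW
  rw [mem_subI] at hW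
  have hb : baseDir β (embL n (d₁ + d₂) z', 0) v = 0 := by
    rw [baseDir, hW.1.2, ContinuousLinearMap.map_zero, ← embL_zL hW.2]
    exact hv
  refine mem_subI.2 ⟨⟨⟨?_, ?_⟩, hb⟩, wfL_embL z'⟩ <;>
  simp only [dvec, hb, Pi.zero_apply, zero_smul, Finset.sum_const_zero, add_zero]

end Subspaces

section IterRep

variable {n d₁ d₂ : ℕ} {A B : Cn n → Cn n → Cn (d₁ + d₂) → Cn (d₁ + d₂)}
  {β : Cn (n + (d₁ + d₂)) × Cn n → Cn (n + (d₁ + d₂))}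

/-- Iterated derivatives of represented expressions are represented. -/
lemma JetRep.exists_iterDeriv (hβ : IsNiceBeta n d₁ d₂ β) (es : List (Cn (n + (d₁ + d₂)) × Cn n)) :
    ∀ {s t : ℕ} {φ : (Cn (n + (d₁ + d₂)) → Cn (n + (d₁ + d₂))) →
      (Cn (n + (d₁ + d₂)) → Cn (n + (d₁ + d₂))) → Cn (n + (d₁ + d₂)) × Cn n → ℂ}
      {Ψ : W0 n d₁ d₂ s × W1 n d₁ d₂ s → ℂ}, JetRep A B β s φ Ψ → 1 ≤ s ∨ n = 0 →
      s + es.length ≤ t →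
    ∃ Ψ' : W0 n d₁ d₂ t × W1 n d₁ d₂ t → ℂ,
      JetRep A B β t (fun H K => iterDeriv es (φ H K)) Ψ' ∧
      (VanOn (subI n d₁ d₂ s) Ψ → (∀ e ∈ es, ∃ z', e = (embL n (d₁ + d₂) z', 0)) →
        VanOn (subI n d₁ d₂ t) Ψ') := by
  induction es with
  | nil =>
    intro s t φ Ψ h _ hst
    exact ⟨_, h.lift hst, fun hv _ => hv.lift truncW_mem_subI⟩
  | cons e es ih =>
    intro s t φ Ψ h hs hst
    obtain ⟨Ψ', h1, h2⟩ := ih (t := t) (h.deriv hβ (Or.inl hs) e) (Or.inl (by omega))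
      (by simp only [List.length_cons] at hst; omega)
    refine ⟨Ψ', h1, fun hv he => h2 ?_ fun e' he' => he e' (List.mem_cons_of_mem _ he')⟩
    obtain ⟨z', rfl⟩ := he e List.mem_cons_self
    exact hv.totalD h.mem truncW_mem_subI (hβ.dvec_mem_subI s z')

end IterRep

section RepAlgebra

variable {n d₁ d₂ : ℕ} {A B : Cn n → Cn n → Cn (d₁ + d₂) → Cn (d₁ + d₂)}
  {β : Cn (n + (d₁ + d₂)) × Cn n → Cn (n + (d₁ + d₂))} {s : ℕ}
  {φ φ' : (Cn (n + (d₁ + d₂)) → Cn (n + (d₁ + d₂))) →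
    (Cn (n + (d₁ + d₂)) → Cn (n + (d₁ + d₂))) → Cn (n + (d₁ + d₂)) × Cn n → ℂ}
  {Ψ Ψ' : W0 n d₁ d₂ s × W1 n d₁ d₂ s → ℂ}

lemma JetRep.congr (h : JetRep A B β s φ Ψ) (hφ : ∀ k H K, s < k → detFz n d₁ d₂ K 0 ≠ 0 →
    Adm n d₁ d₂ A B β k H K → φ H K =ᶠ[𝓝 0] φ' H K) : JetRep A B β s φ' Ψ where
  mem := h.mem
  an k H K hk hd hA := (h.an k H K hk hd hA).congr (hφ k H K hk hd hA)
  bigO k H K hk hd hA := (h.bigO k H K hk hd hA).congr'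
    ((hφ k H K hk hd hA).mono fun y hy => by simp only [hy]) EventuallyEq.rfl

/-- Ring elements represent their own pullbacks. -/
lemma MemRing.jetRep (hβ : IsNiceBeta n d₁ d₂ β) (hΨ : MemRing _ _ Ψ) :
    JetRep A B β s (fun _ K y => Ψ (tMap β s K y)) Ψ where
  mem := hΨ
  an _ _ _ hk hd hA := (hΨ.analyticAt_comp_tMap hβ hk hd hA).2
  bigO _ _ _ _ _ _ := by simpa using isBigO_zero _ _

lemma jetRep_const (c : ℂ) : JetRep A B β s (fun _ _ _ => c) fun _ => c where
  mem := memRing_const c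
  an _ _ _ _ _ _ := analyticAt_const
  bigO _ _ _ _ _ _ := by simpa using isBigO_zero _ _

lemma JetRep.add (h : JetRep A B β s φ Ψ) (h' : JetRep A B β s φ' Ψ') :
    JetRep A B β s (fun H K y => φ H K y + φ' H K y) fun v => Ψ v + Ψ' v where
  mem := h.mem.add h'.mem
  an k H K hk hd hA := (h.an k H K hk hd hA).fun_add (h'.an k H K hk hd hA)
  bigO k H K hk hd hA := ((h.bigO k H K hk hd hA).add (h'.bigO k H K hk hd hA)).congr_left
    fun y => by ring

lemma JetRep.mul (hβ : IsNiceBeta n d₁ d₂ β) (h : JetRep A B β s φ Ψ)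
    (h' : JetRep A B β s φ' Ψ') :
    JetRep A B β s (fun H K y => φ H K y * φ' H K y) fun v => Ψ v * Ψ' v where
  mem := h.mem.mul h'.mem
  an k H K hk hd hA := (h.an k H K hk hd hA).fun_mul (h'.an k H K hk hd hA)
  bigO k H K hk hd hA := by
    have h1 : (φ H K) =O[𝓝 0] fun _ => (1 : ℝ) :=
      (h.an k H K hk hd hA).continuousAt.isBigO_one ℝ
    have h2 : (fun y => Ψ' (tMap β s K y)) =O[𝓝 0] fun _ => (1 : ℝ) :=
      (h'.mem.analyticAt_comp_tMap hβ hk hd hA).2.continuousAt.isBigO_one ℝ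
    have h3 := h1.mul (h'.bigO k H K hk hd hA)
    have h4 := (h.bigO k H K hk hd hA).mul h2
    simp only [one_mul, mul_one] at h3 h4
    exact (h3.add h4).congr_left fun y => by ring

lemma JetRep.sub (hβ : IsNiceBeta n d₁ d₂ β) (h : JetRep A B β s φ Ψ)
    (h' : JetRep A B β s φ' Ψ') :
    JetRep A B β s (fun H K y => φ H K y - φ' H K y) fun v => Ψ v - Ψ' v := by
  simpa [sub_eq_add_neg] using h.add ((jetRep_const (-1)).mul hβ h')

lemma JetRep.sum {ι : Type*} {φ : ι → (Cn (n + (d₁ + d₂)) → Cn (n + (d₁ + d₂))) →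
      (Cn (n + (d₁ + d₂)) → Cn (n + (d₁ + d₂))) → Cn (n + (d₁ + d₂)) × Cn n → ℂ}
    {Ψ : ι → W0 n d₁ d₂ s × W1 n d₁ d₂ s → ℂ} (S : Finset ι)
    (h : ∀ i ∈ S, JetRep A B β s (φ i) (Ψ i)) :
    JetRep A B β s (fun H K y => ∑ i ∈ S, φ i H K y) fun v => ∑ i ∈ S, Ψ i v := by
  classical
  induction S using Finset.induction_on with
  | empty => simpa using jetRep_const 0
  | insert i S hi ih =>
    simp only [Finset.sum_insert hi]
    exact (h i (by simp)).add (ih fun j hj => h j (by simp [hj]))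

lemma JetRep.prod (hβ : IsNiceBeta n d₁ d₂ β) {ι : Type*}
    {φ : ι → (Cn (n + (d₁ + d₂)) → Cn (n + (d₁ + d₂))) →
      (Cn (n + (d₁ + d₂)) → Cn (n + (d₁ + d₂))) → Cn (n + (d₁ + d₂)) × Cn n → ℂ}
    {Ψ : ι → W0 n d₁ d₂ s × W1 n d₁ d₂ s → ℂ} (S : Finset ι)
    (h : ∀ i ∈ S, JetRep A B β s (φ i) (Ψ i)) :
    JetRep A B β s (fun H K y => ∏ i ∈ S, φ i H K y) fun v => ∏ i ∈ S, Ψ i v := by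
  classical
  induction S using Finset.induction_on with
  | empty => simpa using jetRep_const 1
  | insert i S hi ih =>
    simp only [Finset.prod_insert hi]
    exact (h i (by simp)).mul hβ (ih fun j hj => h j (by simp [hj]))

variable {ι : Type*} [Fintype ι] [DecidableEq ι]
  {P : (Cn (n + (d₁ + d₂)) → Cn (n + (d₁ + d₂))) → (Cn (n + (d₁ + d₂)) → Cn (n + (d₁ + d₂))) →
    Cn (n + (d₁ + d₂)) × Cn n → Matrix ι ι ℂ}
  {X : W0 n d₁ d₂ s × W1 n d₁ d₂ s → Matrix ι ι ℂ}

lemma JetRep.det (hβ : IsNiceBeta n d₁ d₂ β)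
    (h : ∀ i j, JetRep A B β s (fun H K y => P H K y i j) fun v => X v i j) :
    JetRep A B β s (fun H K y => (P H K y).det) fun v => (X v).det := by
  simp only [Matrix.det_apply']
  exact JetRep.sum _ fun σ _ => (jetRep_const _).mul hβ (JetRep.prod hβ _ fun i _ => h _ _)

lemma JetRep.adjugate (hβ : IsNiceBeta n d₁ d₂ β)
    (h : ∀ i j, JetRep A B β s (fun H K y => P H K y i j) fun v => X v i j) (i j : ι) :
    JetRep A B β s (fun H K y => (P H K y).adjugate i j) fun v => (X v).adjugate i j := by
  simp only [Matrix.adjugate_apply]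
  refine JetRep.det hβ fun i' j' => ?_
  by_cases h' : i' = j
  · subst h'; simpa using jetRep_const _
  · simpa [h'] using h i' j'

/-- Representation of the inverse of a function which agrees with `det F_z` at the base. -/
lemma JetRep.inv (hβ : IsNiceBeta n d₁ d₂ β) (hs : 1 ≤ s ∨ n = 0) (h : JetRep A B β s φ Ψ)
    (h0 : ∀ x0, Ψ (x0, 0) = detW n d₁ d₂ s (x0, 0)) :
    ∃ Ψ' : W0 n d₁ d₂ s × W1 n d₁ d₂ s → ℂ, JetRep A B β s (fun H K y => (φ H K y)⁻¹) Ψ' ∧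
      ∀ k H K, s < k → detFz n d₁ d₂ K 0 ≠ 0 → Adm n d₁ d₂ A B β k H K →
        ∀ᶠ y in 𝓝 0, φ H K y ≠ 0 := by
  have hθ : MemRing (W0 n d₁ d₂ s) (W1 n d₁ d₂ s) fun v => v.1.1 :=
    memRing_linear ((ContinuousLinearMap.fst ℂ ℂ _).comp
      (ContinuousLinearMap.fst ℂ (W0 n d₁ d₂ s) (W1 n d₁ d₂ s)))
  have h1 : JetRep A B β s (fun _ K y => detFz n d₁ d₂ K (β y)) (detW n d₁ d₂ s) := by
    refine ((memRing_detW s).jetRep hβ).congr fun k H K _ _ hA => ?_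
    have hβc : Tendsto β (𝓝 0) (𝓝 0) := by
      simpa only [hβ.map_zero] using hβ.an.continuousAt.tendsto
    filter_upwards [hβc.eventually hA.anK.eventually_analyticAt] with y hy
    exact detJ_jetFull hs hy.differentiableAt
  have h2 : JetRep A B β s (fun _ K y => 1 / detFz n d₁ d₂ K (β y)) fun v => v.1.1 :=
    hθ.jetRep hβ
  have h3 := h2.mul hβ (h.sub hβ h1)
  have hb : ∀ x0 : W0 n d₁ d₂ s, ((x0, 0) : W0 n d₁ d₂ s × W1 n d₁ d₂ s).1.1 *
      (Ψ (x0, 0) - detW n d₁ d₂ s (x0, 0)) = 0 := fun x0 => by rw [h0, sub_self, mul_zero]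
  have hg : AnalyticAt ℂ (fun x : Unit → ℂ => (1 + x ())⁻¹) fun _ => 0 :=
    AnalyticAt.fun_inv (analyticAt_const.fun_add ((ContinuousLinearMap.proj (R := ℂ)
      (φ := fun _ : Unit => ℂ) ()).analyticAt _)) (by simp)
  have h4 := h2.mul hβ (JetRep.comp (ι := Unit) hβ (fun _ => h3) (fun _ => hb) hg)
  have key : ∀ k H K, s < k → detFz n d₁ d₂ K 0 ≠ 0 → Adm n d₁ d₂ A B β k H K →
      ∀ᶠ y in 𝓝 0, detFz n d₁ d₂ K (β y) ≠ 0 ∧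
        1 + 1 / detFz n d₁ d₂ K (β y) * (φ H K y - detFz n d₁ d₂ K (β y)) ≠ 0 := by
    intro k H K hk hd hA
    have hβc : Tendsto β (𝓝 0) (𝓝 0) := by
      simpa only [hβ.map_zero] using hβ.an.continuousAt.tendsto
    refine (hβc.eventually (hA.anK.detFz.continuousAt.eventually_ne hd)).and ?_
    refine ContinuousAt.eventually_ne
      (continuousAt_const.add (h3.an k H K hk hd hA).continuousAt) ?_
    rw [(h3.apply_zero hβ hb hk hd hA).2, add_zero]
    exact one_ne_zero
  have hφ : ∀ {a b : ℂ}, b ≠ 0 → 1 + 1 / b * (a - b) = a / b := fun {a b} hb => by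
    field_simp
    ring
  refine ⟨_, h4.congr fun k H K hk hd hA => ?_, fun k H K hk hd hA => ?_⟩
  · filter_upwards [key k H K hk hd hA] with y hy
    rw [hφ hy.1]
    rw [inv_div, one_div, div_eq_mul_inv, ← mul_assoc, inv_mul_cancel₀ hy.1, one_mul]
  · filter_upwards [key k H K hk hd hA] with y hy h0
    exact hy.2 (by rw [hφ hy.1, h0, zero_div])

end RepAlgebra

section FDerivatives

variable {n d₁ d₂ : ℕ}

/-- The arguments of the defining map of the target in the equation satisfied by `H̄`. -/
def argX (β : Cn (n + (d₁ + d₂)) × Cn n → Cn (n + (d₁ + d₂)))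
    (H K : Cn (n + (d₁ + d₂)) → Cn (n + (d₁ + d₂))) (y : Cn (n + (d₁ + d₂)) × Cn n) :
    (Cn n × Cn n) × Cn (d₁ + d₂) :=
  ((Fpart n d₁ d₂ K (β y), Fpart n d₁ d₂ H y.1), Gpart n d₁ d₂ H y.1)

/-- Iterated derivatives of the components of `A` in the first group of variables. -/
def derivA (A : Cn n → Cn n → Cn (d₁ + d₂) → Cn (d₁ + d₂)) (j : Fin (d₁ + d₂)) (bs : List (Fin n)) :
    (Cn n × Cn n) × Cn (d₁ + d₂) → ℂ :=
  iterDeriv (bs.map fun b => (((Pi.single b 1 : Cn n), (0 : Cn n)), (0 : Cn (d₁ + d₂))))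
    fun P => A P.1.1 P.1.2 P.2 j

lemma IsNormalMap.analyticAt_derivA {A : Cn n → Cn n → Cn (d₁ + d₂) → Cn (d₁ + d₂)}
    (hA : IsNormalMap n (d₁ + d₂) A) (j : Fin (d₁ + d₂)) (bs : List (Fin n)) :
    AnalyticAt ℂ (derivA A j bs) 0 :=
  AnalyticAt.iterDeriv _ (((ContinuousLinearMap.proj (R := ℂ) (φ := fun _ => ℂ) j).analyticAt
    _).fun_comp hA.an)

variable {s : ℕ} {A B : Cn n → Cn n → Cn (d₁ + d₂) → Cn (d₁ + d₂)}
  {β : Cn (n + (d₁ + d₂)) × Cn n → Cn (n + (d₁ + d₂))}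
  {H K : Cn (n + (d₁ + d₂)) → Cn (n + (d₁ + d₂))}

lemma IsNiceBeta.analyticAt_comp (hβ : IsNiceBeta n d₁ d₂ β) {F : Type*} [NormedAddCommGroup F]
    [NormedSpace ℂ F] {f : Cn (n + (d₁ + d₂)) → F} (hf : AnalyticAt ℂ f 0) :
    AnalyticAt ℂ (fun y => f (β y)) 0 :=
  AnalyticAt.fun_comp (by simpa only [hβ.map_zero] using hf) hβ.an

lemma analyticAt_comp_fst {E F G : Type*} [NormedAddCommGroup E] [NormedSpace ℂ E]
    [NormedAddCommGroup F] [NormedSpace ℂ F] [NormedAddCommGroup G] [NormedSpace ℂ G]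
    {f : E → F} (hf : AnalyticAt ℂ f 0) : AnalyticAt ℂ (fun y : E × G => f y.1) 0 :=
  AnalyticAt.comp_of_eq (f := fun y : E × G => y.1) hf ((ContinuousLinearMap.fst ℂ E G).analyticAt _) rfl

lemma Adm.fpart_zero {k : ℕ} (h : Adm n d₁ d₂ A B β k H K) : Fpart n d₁ d₂ H 0 = 0 := by
  funext i; simp [Fpart, h.H0]

lemma Adm.gpart_zero {k : ℕ} (h : Adm n d₁ d₂ A B β k H K) : Gpart n d₁ d₂ H 0 = 0 := by
  funext i; simp [Gpart, h.H0]

lemma Adm.fpart_zero' {k : ℕ} (h : Adm n d₁ d₂ A B β k H K) : Fpart n d₁ d₂ K 0 = 0 := by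
  funext i; simp [Fpart, h.K0]

lemma Adm.analyticAt_argX {k : ℕ} (h : Adm n d₁ d₂ A B β k H K) (hβ : IsNiceBeta n d₁ d₂ β) :
    AnalyticAt ℂ (argX β H K) 0 :=
  ((hβ.analyticAt_comp h.anK.fpart).prod (analyticAt_comp_fst h.anH.fpart)).prod
    (analyticAt_comp_fst h.anH.gpart)

lemma Adm.argX_zero {k : ℕ} (h : Adm n d₁ d₂ A B β k H K) (hβ : IsNiceBeta n d₁ d₂ β) :
    argX β H K 0 = 0 := by
  simp only [argX, hβ.map_zero, Prod.fst_zero, h.fpart_zero, h.gpart_zero, h.fpart_zero']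
  rfl

lemma Adm.fderiv_argX {k : ℕ} (h : Adm n d₁ d₂ A B β k H K) (hβ : IsNiceBeta n d₁ d₂ β)
    (χ : Cn n) : ∀ᶠ y in 𝓝 0, fderiv ℂ (argX β H K) y (0, χ) =
      ∑ b, fderiv ℂ (fun y => Fpart n d₁ d₂ K (β y) b) y (0, χ) •
        (((Pi.single b 1 : Cn n), (0 : Cn n)), (0 : Cn (d₁ + d₂))) := by
  have hf : Tendsto (fun y : Cn (n + (d₁ + d₂)) × Cn n => y.1) (𝓝 0) (𝓝 0) :=
    (continuous_fst.tendsto _)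
  filter_upwards [(hβ.analyticAt_comp h.anK.fpart).eventually_analyticAt,
    hf.eventually h.anH.eventually_analyticAt] with y hy hy'
  have h1 := hy.differentiableAt.hasFDerivAt
  have h2 := hy'.fpart.differentiableAt.hasFDerivAt.comp y hasFDerivAt_fst
  have h3 := hy'.gpart.differentiableAt.hasFDerivAt.comp y hasFDerivAt_fst
  have h4 : fderiv ℂ (argX β H K) y = _ := ((h1.prodMk h2).prodMk h3).fderiv
  rw [h4]
  simp only [ContinuousLinearMap.prod_apply, ContinuousLinearMap.comp_apply,
    ContinuousLinearMap.coe_fst', ContinuousLinearMap.map_zero]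
  have h5 : fderiv ℂ (fun y => Fpart n d₁ d₂ K (β y)) y (0, χ) =
      ∑ b, fderiv ℂ (fun y => Fpart n d₁ d₂ K (β y) b) y (0, χ) • (Pi.single b 1 : Cn n) := by
    rw [pi_eq_sum_univ' (fderiv ℂ (fun y => Fpart n d₁ d₂ K (β y)) y (0, χ))]
    refine Finset.sum_congr rfl fun b _ => ?_
    rw [fderiv_apply_pi hy.differentiableAt]
  rw [h5]
  refine Prod.ext (Prod.ext ?_ ?_) ?_ <;> simp [Prod.fst_sum, Prod.snd_sum]

lemma Adm.fderiv_derivA {k : ℕ} (h : Adm n d₁ d₂ A B β k H K) (hβ : IsNiceBeta n d₁ d₂ β)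
    (hA : IsNormalMap n (d₁ + d₂) A) (j : Fin (d₁ + d₂)) (bs : List (Fin n)) (χ : Cn n) :
    ∀ᶠ y in 𝓝 0, fderiv ℂ (fun y => derivA A j bs (argX β H K y)) y (0, χ) =
      ∑ b, fderiv ℂ (fun y => Fpart n d₁ d₂ K (β y) b) y (0, χ) *
        derivA A j (bs ++ [b]) (argX β H K y) := by
  have ht : Tendsto (argX β H K) (𝓝 0) (𝓝 0) := by
    simpa only [h.argX_zero hβ] using (h.analyticAt_argX hβ).continuousAt.tendsto
  filter_upwards [h.fderiv_argX hβ χ, (h.analyticAt_argX hβ).eventually_analyticAt,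
    ht.eventually (hA.analyticAt_derivA j bs).eventually_analyticAt] with y hy h1 h2
  have h3 := (h2.differentiableAt.hasFDerivAt.comp y h1.differentiableAt.hasFDerivAt).fderiv
  have h4 : fderiv ℂ (fun y => derivA A j bs (argX β H K y)) y = _ := h3
  rw [h4, ContinuousLinearMap.comp_apply, hy, map_sum]
  refine Finset.sum_congr rfl fun b _ => ?_
  rw [map_smul, smul_eq_mul]
  congr 1
  simp only [derivA, List.map_append, List.map_cons, List.map_nil, iterDeriv_concat]


lemma totalD_clm (L : (W0 n d₁ d₂ s × W1 n d₁ d₂ s) →L[ℂ] ℂ)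
    (e : Cn (n + (d₁ + d₂)) × Cn n) (v : W0 n d₁ d₂ (s + 1) × W1 n d₁ d₂ (s + 1)) :
    totalD β s e L v = L (dvec β s e v) := by
  rw [totalD, ContinuousLinearMap.fderiv]

/-- The derivatives along `𝓜` of the components of `F̄` are represented. -/
lemma IsNiceBeta.exists_rep_fderiv_fpart (hβ : IsNiceBeta n d₁ d₂ β) (s : ℕ) :
    ∃ Ψ : W0 n d₁ d₂ (s + 1) × W1 n d₁ d₂ (s + 1) → Matrix (Fin n) (Fin n) ℂ,
      (∀ i b, JetRep A B β (s + 1) (fun _ K y => (Matrix.of fun i b =>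
        fderiv ℂ (fun y => Fpart n d₁ d₂ K (β y) b) y (0, Pi.single i 1)) i b) fun v => Ψ v i b) ∧
      ∀ x0, (Ψ (x0, 0)).det = detW n d₁ d₂ (s + 1) (x0, 0) := by
  let L : Fin n → (W0 n d₁ d₂ s × W1 n d₁ d₂ s) →L[ℂ] ℂ := fun b =>
    (ContinuousLinearMap.proj (R := ℂ) (φ := fun _ => ℂ) b).comp (fL n d₁ d₂ s)
  have hL : ∀ b, JetRep A B β s (fun _ K y => Fpart n d₁ d₂ K (β y) b) (L b) :=
    fun b => (memRing_linear (L b)).jetRep hβ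
  have hθ : ∀ b v, fderiv ℂ (L b) v ((1, 0), 0) = 0 := fun b v => by
    rw [ContinuousLinearMap.fderiv]; rfl
  refine ⟨fun v => Matrix.of fun i b => totalD β s (0, Pi.single i 1) (L b) v,
    fun i b => (hL b).deriv hβ (Or.inr (hθ b)) _, fun x0 => ?_⟩
  rw [detW, detJ, ← Matrix.det_transpose]
  congr 1
  ext b i
  have h1 := ((hβ.dvec_mem_subK s (Pi.single i 1) x0).self_of_nhds (mem_subK_base _ x0)).2
  rw [embL_single] at h1
  simp only [Matrix.transpose_apply, Matrix.of_apply, totalD_clm]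
  change (∑ j, baseDir β _ _ j • zL n d₁ d₂ (getJ (s + 1) _ _ (Pi.single j 1) x0.2)) b = _
  rw [h1]
  simp only [Pi.single_apply, ite_smul, one_smul, zero_smul, Finset.sum_ite_eq', Finset.mem_univ,
    if_true]
  rfl

/-- The derivatives of `A` in the first variables, evaluated along an approximate equivalence,
are represented by ring elements. -/
theorem exists_rep_derivA (hβ : IsNiceBeta n d₁ d₂ β) (hA : IsNormalMap n (d₁ + d₂) A)
    (j : Fin (d₁ + d₂)) (s : ℕ) : ∀ bs : List (Fin n), bs.length = s →
    ∃ Θ : W0 n d₁ d₂ s × W1 n d₁ d₂ s → ℂ,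
      JetRep A B β s (fun H K y => derivA A j bs (argX β H K y)) Θ ∧
      VanOn (subK n d₁ d₂ s) Θ ∧ (s = 0 → ∀ v, fderiv ℂ Θ v ((1, 0), 0) = 0) := by
  induction s with
  | zero =>
    intro bs hbs
    obtain rfl := List.length_eq_zero_iff.1 hbs
    let L : (W0 n d₁ d₂ 0 × W1 n d₁ d₂ 0) →L[ℂ] ℂ :=
      (ContinuousLinearMap.proj (R := ℂ) (φ := fun _ => ℂ) j).comp
        ((getJ 0 n (d₁ + d₂) 0).comp (gamL n d₁ d₂ 0))
    refine ⟨L, ⟨memRing_linear L, fun k H K _ _ h => ?_, fun k H K _ _ h => ?_⟩,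
      fun x0 => Eventually.of_forall fun v hv => ?_, fun _ v => ?_⟩
    · exact AnalyticAt.fun_comp (by simpa only [h.argX_zero hβ] using hA.analyticAt_derivA j [])
        (h.analyticAt_argX hβ)
    · refine ((h.id₁ j).neg_left).congr_left fun y => ?_
      have : L (tMap β 0 K y) = Gpart n d₁ d₂ K (β y) j := by
        change getJ 0 n (d₁ + d₂) 0 (multiJet (zIdx n d₁ d₂) 0 _ (β y)) j = _
        rw [getJ_multiJet (by simp)]
        rw [mderivIdx, List.flatMap_eq_nil_iff.2 (by simp)]
        rfl
      rw [this]
      simp [derivA, argX, iterDeriv]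
    · change getJ 0 n (d₁ + d₂) 0 v.2.1.1 j = 0
      rw [(mem_subK.1 hv).1.1, ContinuousLinearMap.map_zero, Pi.zero_apply]
    · rw [ContinuousLinearMap.fderiv]
      exact congrFun (ContinuousLinearMap.map_zero (getJ 0 n (d₁ + d₂) 0)) j
  | succ s ih =>
    intro bs hbs
    rcases List.eq_nil_or_concat bs with rfl | ⟨bs, b, rfl⟩
    · simp at hbs
    obtain ⟨Θ, h1, h2, h3⟩ := ih bs (by simpa using hbs)
    have hs : (1 ≤ s ∨ n = 0) ∨ ∀ v, fderiv ℂ Θ v ((1, 0), 0) = 0 := by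
      rcases Nat.eq_zero_or_pos s with h | h
      exacts [Or.inr (h3 h), Or.inl (Or.inl h)]
    obtain ⟨P, hP, hP0⟩ := hβ.exists_rep_fderiv_fpart (A := A) (B := B) s
    have hY := fun i : Fin n => h1.deriv hβ hs (0, Pi.single i 1)
    obtain ⟨D, hD, hDne⟩ := (JetRep.det hβ hP).inv hβ (Or.inl (by omega)) hP0
    refine ⟨_, (JetRep.sum Finset.univ fun i _ =>
      ((JetRep.adjugate hβ hP b i).mul hβ hD).mul hβ (hY i)).congr fun k H K hk hd h => ?_,
      fun x0 => ?_, by simp⟩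
    · have h4 := eventually_all.2 fun i : Fin n =>
        h.fderiv_derivA hβ hA j bs (Pi.single i 1)
      filter_upwards [h4, hDne k H K hk hd h] with y hy hy'
      set M : Matrix (Fin n) (Fin n) ℂ := Matrix.of fun i b =>
        fderiv ℂ (fun y => Fpart n d₁ d₂ K (β y) b) y (0, Pi.single i 1) with hM
      have h5 : (fun i => fderiv ℂ (fun y => derivA A j bs (argX β H K y)) y (0, Pi.single i 1)) =
          M.mulVec fun b => derivA A j (bs ++ [b]) (argX β H K y) := funext hy
      have h6 := congrFun (congrArg M.adjugate.mulVec h5) b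
      rw [Matrix.mulVec_mulVec, Matrix.adjugate_mul, Matrix.smul_mulVec, Matrix.one_mulVec,
        Pi.smul_apply, smul_eq_mul, Matrix.mulVec, dotProduct] at h6
      simp only [List.concat_eq_append]
      rw [← inv_mul_cancel_left₀ hy' (derivA A j (bs ++ [b]) (argX β H K y)), ← h6, Finset.mul_sum]
      exact Finset.sum_congr rfl fun i _ => by ring
    · have h7 : ∀ᶠ v in 𝓝 (x0, 0), ∀ i : Fin n, v ∈ subK n d₁ d₂ (s + 1) →
          totalD β s (0, Pi.single i 1) Θ v = 0 := eventually_all.2 fun i =>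
        h2.totalD h1.mem truncW_mem_subK (fun x0 => (hβ.dvec_mem_subK s _ x0).mono
          fun v hv hv' => (hv hv').1) x0
      filter_upwards [h7] with v hv hv'
      exact Finset.sum_eq_zero fun i _ => by rw [hv i hv', mul_zero]

end FDerivatives

/-- An analytic map with finite-dimensional source whose derivative in the second group of
variables is injective has a parametrised analytic left inverse. -/
lemma exists_analyticAt_left_inverse {E X Y : Type*} [NormedAddCommGroup E] [NormedSpace ℂ E]
    [FiniteDimensional ℂ E] [NormedAddCommGroup X] [NormedSpace ℂ X] [FiniteDimensional ℂ X]
    [NormedAddCommGroup Y] [NormedSpace ℂ Y] [FiniteDimensional ℂ Y] {Φ : E × X → Y}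
    (hΦ : AnalyticAt ℂ Φ 0) (h0 : Φ 0 = 0) (hinj : ∀ x : X, fderiv ℂ Φ 0 (0, x) = 0 → x = 0) :
    ∃ S : Y × E → X, AnalyticAt ℂ S 0 ∧ S 0 = 0 ∧ ∀ᶠ p in 𝓝 (0 : E × X), S (Φ p, p.1) = p.2 := by
  have : CompleteSpace E := FiniteDimensional.complete ℂ E
  have : CompleteSpace X := FiniteDimensional.complete ℂ X
  obtain ⟨g, hg⟩ := LinearMap.exists_leftInverse_of_injective
    (((fderiv ℂ Φ 0).comp (ContinuousLinearMap.inr ℂ E X) : X →L[ℂ] Y) : X →ₗ[ℂ] Y)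
    (LinearMap.ker_eq_bot'.2 fun x hx => hinj x hx)
  let G : Y →L[ℂ] X := LinearMap.toContinuousLinearMap g
  have hG : ∀ x, G (fderiv ℂ Φ 0 (0, x)) = x := fun x => LinearMap.congr_fun hg x
  let Ξ : E × X → E × X := fun p => (p.1, G (Φ p))
  have hΞ : AnalyticAt ℂ Ξ 0 := ((ContinuousLinearMap.fst ℂ E X).analyticAt 0).prod
    ((G.analyticAt _).fun_comp hΦ)
  let D : E × X →L[ℂ] E × X := (ContinuousLinearMap.fst ℂ E X).prod (G.comp (fderiv ℂ Φ 0))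
  have hD : HasFDerivAt Ξ D 0 := hasFDerivAt_fst.prodMk
    (G.hasFDerivAt.comp (0 : E × X) hΦ.differentiableAt.hasFDerivAt)
  have hDi : Function.Injective (D : E × X →ₗ[ℂ] E × X) := by
    refine (injective_iff_map_eq_zero _).2 fun p hp => ?_
    have h1 : p.1 = 0 := congrArg Prod.fst hp
    have h2 : G (fderiv ℂ Φ 0 p) = 0 := congrArg Prod.snd hp
    have h3 : p = (0, p.2) := Prod.ext h1 rfl
    rw [h3, hG] at h2
    exact Prod.ext h1 h2
  let D' : (E × X) ≃L[ℂ] (E × X) := (LinearEquiv.ofInjectiveEndo _ hDi).toContinuousLinearEquiv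
  have hD' : HasFDerivAt Ξ (D' : E × X →L[ℂ] E × X) 0 := by
    have h1 : (D' : E × X →L[ℂ] E × X) = D := ContinuousLinearMap.ext fun p => rfl
    rwa [h1]
  have hc : ContDiffAt ℂ ω Ξ 0 := hΞ.contDiffAt
  have hinv := hc.to_localInverse hD' (by simp)
  have hleft := (hc.hasStrictFDerivAt' hD' (by simp)).eventually_left_inverse
  have hΞ0 : Ξ 0 = 0 := Prod.ext rfl (by simp [Ξ, h0])
  have himg := hc.localInverse_apply_image hD' (by simp)
  set I := hc.localInverse hD' (by simp) with hI
  rw [hΞ0] at hinv himg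
  refine ⟨fun q => (I (q.2, G q.1)).2, ?_, ?_, ?_⟩
  · have h1 : AnalyticAt ℂ I 0 := hinv.analyticAt
    have h2 : AnalyticAt ℂ (fun q : Y × E => (q.2, G q.1)) 0 :=
      ((ContinuousLinearMap.snd ℂ Y E).prod (G.comp (ContinuousLinearMap.fst ℂ Y E))).analyticAt 0
    exact ((ContinuousLinearMap.snd ℂ E X).analyticAt _).fun_comp
      (AnalyticAt.comp_of_eq h1 h2 (Prod.ext rfl (by simp)))
  · simp only [Prod.snd_zero, Prod.fst_zero, map_zero]
    exact congrArg Prod.snd himg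
  · exact hleft.mono fun p hp => congrArg Prod.snd hp

section Nondegenerate

variable {n d₁ d₂ : ℕ}

def assocL (n m : ℕ) : ((Cn n × Cn n) × Cn m) →L[ℂ] Cn n × Cn n × Cn m :=
  ((ContinuousLinearMap.fst ℂ _ _).comp (ContinuousLinearMap.fst ℂ (Cn n × Cn n) (Cn m))).prod
    (((ContinuousLinearMap.snd ℂ _ _).comp (ContinuousLinearMap.fst ℂ (Cn n × Cn n) (Cn m))).prod
      (ContinuousLinearMap.snd ℂ _ _))

lemma fderiv_derivA_conjQ {Q' : Cn n → Cn n → Cn (d₁ + d₂) → Cn (d₁ + d₂)}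
    (hQ' : IsNormalMap n (d₁ + d₂) Q') (j : Fin (d₁ + d₂)) (bs : List (Fin n)) (i : Fin n) :
    fderiv ℂ (derivA (conjQ n _ Q') j bs) 0 ((0, Pi.single i 1), 0) =
      star (iterDeriv ((((0 : Cn n), Pi.single i (1 : ℂ), (0 : Cn (d₁ + d₂))) :
          Cn n × Cn n × Cn (d₁ + d₂)) ::
        bs.map fun b => (((Pi.single b (1 : ℂ) : Cn n), (0 : Cn n), (0 : Cn (d₁ + d₂))) :
          Cn n × Cn n × Cn (d₁ + d₂)))
      (fun P => Q' P.1 P.2.1 P.2.2 j) 0) := by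
  have hg : AnalyticAt ℂ (fun P : Cn n × Cn n × Cn (d₁ + d₂) => Q' P.1 P.2.1 P.2.2 j) 0 := by
    let L' : (Cn n × Cn n × Cn (d₁ + d₂)) →L[ℂ] (Cn n × Cn n) × Cn (d₁ + d₂) :=
      ((ContinuousLinearMap.fst ℂ _ _).prod ((ContinuousLinearMap.fst ℂ _ _).comp
        (ContinuousLinearMap.snd ℂ (Cn n) (Cn n × Cn (d₁ + d₂))))).prod
        ((ContinuousLinearMap.snd ℂ _ _).comp (ContinuousLinearMap.snd ℂ _ _))
    exact AnalyticAt.comp_of_eq (((ContinuousLinearMap.proj (R := ℂ) (φ := fun _ => ℂ) j).analyticAt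
      _).fun_comp hQ'.an) (L'.analyticAt 0) rfl
  have hg' : AnalyticAt ℂ (fun P : Cn n × Cn n × Cn (d₁ + d₂) => Q' P.1 P.2.1 P.2.2 j)
      (assocL n (d₁ + d₂) 0) := by simpa only [map_zero] using hg
  have hg2 : AnalyticAt ℂ (fun P => (fun P : Cn n × Cn n × Cn (d₁ + d₂) => Q' P.1 P.2.1 P.2.2 j)
      (assocL n (d₁ + d₂) P)) (star 0) := by
    rw [star_zero]
    exact hg'.fun_comp ((assocL n (d₁ + d₂)).analyticAt 0)
  set es : List ((Cn n × Cn n) × Cn (d₁ + d₂)) :=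
    (bs.map fun b => (((Pi.single b 1 : Cn n), (0 : Cn n)), (0 : Cn (d₁ + d₂)))) ++
      [((0, Pi.single i 1), 0)] with hes
  have h1 : fderiv ℂ (derivA (conjQ n _ Q') j bs) 0 ((0, Pi.single i 1), 0) =
      iterDeriv es (fun P => conjQ n _ Q' P.1.1 P.1.2 P.2 j) 0 := by
    rw [hes, iterDeriv_concat]
    rfl
  have h2 := iterDeriv_starConj es hg2
  have h3 : es.map star = es := by
    simp only [hes, List.map_append, List.map_map, List.map_cons, List.map_nil]
    congr 1
    · refine List.map_congr_left fun b _ => ?_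
      simp [Prod.ext_iff]
    · simp [Prod.ext_iff]
  rw [h3, star_zero, iterDeriv_comp_clm (assocL n (d₁ + d₂)) es hg', map_zero] at h2
  rw [h1]
  refine h2.trans (congrArg star (iterDeriv_perm ?_ hg))
  simp only [hes, List.map_append, List.map_map, List.map_cons, List.map_nil]
  exact List.perm_append_singleton _ _

lemma QpLNondeg.eq_zero {l : ℕ} {Q' : Cn n → Cn n → Cn (d₁ + d₂) → Cn (d₁ + d₂)}
    (hnd : QpLNondeg n (d₁ + d₂) l Q') (hQ' : IsNormalMap n (d₁ + d₂) Q') {p : Cn n}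
    (hp : ∀ (j : Fin (d₁ + d₂)) (bs : List (Fin n)), 1 ≤ bs.length → bs.length ≤ l →
      fderiv ℂ (derivA (conjQ n _ Q') j bs) 0 ((0, p), 0) = 0) : p = 0 := by
  let T : Cn n →ₗ[ℂ] ℂ := ∑ i, star (p i) • LinearMap.proj i
  have hT : ∀ w, T w = ∑ i, star (p i) * w i := fun w => by simp [T]
  have h1 : ⊤ ≤ LinearMap.ker T := by
    rw [QpLNondeg] at hnd
    rw [← hnd, Submodule.span_le]
    rintro v ⟨j, β, hβ1, hβ2, rfl⟩
    set bs : List (Fin n) := (List.finRange n).flatMap fun i' => List.replicate (β i') i' with hbs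
    have hlen : bs.length = ∑ i, β i := by
      simp [hbs, List.length_flatMap, List.sum_ofFn, ← List.ofFn_eq_map]
    have h2 := hp j bs (by omega) (by omega)
    have h3 : (((0 : Cn n), p), (0 : Cn (d₁ + d₂))) =
        ∑ i, p i • (((0 : Cn n), (Pi.single i 1 : Cn n)), (0 : Cn (d₁ + d₂))) := by
      refine Prod.ext (Prod.ext ?_ ?_) ?_
      · simp [Prod.fst_sum]
      · simp only [Prod.fst_sum, Prod.snd_sum, Prod.smul_fst, Prod.smul_snd]
        exact pi_eq_sum_univ' p
      · simp [Prod.snd_sum]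
    rw [h3, map_sum] at h2
    simp only [map_smul, fderiv_derivA_conjQ hQ'] at h2
    rw [SetLike.mem_coe, LinearMap.mem_ker, hT, ← star_eq_zero, star_sum, ← h2]
    refine Finset.sum_congr rfl fun i _ => ?_
    simp only [hbs, List.map_flatMap, List.map_replicate, star_mul', star_star, smul_eq_mul]
  funext i
  have h2 : T (Pi.single i 1) = 0 :=
    LinearMap.mem_ker.1 (h1 trivial)
  rw [hT] at h2
  simpa [Pi.single_apply] using h2

end Nondegenerate

section Reflection

variable {n d₁ d₂ l : ℕ} {A B Q' : Cn n → Cn n → Cn (d₁ + d₂) → Cn (d₁ + d₂)}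
  {β : Cn (n + (d₁ + d₂)) × Cn n → Cn (n + (d₁ + d₂))}

lemma IsNormalMap.derivA_zero (hA : IsNormalMap n (d₁ + d₂) A) (j : Fin (d₁ + d₂))
    (bs : List (Fin n)) : derivA A j bs 0 = 0 := by
  let L : Cn n →L[ℂ] (Cn n × Cn n) × Cn (d₁ + d₂) :=
    ((ContinuousLinearMap.id ℂ (Cn n)).prod 0).prod 0
  have hL : AnalyticAt ℂ (fun P : (Cn n × Cn n) × Cn (d₁ + d₂) => A P.1.1 P.1.2 P.2 j) (L 0) := by
    rw [map_zero]
    exact hA.analyticAt_derivA j []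
  have h1 := iterDeriv_comp_clm L (bs.map fun b => (Pi.single b 1 : Cn n)) hL
  have h2 : (fun f => A (L f).1.1 (L f).1.2 (L f).2 j) =ᶠ[𝓝 0] fun _ => 0 := by
    have : Tendsto L (𝓝 0) (𝓝 0) := by simpa only [map_zero] using L.continuous.tendsto 0
    filter_upwards [this.eventually hA.nrm] with f hf
    exact congrFun hf.1 j
  rw [AnalyticAt.iterDeriv_eq_zero (hL.fun_comp (L.analyticAt 0))
    (h2.trans_isBigO (isBigO_zero _ _)) (Nat.lt_succ_self _), map_zero] at h1
  rw [derivA, h1, List.map_map]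
  rfl

lemma IsNormalMap.fderiv_derivA_nil (hA : IsNormalMap n (d₁ + d₂) A) (j : Fin (d₁ + d₂))
    (p : Cn n) (q : Cn (d₁ + d₂)) : fderiv ℂ (derivA A j []) 0 ((0, p), q) = q j := by
  let L : (Cn n × Cn (d₁ + d₂)) →L[ℂ] (Cn n × Cn n) × Cn (d₁ + d₂) :=
    ((0 : (Cn n × Cn (d₁ + d₂)) →L[ℂ] Cn n).prod (ContinuousLinearMap.fst ℂ _ _)).prod
      (ContinuousLinearMap.snd ℂ _ _)
  let P : (Cn n × Cn (d₁ + d₂)) →L[ℂ] ℂ :=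
    (ContinuousLinearMap.proj (R := ℂ) (φ := fun _ => ℂ) j).comp (ContinuousLinearMap.snd ℂ _ _)
  have hL : AnalyticAt ℂ (derivA A j []) (L 0) := by
    simpa only [map_zero] using hA.analyticAt_derivA j []
  have h2 : (fun x => derivA A j [] (L x)) =ᶠ[𝓝 0] P := by
    have : Tendsto L (𝓝 0) (𝓝 0) := by simpa only [map_zero] using L.continuous.tendsto 0
    filter_upwards [this.eventually hA.nrm] with f hf
    exact congrFun hf.2 j
  have h3 := (hL.differentiableAt.hasFDerivAt.comp (0 : Cn n × Cn (d₁ + d₂)) L.hasFDerivAt).fderiv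
  have h4 : fderiv ℂ (fun x => derivA A j [] (L x)) 0 = _ := h3
  rw [h2.fderiv_eq, ContinuousLinearMap.fderiv, map_zero] at h4
  exact (congrArg (fun T => T (p, q)) h4).symm

/-- The derivatives of `A` used to solve for the first factor. -/
abbrev DerivIdx (n m l : ℕ) : Type := {bs : List (Fin n) // bs.length ≤ l} × Fin m

instance (n l : ℕ) : Fintype {bs : List (Fin n) // bs.length ≤ l} :=
  (List.finite_length_le (Fin n) l).fintype

/-- The components of `H` are analytic functions of the derivatives of `A` along `(H, H̄)`. -/
lemma QpLNondeg.exists_solution (hnd : QpLNondeg n (d₁ + d₂) l Q')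
    (hQ' : IsNormalMap n (d₁ + d₂) Q') :
    ∃ S : (DerivIdx n (d₁ + d₂) l → ℂ) × Cn n → Cn n × Cn (d₁ + d₂), AnalyticAt ℂ S 0 ∧ S 0 = 0 ∧
      ∀ᶠ P in 𝓝 (0 : (Cn n × Cn n) × Cn (d₁ + d₂)),
        S (fun i => derivA (conjQ n _ Q') i.2 i.1.1 P, P.1.1) = (P.1.2, P.2) := by
  have hA := hQ'.conj
  let L : (Cn n × (Cn n × Cn (d₁ + d₂))) →L[ℂ] (Cn n × Cn n) × Cn (d₁ + d₂) :=
    ((ContinuousLinearMap.fst ℂ _ _).prod ((ContinuousLinearMap.fst ℂ _ _).comp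
      (ContinuousLinearMap.snd ℂ (Cn n) (Cn n × Cn (d₁ + d₂))))).prod
      ((ContinuousLinearMap.snd ℂ _ _).comp (ContinuousLinearMap.snd ℂ _ _))
  have hL : ∀ i : DerivIdx n (d₁ + d₂) l,
      AnalyticAt ℂ (derivA (conjQ n _ Q') i.2 i.1.1) (L 0) := fun i => by
    simpa only [map_zero] using hA.analyticAt_derivA i.2 i.1.1
  have hΦ : AnalyticAt ℂ (fun x (i : DerivIdx n (d₁ + d₂) l) =>
      derivA (conjQ n _ Q') i.2 i.1.1 (L x)) 0 :=
    AnalyticAt.pi fun i => (hL i).fun_comp (L.analyticAt 0)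
  obtain ⟨S, hS, hS0, hS1⟩ := exists_analyticAt_left_inverse hΦ
    (funext fun i => by
      simpa only [map_zero, Pi.zero_apply] using hA.derivA_zero i.2 i.1.1) (by
      rintro ⟨p, q⟩ hx
      have h1 : ∀ (bs : List (Fin n)) (j : Fin (d₁ + d₂)), bs.length ≤ l →
          fderiv ℂ (derivA (conjQ n _ Q') j bs) 0 ((0, p), q) = 0 := fun bs j hbs => by
        have h2 := congrFun hx (⟨bs, hbs⟩, j)
        rw [fderiv_apply_pi hΦ.differentiableAt] at h2
        have h3 := ((hL (⟨bs, hbs⟩, j)).differentiableAt.hasFDerivAt.comp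
          (0 : Cn n × (Cn n × Cn (d₁ + d₂))) L.hasFDerivAt).fderiv
        have h4 : fderiv ℂ (fun x => derivA (conjQ n _ Q') j bs (L x)) 0 = _ := h3
        rw [h4, map_zero] at h2
        exact h2
      have hq : q = 0 := funext fun j => by
        rw [← hA.fderiv_derivA_nil j p q]
        exact h1 [] j (Nat.zero_le _)
      subst hq
      exact Prod.ext (hnd.eq_zero hQ' fun j bs _ h => h1 bs j h) rfl)
  refine ⟨S, hS, hS0, ?_⟩
  let L' : ((Cn n × Cn n) × Cn (d₁ + d₂)) →L[ℂ] Cn n × (Cn n × Cn (d₁ + d₂)) :=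
    assocL n (d₁ + d₂)
  have : Tendsto L' (𝓝 0) (𝓝 0) := by simpa only [map_zero] using L'.continuous.tendsto 0
  exact this.eventually hS1

/-- Each component of `H` is represented by a ring element vanishing at the base. -/
theorem QpLNondeg.exists_rep (hnd : QpLNondeg n (d₁ + d₂) l Q')
    (hQ' : IsNormalMap n (d₁ + d₂) Q') (hβ : IsNiceBeta n d₁ d₂ β) (i : Fin (n + (d₁ + d₂))) :
    ∃ Ψ : W0 n d₁ d₂ l × W1 n d₁ d₂ l → ℂ,
      JetRep (conjQ n _ Q') B β l (fun H _ y => H y.1 i) Ψ ∧ ∀ x0, Ψ (x0, 0) = 0 := by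
  obtain ⟨S, hS, hS0, hS1⟩ := hnd.exists_solution hQ'
  have hΘ : ∀ a : DerivIdx n (d₁ + d₂) l, ∃ Θ : W0 n d₁ d₂ l × W1 n d₁ d₂ l → ℂ,
      JetRep (conjQ n _ Q') B β l
        (fun H K y => derivA (conjQ n _ Q') a.2 a.1.1 (argX β H K y)) Θ ∧
      ∀ x0, Θ (x0, 0) = 0 := fun a => by
    obtain ⟨Θ, h1, h2, -⟩ := exists_rep_derivA (B := B) hβ hQ'.conj a.2 _ a.1.1 rfl
    exact ⟨_, h1.lift a.1.2, fun x0 => (h2.lift (W' := subK n d₁ d₂ l) truncW_mem_subK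
      x0).self_of_nhds (mem_subK_base _ _)⟩
  choose Θ hΘ1 hΘ2 using hΘ
  let L : Fin n → (W0 n d₁ d₂ l × W1 n d₁ d₂ l) →L[ℂ] ℂ := fun b =>
    (ContinuousLinearMap.proj (R := ℂ) (φ := fun _ => ℂ) b).comp (fL n d₁ d₂ l)
  let J : (DerivIdx n (d₁ + d₂) l ⊕ Fin n → ℂ) →L[ℂ] (DerivIdx n (d₁ + d₂) l → ℂ) × Cn n :=
    (ContinuousLinearMap.pi fun a => ContinuousLinearMap.proj (Sum.inl a)).prod
      (ContinuousLinearMap.pi fun a => ContinuousLinearMap.proj (Sum.inr a))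
  let T : Cn n × Cn (d₁ + d₂) →L[ℂ] ℂ :=
    (ContinuousLinearMap.proj (R := ℂ) (φ := fun _ => ℂ) i).comp (appendL n (d₁ + d₂))
  have hg : AnalyticAt ℂ (fun c => T (S (J c))) fun _ => 0 :=
    (T.analyticAt _).fun_comp (AnalyticAt.comp_of_eq hS (J.analyticAt _) (map_zero J))
  have hrep : ∀ a : DerivIdx n (d₁ + d₂) l ⊕ Fin n, JetRep (conjQ n _ Q') B β l
      (fun H K y => Sum.elim (fun a => derivA (conjQ n _ Q') a.2 a.1.1 (argX β H K y))
        (Fpart n d₁ d₂ K (β y)) a) fun v => Sum.elim (fun a => Θ a v) (fun b => L b v) a := by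
    rintro (a | b)
    · exact hΘ1 a
    · exact (memRing_linear (L b)).jetRep hβ
  have hbase : ∀ (a : DerivIdx n (d₁ + d₂) l ⊕ Fin n) (x0 : W0 n d₁ d₂ l),
      Sum.elim (fun a => Θ a (x0, 0)) (fun b => L b (x0, 0)) a = 0 := by
    rintro (a | b) x0
    · exact hΘ2 a x0
    · rfl
  refine ⟨_, (JetRep.comp hβ hrep hbase hg).congr fun k H K hk hd h => ?_, fun x0 => ?_⟩
  · have ht : Tendsto (argX β H K) (𝓝 0) (𝓝 0) := by
      simpa only [h.argX_zero hβ] using (h.analyticAt_argX hβ).continuousAt.tendsto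
    filter_upwards [ht.eventually hS1] with y hy
    have h1 : T (S (fun i => derivA (conjQ n _ Q') i.2 i.1.1 (argX β H K y),
      (argX β H K y).1.1)) = H y.1 i := by
      rw [hy]
      change appendL n (d₁ + d₂) (zPart n d₁ d₂ (H y.1), wfPart n d₁ d₂ (H y.1)) i = _
      rw [appendL_apply, append_zPart_wfPart]
    exact h1
  · simp only [hbase]
    change T (S (J 0)) = 0
    rw [map_zero, hS0, map_zero]

end Reflection

section Components

variable {n d₁ d₂ l : ℕ} {A B Q' : Cn n → Cn n → Cn (d₁ + d₂) → Cn (d₁ + d₂)}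
  {β : Cn (n + (d₁ + d₂)) × Cn n → Cn (n + (d₁ + d₂))}

lemma QpLNondeg.one_le_or (hnd : QpLNondeg n (d₁ + d₂) l Q')
    (hQ' : IsNormalMap n (d₁ + d₂) Q') : 1 ≤ l ∨ n = 0 := by
  by_contra! h
  have h1 := congrFun (hnd.eq_zero hQ' (p := fun _ => 1) fun j bs h1 h2 => by omega)
    ⟨0, Nat.pos_of_ne_zero h.2⟩
  exact one_ne_zero h1

lemma mderivIdx_of_eq_zero {N m : ℕ} {F : Type*} [NormedAddCommGroup F] [NormedSpace ℂ F]
    (idx : Fin m → Fin N) {α : Fin m → ℕ} (hα : ∀ i, α i = 0) (f : Cn N → F) :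
    mderivIdx m idx α f = f := by
  have h : ((List.finRange m).flatMap fun i =>
      List.replicate (α i) ((Pi.single (idx i) (1:ℂ) : Cn N))) = [] := by
    simp [hα]
  rw [mderivIdx, h]
  rfl

lemma length_dirList {N m : ℕ} (idx : Fin m → Fin N) (α : Fin m → ℕ) :
    ((List.finRange m).flatMap fun i =>
      List.replicate (α i) ((Pi.single (idx i) (1:ℂ) : Cn N))).length = ∑ i, α i := by
  simp [List.length_flatMap, ← List.sum_ofFn, List.ofFn_eq_map]

/-- Partial derivatives in `Z` of represented expressions are represented. -/
lemma JetRep.exists_mderivIdx (hβ : IsNiceBeta n d₁ d₂ β) {s t m p : ℕ}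
    {g : (Cn (n + (d₁ + d₂)) → Cn (n + (d₁ + d₂))) → Cn (n + (d₁ + d₂)) → Cn p}
    (hg : ∀ H : Cn (n + (d₁ + d₂)) → Cn (n + (d₁ + d₂)), AnalyticAt ℂ H 0 → AnalyticAt ℂ (g H) 0)
    {i : Fin p} {Ψ : W0 n d₁ d₂ s × W1 n d₁ d₂ s → ℂ}
    (h : JetRep A B β s (fun H _ y => g H y.1 i) Ψ) (hs : 1 ≤ s ∨ n = 0)
    (idx : Fin m → Fin (n + (d₁ + d₂))) (α : Fin m → ℕ) (hst : s + ∑ i, α i ≤ t) :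
    ∃ Ψ' : W0 n d₁ d₂ t × W1 n d₁ d₂ t → ℂ,
      JetRep A B β t (fun H _ y => mderivIdx m idx α (g H) y.1 i) Ψ' ∧
      (VanOn (subI n d₁ d₂ s) Ψ → (∀ i, ∃ z', Pi.single (idx i) 1 = embL n (d₁ + d₂) z') →
        VanOn (subI n d₁ d₂ t) Ψ') := by
  set vs := (List.finRange m).flatMap fun i =>
      List.replicate (α i) ((Pi.single (idx i) (1:ℂ) : Cn (n + (d₁ + d₂)))) with hvs
  obtain ⟨Ψ', h1, h2⟩ := h.exists_iterDeriv (t := t) hβ (vs.map fun v => (v, (0 : Cn n))) hs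
    (by rw [List.length_map, length_dirList]; exact hst)
  refine ⟨Ψ', h1.congr fun k H K hk hd hA => ?_, fun hv hz => h2 hv fun e he => ?_⟩
  · have ht : Tendsto (fun y : Cn (n + (d₁ + d₂)) × Cn n => y.1) (𝓝 0) (𝓝 0) :=
      continuous_fst.tendsto 0
    filter_upwards [ht.eventually (hg H hA.anH).eventually_analyticAt] with y hy
    let P := ContinuousLinearMap.proj (R := ℂ) (φ := fun _ : Fin p => ℂ) i
    have h3 := iterDeriv_clm_comp P vs hy
    have h4 := iterDeriv_comp_clm (ContinuousLinearMap.fst ℂ (Cn (n + (d₁ + d₂))) (Cn n))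
      (vs.map fun v => (v, (0 : Cn n))) (f := fun Z => P (g H Z)) (x := y)
      ((P.analyticAt _).fun_comp hy)
    have h5 : (vs.map fun v => (v, (0 : Cn n))).map
        (ContinuousLinearMap.fst ℂ (Cn (n + (d₁ + d₂))) (Cn n)) = vs := by
      rw [List.map_map]
      exact List.map_id _
    rw [h5] at h4
    exact h4.trans h3
  · obtain ⟨v, hv, rfl⟩ := List.mem_map.1 he
    obtain ⟨j, -, hj⟩ := List.mem_flatMap.1 hv
    obtain ⟨z', hz'⟩ := hz j
    exact ⟨z', by rw [← hz', List.eq_of_mem_replicate hj]⟩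

/-- The components of `G` are represented by ring elements vanishing along `subI`. -/
lemma QpLNondeg.exists_rep_gpart (hnd : QpLNondeg n (d₁ + d₂) l Q')
    (hQ' : IsNormalMap n (d₁ + d₂) Q') (hβ : IsNiceBeta n d₁ d₂ β) (j : Fin (d₁ + d₂)) :
    ∃ Ψ : W0 n d₁ d₂ l × W1 n d₁ d₂ l → ℂ,
      JetRep (conjQ n _ Q') Q' β l (fun H _ y => Gpart n d₁ d₂ H y.1 j) Ψ ∧
      VanOn (subI n d₁ d₂ l) Ψ := by
  choose ΨF hF hF0 using fun a : Fin n => hnd.exists_rep (B := Q') hQ' hβ (zIdx n d₁ d₂ a)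
  let Γ : (W0 n d₁ d₂ l × W1 n d₁ d₂ l) →L[ℂ] Cn (d₁ + d₂) :=
    (getJ l n (d₁ + d₂) 0).comp (gamL n d₁ d₂ l)
  let J : (Fin n ⊕ Fin n ⊕ Fin (d₁ + d₂) → ℂ) →L[ℂ] (Cn n × Cn n) × Cn (d₁ + d₂) :=
    ((ContinuousLinearMap.pi fun a => ContinuousLinearMap.proj (Sum.inl a)).prod
      (ContinuousLinearMap.pi fun a => ContinuousLinearMap.proj (Sum.inr (Sum.inl a)))).prod
      (ContinuousLinearMap.pi fun a => ContinuousLinearMap.proj (Sum.inr (Sum.inr a)))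
  have hg : AnalyticAt ℂ (fun c => Q' (J c).1.1 (J c).1.2 (J c).2 j) fun _ => 0 :=
    ((ContinuousLinearMap.proj (R := ℂ) (φ := fun _ => ℂ) j).analyticAt _).fun_comp
      (AnalyticAt.comp_of_eq hQ'.an (J.analyticAt _) (map_zero J))
  have hGL : ∀ K y, Γ (tMap β l K y) = Gpart n d₁ d₂ K (β y) := fun K y => by
    have h1 : Γ (tMap β l K y) = mderivIdx n (zIdx n d₁ d₂) 0
      (fun W => Gpart n d₁ d₂ K W) (β y) := getJ_multiJet (by simp)
    exact h1.trans (congrFun (mderivIdx_of_eq_zero _ (fun _ => rfl) _) _)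
  have hrep : ∀ a : Fin n ⊕ Fin n ⊕ Fin (d₁ + d₂), JetRep (conjQ n _ Q') Q' β l
      (fun H K y => Sum.elim (fun a => H y.1 (zIdx n d₁ d₂ a)) (Sum.elim
        (Fpart n d₁ d₂ K (β y)) (Gpart n d₁ d₂ K (β y))) a)
      fun v => Sum.elim (fun a => ΨF a v) (Sum.elim (fL n d₁ d₂ l v) (Γ v)) a := by
    rintro (a | a | a)
    · exact hF a
    · exact (memRing_clm_apply (fL n d₁ d₂ l) a).jetRep hβ
    · exact ((memRing_clm_apply Γ a).jetRep hβ).congr fun k H K _ _ _ =>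
        Eventually.of_forall fun y => congrFun (hGL K y) a
  have hbase : ∀ (a : Fin n ⊕ Fin n ⊕ Fin (d₁ + d₂)) (x0 : W0 n d₁ d₂ l),
      Sum.elim (fun a => ΨF a (x0, 0)) (Sum.elim (fL n d₁ d₂ l (x0, 0)) (Γ (x0, 0))) a = 0 := by
    rintro (a | a | a) x0
    · exact hF0 a x0
    · rfl
    · exact congrFun (map_zero (getJ l n (d₁ + d₂) 0)) a
  have hcomp := JetRep.comp hβ hrep hbase hg
  refine ⟨_, ⟨hcomp.mem, fun k H K hk hd hA => ?_, fun k H K hk hd hA => ?_⟩, fun x0 => ?_⟩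
  · exact analyticAt_comp_fst (((ContinuousLinearMap.proj (R := ℂ)
      (φ := fun _ => ℂ) j).analyticAt _).fun_comp hA.anH.gpart)
  · refine (((hA.id₂ j).trans (isBigO_pow_of_le (Nat.sub_le k l))).add
      (hcomp.bigO k H K hk hd hA)).congr_left fun y => ?_
    exact sub_add_sub_cancel _ _ _
  · have h1 : Tendsto (fun v => ((fun a => ΨF a v, (0 : Cn n)), (0 : Cn (d₁ + d₂))))
        (𝓝 (x0, 0)) (𝓝 0) := by
      have h2 : ContinuousAt (fun v => ((fun a => ΨF a v, (0 : Cn n)), (0 : Cn (d₁ + d₂))))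
          (x0, 0) :=
        ((continuousAt_pi.2 fun a => ((hF a).mem.analyticAt x0).continuousAt).prodMk
          continuousAt_const).prodMk continuousAt_const
      have h3 := h2.tendsto
      simp only [hF0] at h3
      exact h3
    filter_upwards [h1.eventually hQ'.nrm] with v hv hmem
    obtain ⟨⟨⟨hγ, hf⟩, -⟩, -⟩ := mem_subI.1 hmem
    have h4 : fL n d₁ d₂ l v = 0 := hf
    have h5 : Γ v = 0 := by
      change getJ l n (d₁ + d₂) 0 v.2.1.1 = 0
      rw [hγ, map_zero]
    rw [h4, h5]
    exact congrFun hv.1 j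

end Components

section Assembly

variable {n d₁ d₂ l : ℕ} {Q' : Cn n → Cn n → Cn (d₁ + d₂) → Cn (d₁ + d₂)}
  {β : Cn (n + (d₁ + d₂)) × Cn n → Cn (n + (d₁ + d₂))}
  {K : Cn (n + (d₁ + d₂)) → Cn (n + (d₁ + d₂))}

lemma apply_truncW_base {s t : ℕ}
    {Ψ : W0 n d₁ d₂ s × W1 n d₁ d₂ s → ℂ} (h : ∀ x0, Ψ (x0, 0) = 0) (x0 : W0 n d₁ d₂ t) :
    Ψ (truncW n d₁ d₂ s t (x0, 0)) = 0 := by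
  have h1 : truncW n d₁ d₂ s t (x0, 0) = (trunc0 n d₁ d₂ s t x0, 0) :=
    Prod.ext rfl (map_zero (trunc1 n d₁ d₂ s t))
  rw [h1, h]

lemma QpLNondeg.exists_rep_jetFull (hnd : QpLNondeg n (d₁ + d₂) l Q')
    (hQ' : IsNormalMap n (d₁ + d₂) Q') (hβ : IsNiceBeta n d₁ d₂ β) (r : ℕ)
    (α : MIdx (n + (d₁ + d₂)) r) (i : Fin (n + (d₁ + d₂))) :
    ∃ Ψ : W0 n d₁ d₂ (r + l) × W1 n d₁ d₂ (r + l) → ℂ,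
      JetRep (conjQ n _ Q') Q' β (r + l) (fun H _ y => jetFull _ r H y.1 α i) Ψ ∧
      (r = 0 → ∀ x0, Ψ (x0, 0) = 0) := by
  obtain ⟨Ψ, h, h0⟩ := hnd.exists_rep (B := Q') hQ' hβ i
  by_cases hr : r = 0
  · have hα : ∀ i, (α.1 i : ℕ) = 0 := fun i => by have := (α.1 i).2; omega
    refine ⟨_, (h.lift (Nat.le_add_left l r)).congr fun k H K _ _ _ =>
      Eventually.of_forall fun y => ?_, fun _ x0 => apply_truncW_base h0 x0⟩
    exact (congrFun (congrFun (mderivIdx_of_eq_zero id hα H) y.1) i).symm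
  · obtain ⟨Ψ', h', -⟩ := JetRep.exists_mderivIdx (g := fun H => H) (t := r + l) hβ
      (fun _ hH => hH) h (hnd.one_le_or hQ') id (fun i => (α.1 i : ℕ)) (by have := α.2; omega)
    exact ⟨Ψ', h', fun h => absurd h hr⟩

lemma QpLNondeg.exists_rep_jetZG (hnd : QpLNondeg n (d₁ + d₂) l Q')
    (hQ' : IsNormalMap n (d₁ + d₂) Q') (hβ : IsNiceBeta n d₁ d₂ β) (r : ℕ)
    (ν : MIdx n r) (j : Fin (d₁ + d₂)) :
    ∃ Ψ : W0 n d₁ d₂ (r + l) × W1 n d₁ d₂ (r + l) → ℂ,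
      JetRep (conjQ n _ Q') Q' β (r + l) (fun H _ y => jetZG n d₁ d₂ r H y.1 ν j) Ψ ∧
      ∀ x0, Ψ (x0, 0) = 0 := by
  obtain ⟨Ψ, h, h0⟩ := hnd.exists_rep_gpart hQ' hβ j
  obtain ⟨Ψ', h', h1⟩ := JetRep.exists_mderivIdx (g := fun H W => Gpart n d₁ d₂ H W) (t := r + l)
    hβ (fun _ hH => hH.gpart) h (hnd.one_le_or hQ') (zIdx n d₁ d₂) (fun i => (ν.1 i : ℕ))
    (by have := ν.2; omega)
  exact ⟨Ψ', h', fun x0 => (h1 h0 fun i => ⟨_, (embL_single i).symm⟩) x0 |>.self_of_nhds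
    (mem_subI_base _ _)⟩

/-- The basic identity along the graph of `β`. -/
lemma QpLNondeg.exists_rep_calJ (hnd : QpLNondeg n (d₁ + d₂) l Q')
    (hQ' : IsNormalMap n (d₁ + d₂) Q') (hβ : IsNiceBeta n d₁ d₂ β) (r : ℕ) :
    ∃ Ψ : W0 n d₁ d₂ (r + l) × W1 n d₁ d₂ (r + l) → ESp n d₁ d₂ r,
      MemRingMap _ _ _ Ψ ∧ (∀ x0, (Ψ (x0, 0)).2 = 0) ∧ (r = 0 → ∀ x0, Ψ (x0, 0) = 0) ∧
      ∀ k H K, r + l < k → Adm n d₁ d₂ (conjQ n _ Q') Q' β k H K →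
        (fun y => calJ n d₁ d₂ r H y.1 - Ψ (tMap β (r + l) K y)) =O[𝓝 0]
          fun y => ‖y‖ ^ (k - (r + l)) := by
  choose Ψ₁ h₁ b₁ using hnd.exists_rep_jetFull hQ' hβ r
  choose Ψ₂ h₂ b₂ using hnd.exists_rep_jetZG hQ' hβ r
  choose Ψ₃ h₃ b₃ using fun i => hnd.exists_rep (B := Q') hQ' hβ (zIdx n d₁ d₂ i)
  have h₃' := fun i => (h₃ i).lift (Nat.le_add_left l r)
  have b : ∀ x0 : W0 n d₁ d₂ (r + l), ((fun ν j => Ψ₂ ν j (x0, 0),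
      fun i => Ψ₃ i (truncW n d₁ d₂ l (r + l) (x0, 0))) : JetSp r n (d₁ + d₂) × Cn n) = 0 :=
    fun x0 => Prod.ext (funext fun ν => funext fun j => b₂ ν j x0)
      (funext fun i => apply_truncW_base (b₃ i) x0)
  refine ⟨fun v => (fun α i => Ψ₁ α i v, (fun ν j => Ψ₂ ν j v,
    fun i => Ψ₃ i (truncW n d₁ d₂ l (r + l) v))), ?_, b, fun hr x0 => Prod.ext
      (funext fun α => funext fun i => b₁ α i hr x0) (b x0), fun k H K hk hA => ?_⟩
  · exact (memRingMap_pi fun α => memRingMap_pi fun i => (h₁ α i).mem.memRingMap).prodMk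
      ((memRingMap_pi fun ν => memRingMap_pi fun j => (h₂ ν j).mem.memRingMap).prodMk
        (memRingMap_pi fun i => (h₃' i).mem.memRingMap))
  · have hd : detFz n d₁ d₂ K 0 ≠ 0 := hA.det (by
      have := hnd.one_le_or hQ'
      omega)
    exact ((isBigO_pi.2 fun α => isBigO_pi.2 fun i => (h₁ α i).bigO k H K hk hd hA).prod_left
      ((isBigO_pi.2 fun ν => isBigO_pi.2 fun j => (h₂ ν j).bigO k H K hk hd hA).prod_left
        (isBigO_pi.2 fun i => (h₃' i).bigO k H K hk hd hA)))

lemma AnalyticAt.sig (hK : AnalyticAt ℂ K 0) (hdet : _root_.detFz n d₁ d₂ K 0 ≠ 0) (s : ℕ) :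
    AnalyticAt ℂ (fun p : Cn (n + (d₁ + d₂)) × Cn (n + (d₁ + d₂)) =>
      _root_.sig n d₁ d₂ s K p.1 p.2) 0 := by
  have h2 : AnalyticAt ℂ (fun p : Cn (n + (d₁ + d₂)) × Cn (n + (d₁ + d₂)) => p.2) 0 :=
    analyticAt_snd
  have hJ : AnalyticAt ℂ (jetFull _ s K) 0 := AnalyticAt.multiJet (idx := id) hK
  have hG : AnalyticAt ℂ (jetZG n d₁ d₂ s K) 0 := AnalyticAt.multiJet hK.gpart
  exact ((AnalyticAt.fun_div analyticAt_const (AnalyticAt.comp_of_eq hK.detFz h2 rfl) hdet).prod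
    (AnalyticAt.comp_of_eq hJ h2 rfl)).prod
    (((AnalyticAt.comp_of_eq hG h2 rfl).prod (AnalyticAt.comp_of_eq hK.fpart h2 rfl)).prod
      (h2.prod analyticAt_fst))

lemma AnalyticAt.calJ (hK : AnalyticAt ℂ K 0) (r : ℕ) :
    AnalyticAt ℂ (_root_.calJ n d₁ d₂ r K) 0 :=
  (AnalyticAt.multiJet (idx := id) hK).prod ((AnalyticAt.multiJet hK.gpart).prod hK.fpart)

end Assembly

end

/-- The Basic Identity. -/
theorem statement9 (n d₁ d₂ l : ℕ)
    (Q : Cn n → Cn n → Cn d₁ → Cn d₂ → Cn d₁)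
    (Q' : Cn n → Cn n → Cn (d₁ + d₂) → Cn (d₁ + d₂))
    (M M' : Set (Cn (n + (d₁ + d₂))))
    (hM : IsRASubmanifold (n + (d₁ + d₂)) (d₁ + d₂) M)
    (hM' : IsRASubmanifold (n + (d₁ + d₂)) (d₁ + d₂) M')
    (h0 : (0 : Cn (n + (d₁ + d₂))) ∈ M) (h0' : (0 : Cn (n + (d₁ + d₂))) ∈ M')
    (hQ : QDescribes n d₁ d₂ Q M) (hQ' : QpDescribes n d₁ d₂ Q' M')
    (hnd : QpLNondeg n (d₁ + d₂) l Q') :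
    ∀ r : ℕ, ∃ Ψ : (ℂ × JetSp (r + l) (n + (d₁ + d₂)) (n + (d₁ + d₂))) ×
        ((JetSp (r + l) n (d₁ + d₂) × Cn n) ×
          (Cn (n + (d₁ + d₂)) × Cn (n + (d₁ + d₂)))) → ESp n d₁ d₂ r,
      -- the components of `Ψ^r` are in the ring `R^{r+l}_{2N}`
      MemRingMap _ _ _ Ψ ∧
      -- `Ψ^r` maps `ℂ × E^{r+l}_0 × {0}` into `E^r_0`
      (∀ (θ : ℂ) (Λ : JetSp (r + l) (n + (d₁ + d₂)) (n + (d₁ + d₂))),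
        (Ψ ((θ, Λ), 0)).2 = 0) ∧
      -- and, for `r = 0`, into `(E^0, 0)`
      (r = 0 → ∀ (θ : ℂ) (Λ : JetSp (r + l) (n + (d₁ + d₂)) (n + (d₁ + d₂))),
        Ψ ((θ, Λ), 0) = 0) ∧
      ∀ (k : ℕ) (H : Cn (n + (d₁ + d₂)) → Cn (n + (d₁ + d₂))),
        r + l < k → IsKEquivalence (n + (d₁ + d₂)) (d₁ + d₂) M M' 0 0 k H →
        ∃ R : Cn (n + (d₁ + d₂)) × Cn (n + (d₁ + d₂)) → ESp n d₁ d₂ r,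
          AnalyticAt ℂ R 0 ∧
          -- the basic identity `𝒥^r H(Z) = Ψ^r(1/det F̄_χ(ζ), 𝒥^{r+l}H̄(ζ), ζ, Z) + R(Z,ζ)`
          (∀ᶠ p : Cn (n + (d₁ + d₂)) × Cn (n + (d₁ + d₂)) in nhds 0,
            calJ n d₁ d₂ r H p.1 =
              Ψ ((1 / detFz n d₁ d₂ (conjMap (n + (d₁ + d₂)) H) p.2,
                  jetFull (n + (d₁ + d₂)) (r + l) (conjMap (n + (d₁ + d₂)) H) p.2),
                 ((jetZG n d₁ d₂ (r + l) (conjMap (n + (d₁ + d₂)) H) p.2,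
                   Fpart n d₁ d₂ (conjMap (n + (d₁ + d₂)) H) p.2),
                  (p.2, p.1))) + R p) ∧
          -- the restriction of `R` to `𝓜` vanishes of order `k - r - l` at `0`
          ∃ C ε : ℝ, 0 < ε ∧
            ∀ p : Cn (n + (d₁ + d₂)) × Cn (n + (d₁ + d₂)),
              cxRel n d₁ d₂ Q p.1 p.2 → ‖p‖ < ε →
                ‖R p‖ ≤ C * ‖p‖ ^ (k - r - l) := by
  intro r
  have hβ := isNiceBeta_betaMap hQ
  obtain ⟨Ψ, hΨ, hb, hb0, hO⟩ := hnd.exists_rep_calJ hQ'.isNormalMap hβ r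
  refine ⟨Ψ, hΨ, fun θ Λ => hb (θ, Λ), fun hr θ Λ => hb0 hr (θ, Λ), fun k H hk hH => ?_⟩
  have hA := hH.adm hM' h0' hQ hQ'
  set K := conjMap (n + (d₁ + d₂)) H
  have hd : detFz n d₁ d₂ K 0 ≠ 0 := hA.det (by
    have := hnd.one_le_or hQ'.isNormalMap
    omega)
  refine ⟨fun p => calJ n d₁ d₂ r H p.1 - Ψ (sig n d₁ d₂ (r + l) K p.1 p.2), ?_,
    Filter.Eventually.of_forall fun p => (add_sub_cancel _ _).symm, ?_⟩
  · obtain ⟨x0, hx0⟩ := hA.sig_zero hk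
    have h1 : AnalyticAt ℂ Ψ (sig n d₁ d₂ (r + l) K 0 0) := by
      rw [hx0]
      exact hΨ.analyticAt x0
    exact (analyticAt_comp_fst (hA.anH.calJ r)).sub
      (AnalyticAt.comp_of_eq h1 (hA.anK.sig hd (r + l)) rfl)
  · obtain ⟨-, -, -, Ω, Zp, hZ, -⟩ := hH
    obtain ⟨C, hC0, hC⟩ := (hO k H K hk hA).exists_pos
    have ht : Filter.Tendsto (fun p : Cn (n + (d₁ + d₂)) × Cn (n + (d₁ + d₂)) =>
        (p.1, zPart n d₁ d₂ p.2)) (nhds 0) (nhds 0) :=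
      (continuous_fst.prodMk (zPart_continuous.comp continuous_snd)).tendsto 0
    obtain ⟨ε, hε, h⟩ := Metric.eventually_nhds_iff.1
      ((cxRel_iff_betaMap hQ hZ).and (ht.eventually hC.bound))
    refine ⟨C, ε, hε, fun p hp hpε => ?_⟩
    obtain ⟨h1, h2⟩ := h (y := p) (by rwa [dist_zero_right])
    have h3 : tMap (betaMap n d₁ d₂ Q) (r + l) K (p.1, zPart n d₁ d₂ p.2) =
        sig n d₁ d₂ (r + l) K p.1 p.2 := by
      rw [tMap, ← h1 hp]
    rw [h3, norm_pow, norm_norm, ← Nat.sub_sub] at h2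
    refine h2.trans (mul_le_mul_of_nonneg_left (pow_le_pow_left₀ (norm_nonneg _) ?_ _) hC0.le)
    exact max_le_max le_rfl ((pi_norm_le_iff_of_nonneg (norm_nonneg _)).2
      fun i => norm_le_pi_norm p.2 _)
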